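/- In G(𝒜): if y ∈ G(𝒜) satisfies u_c(y,f₁) = e and u_c(y,f₂) = e, but y^{p₁} ≠ e and y^{p₂} ≠ e, then y = c; and if z ∈ G(𝒜) satisfies u_d(z,f₁) = e and u_d(z,f₂) = e, but z^{p₁} ≠ e and z^{p₂} ≠ e, then z = d. -/

import Mathlib

/-!
Common setup: an `L`-structure `𝒜` for a language whose symbols are enumerated
(`m`-th symbol, `m ≥ 1`, each a function or relation symbol of arity ≥ 1), and the
presented group `G(𝒜)` of Harrison-Trainor and Ho.
-/

/-- A first-order language with symbols enumerated by `ℕ` (the `m`-th symbol, for `m ≥ 1`,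
is a function symbol if `isFunc m`, and a relation symbol otherwise, of arity `arity m ≥ 1`),
together with an interpretation on a domain `A`: `funcInterp m` interprets the `m`-th symbol
when it is a function symbol, and `relInterp m` when it is a relation symbol. -/
structure IndexedStructure where
  A : Type
  arity : ℕ → ℕ
  arity_pos : ∀ m, 1 ≤ m → 1 ≤ arity m
  isFunc : ℕ → Prop
  funcInterp : ∀ m, (Fin (arity m) → A) → A
  relInterp : ∀ m, (Fin (arity m) → A) → Prop

/-- The generating set of `G(𝒜)`: one generator for each element of the domain `A`,
plus five further generators `b`, `c`, `d`, `f₁`, `f₂`. -/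
inductive GenSym (A : Type) : Type
  | elt : A → GenSym A
  | b : GenSym A
  | c : GenSym A
  | d : GenSym A
  | f1 : GenSym A
  | f2 : GenSym A

/-- `chainProd lo x y = x y^{(lo+1)²} x y^{(lo+2)²} ⋯ x y^{(lo+1000)²}`.
So `u_A = chainProd 0`, `u_b = chainProd 1000`, `u_c = chainProd 2000`,
`u_d = chainProd 3000`, and `v = chainProd 4000`. -/
def chainProd {G : Type*} [Group G] (lo : ℕ) (x y : G) : G :=
  ((List.range 1000).map fun k => x * y ^ ((lo + k + 1) ^ 2)).prod

/-- `wProd m xs y = x₁⋯xₙ y^{100m+1} x₁⋯xₙ y^{100m+2} ⋯ x₁⋯xₙ y^{100m+100}`,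
i.e. the word `w_m(x₁,…,xₙ,y)`. -/
def wProd {G : Type*} [Group G] (m : ℕ) {n : ℕ} (xs : Fin n → G) (y : G) : G :=
  ((List.range 100).map fun k => (List.ofFn xs).prod * y ^ (100 * m + k + 1)).prod

/-- The set of relators of the presentation of `G(𝒜)`. -/
def grpRels (S : IndexedStructure) (p₁ p₂ : ℕ) : Set (FreeGroup (GenSym S.A)) :=
  {FreeGroup.of GenSym.f1 ^ p₁, FreeGroup.of GenSym.f2 ^ p₂,
    chainProd 4000 (FreeGroup.of GenSym.f1) (FreeGroup.of GenSym.f2),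
    chainProd 4000 (FreeGroup.of GenSym.f2) (FreeGroup.of GenSym.f1),
    chainProd 1000 (FreeGroup.of GenSym.b) (FreeGroup.of GenSym.f1),
    chainProd 1000 (FreeGroup.of GenSym.b) (FreeGroup.of GenSym.f2),
    chainProd 2000 (FreeGroup.of GenSym.c) (FreeGroup.of GenSym.f1),
    chainProd 2000 (FreeGroup.of GenSym.c) (FreeGroup.of GenSym.f2),
    chainProd 3000 (FreeGroup.of GenSym.d) (FreeGroup.of GenSym.f1),
    chainProd 3000 (FreeGroup.of GenSym.d) (FreeGroup.of GenSym.f2)}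
  ∪ {r | ∃ a : S.A,
      r = chainProd 0 (FreeGroup.of (GenSym.elt a)) (FreeGroup.of GenSym.c) ∨
      r = chainProd 0 (FreeGroup.of (GenSym.elt a)) (FreeGroup.of GenSym.d)}
  ∪ {r | ∃ m, 1 ≤ m ∧ S.isFunc m ∧ ∃ as : Fin (S.arity m) → S.A,
      r = wProd m (fun i => FreeGroup.of (GenSym.elt (as i))) (FreeGroup.of GenSym.b) *
        (FreeGroup.of (GenSym.elt (S.funcInterp m as)))⁻¹}
  ∪ {r | ∃ m, 1 ≤ m ∧ ¬ S.isFunc m ∧ ∃ as : Fin (S.arity m) → S.A,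
      S.relInterp m as ∧
      r = wProd m (fun i => FreeGroup.of (GenSym.elt (as i))) (FreeGroup.of GenSym.b)}

/-- The group `G(𝒜)`, presented on the generators `GenSym A` with relators `grpRels`. -/
abbrev GA (S : IndexedStructure) (p₁ p₂ : ℕ) : Type :=
  PresentedGroup (grpRels S p₁ p₂)

/-- The image in `G(𝒜)` of a generator. -/
def gen (S : IndexedStructure) (p₁ p₂ : ℕ) (g : GenSym S.A) : GA S p₁ p₂ :=
  PresentedGroup.of g


section Part1
open FreeGroup
section words
variable {α : Type*}

/-- inverse letter -/
def ilt (x : α × Bool) : α × Bool := (x.1, !x.2)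

theorem ilt_ilt (x : α × Bool) : ilt (ilt x) = x := by simp [ilt]
theorem ilt_ne (x : α × Bool) : ilt x ≠ x := by
  intro h; have := congrArg Prod.snd h; simp [ilt] at this
theorem mk_pair (x : α × Bool) : FreeGroup.mk [x, ilt x] = 1 := by
  have h : FreeGroup.Red.Step ([] ++ (x.1, x.2) :: (x.1, !x.2) :: []) ([] ++ []) := FreeGroup.Red.Step.not
  exact Quot.sound h
theorem mk_ilt (x : α × Bool) : FreeGroup.mk [ilt x] = (FreeGroup.mk [x])⁻¹ := by
  rw [eq_inv_iff_mul_eq_one, FreeGroup.mul_mk]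
  simpa [ilt_ilt] using mk_pair (ilt x)
theorem invRev_cons' (x : α × Bool) (l : List (α × Bool)) :
    FreeGroup.invRev (x :: l) = FreeGroup.invRev l ++ [ilt x] := by
  simp [FreeGroup.invRev, ilt]
theorem mk_append (a b : List (α × Bool)) : FreeGroup.mk (a ++ b) = FreeGroup.mk a * FreeGroup.mk b := by
  rw [FreeGroup.mul_mk]
theorem mk_cons (x : α × Bool) (b : List (α × Bool)) : FreeGroup.mk (x :: b) = FreeGroup.mk [x] * FreeGroup.mk b := by
  rw [FreeGroup.mul_mk]; rfl

/-- symmetrized set with small cancellation -/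
structure SymR (R : Set (List (α × Bool))) : Prop where
  ne : ∀ r ∈ R, r ≠ []
  red : ∀ r ∈ R, FreeGroup.IsReduced r
  inv : ∀ r ∈ R, FreeGroup.invRev r ∈ R
  rot : ∀ u v, u ++ v ∈ R → v ++ u ∈ R
  piece : ∀ q t1 t2, q ++ t1 ∈ R → q ++ t2 ∈ R → (q ++ t1).length < 15 * q.length → t1 = t2

variable (R : Set (List (α × Bool)))

/-- products of `k` conjugates of relators -/
inductive Prd : ℕ → FreeGroup α → Prop
  | one : Prd 0 1
  | mul (k : ℕ) (g c : FreeGroup α) (r : List (α × Bool)) : Prd k g → r ∈ R →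
      Prd (k + 1) (g * (c * FreeGroup.mk r * c⁻¹))

inductive Ins : ℕ → List (α × Bool) → List (α × Bool) → Prop
  | zero (w : List (α × Bool)) : Ins 0 w w
  | succ (n : ℕ) (w X Y r : List (α × Bool)) : Ins n w (X ++ Y) → r ∈ R → Ins (n + 1) w (X ++ r ++ Y)

variable {R}

theorem Prd.mul' {k l : ℕ} {g h : FreeGroup α} (hg : Prd R k g) (hh : Prd R l h) : Prd R (k + l) (g * h) := by
  induction hh with
  | one => simpa using hg
  | mul l h c r _ hr ih => rw [← mul_assoc]; exact Prd.mul _ _ c r ih hr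

theorem Prd.conj {k : ℕ} {g : FreeGroup α} (c : FreeGroup α) (hg : Prd R k g) : Prd R k (c * g * c⁻¹) := by
  induction hg with
  | one => simpa using Prd.one
  | mul l h d r _ hr ih =>
    have := Prd.mul _ _ (c * d) r ih hr
    convert this using 1; group

theorem Prd.single {r : List (α × Bool)} (hr : r ∈ R) : Prd R 1 (FreeGroup.mk r) := by
  simpa using Prd.mul 0 1 1 r Prd.one hr

theorem Prd.inv (hR : SymR R) {k : ℕ} {g : FreeGroup α} (hg : Prd R k g) : Prd R k g⁻¹ := by
  induction hg with
  | one => simpa using Prd.one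
  | mul l h d r _ hr ih =>
    have h1 := (Prd.single (hR.inv r hr)).conj d
    have h2 := h1.mul' ih
    rw [add_comm] at h2
    convert h2 using 1
    rw [← FreeGroup.inv_mk]; group

theorem Prd.of_normalClosure (hR : SymR R) {g : FreeGroup α}
    (h : g ∈ Subgroup.normalClosure (FreeGroup.mk '' R)) : ∃ k, Prd R k g := by
  let K : Subgroup (FreeGroup α) :=
    { carrier := {g | ∃ k, Prd R k g}
      one_mem' := ⟨0, Prd.one⟩
      mul_mem' := by rintro a b ⟨k, hk⟩ ⟨l, hl⟩; exact ⟨_, hk.mul' hl⟩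
      inv_mem' := by rintro a ⟨k, hk⟩; exact ⟨k, hk.inv hR⟩ }
  have : K.Normal := ⟨by rintro n ⟨k, hk⟩ g; exact ⟨k, hk.conj g⟩⟩
  have : Subgroup.normalClosure (FreeGroup.mk '' R) ≤ K := by
    apply Subgroup.normalClosure_le_normal
    rintro _ ⟨r, hr, rfl⟩
    exact ⟨1, Prd.single hr⟩
  exact this h

/-! insertions -/
theorem Ins.split {N : ℕ} {U V Z : List (α × Bool)} (h : Ins R N (U ++ V) Z) :
    ∃ N1 N2 Z1 Z2, N1 + N2 = N ∧ Z = Z1 ++ Z2 ∧ Ins R N1 U Z1 ∧ Ins R N2 V Z2 := by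
  generalize hw : U ++ V = w at h
  induction h with
  | zero w => subst hw; exact ⟨0, 0, U, V, rfl, rfl, .zero _, .zero _⟩
  | succ n w X Y r h hr ih =>
    obtain ⟨N1, N2, Z1, Z2, rfl, hZ, h1, h2⟩ := ih hw
    rcases List.append_eq_append_iff.1 hZ with ⟨c, rfl, rfl⟩ | ⟨c, rfl, rfl⟩
    · refine ⟨N1 + 1, N2, X ++ r ++ c, Z2, by omega, by simp, .succ _ _ _ _ _ h1 hr, h2⟩
    · refine ⟨N1, N2 + 1, Z1, c ++ r ++ Y, by omega, by simp, h1, .succ _ _ _ _ _ h2 hr⟩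

theorem Ins.single {N : ℕ} {x : α × Bool} {Z : List (α × Bool)} (h : Ins R N [x] Z) :
    ∃ N1 N2 Z1 Z2, N1 + N2 = N ∧ Z = Z1 ++ x :: Z2 ∧ Ins R N1 [] Z1 ∧ Ins R N2 [] Z2 := by
  generalize hw : [x] = w at h
  induction h with
  | zero w => subst hw; exact ⟨0, 0, [], [], rfl, rfl, .zero _, .zero _⟩
  | succ n w X Y r h hr ih =>
    obtain ⟨N1, N2, Z1, Z2, rfl, hZ, h1, h2⟩ := ih hw
    rcases List.append_eq_append_iff.1 hZ with ⟨c, rfl, rfl⟩ | ⟨c, rfl, hc⟩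
    · refine ⟨N1 + 1, N2, X ++ r ++ c, Z2, by omega, by simp, .succ _ _ _ _ _ h1 hr, h2⟩
    · rcases c with _ | ⟨y, c⟩
      · simp at hc
        subst hc
        refine ⟨N1 + 1, N2, Z1 ++ r, Z2, by omega, by simp, ?_, h2⟩
        simpa using Ins.succ N1 [] Z1 [] r (by simpa using h1) hr
      · simp at hc
        obtain ⟨rfl, rfl⟩ := hc
        refine ⟨N1, N2 + 1, Z1, c ++ r ++ Y, by omega, by simp, h1, .succ _ _ _ _ _ h2 hr⟩

theorem Ins.nest {n m : ℕ} {U A B M : List (α × Bool)} (h : Ins R n [] M) (h2 : Ins R m U (A ++ B)) :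
    Ins R (n + m) U (A ++ M ++ B) := by
  generalize hw : ([] : List (α × Bool)) = w at h
  induction h with
  | zero w => subst hw; simpa using h2
  | succ n w X Y r h hr ih =>
    have h3 := ih hw
    have := Ins.succ _ U (A ++ X) (Y ++ B) r (by simpa using h3) hr
    have e : n + 1 + m = n + m + 1 := by omega
    rw [e]; simpa using this

theorem Ins.app {n m : ℕ} {U V A B : List (α × Bool)} (h : Ins R n U A) (h2 : Ins R m V B) :
    Ins R (n + m) (U ++ V) (A ++ B) := by
  induction h with
  | zero w => 
    rw [zero_add]
    induction h2 with
    | zero => exact .zero _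
    | succ n w' X Y r h hr ih =>
      have := Ins.succ n (w ++ w') (w ++ X) Y r (by simpa using ih) hr
      simpa using this
  | succ n w' X Y r h hr ih =>
    have := Ins.succ (n + m) (w' ++ V) X (Y ++ B) r (by simpa using ih) hr
    have e : n + 1 + m = n + m + 1 := by omega
    rw [e]; simpa using this

theorem Ins.rot (hR : SymR R) {N : ℕ} {U V : List (α × Bool)} (h : Ins R N [] (U ++ V)) :
    Ins R N [] (V ++ U) := by
  generalize hw : ([] : List (α × Bool)) = w at h
  generalize hz : U ++ V = Z at h
  induction h generalizing U V with
  | zero w => subst hw; simp at hz; obtain ⟨rfl, rfl⟩ := hz; exact .zero _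
  | succ n w X Y r h hr ih =>
    subst hw
    rcases List.append_eq_append_iff.1 hz with ⟨c, hc, rfl⟩ | ⟨c, rfl, rfl⟩
    · rcases List.append_eq_append_iff.1 hc with ⟨d, rfl, rfl⟩ | ⟨d, rfl, rfl⟩
      · have h1 := ih (U := X) (V := Y) rfl rfl
        have h2 := hR.rot d c hr
        have h3 : Ins R 1 [] (c ++ d) := by simpa using Ins.succ 0 [] [] [] (c ++ d) (.zero _) h2
        have := Ins.nest h1 h3
        simpa using this
      · have := ih (U := U) (V := d ++ Y) rfl (by simp)
        have := Ins.succ _ [] d (Y ++ U) r (by simpa using this) hr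
        simpa using this
    · have := ih (U := X ++ c) (V := V) rfl (by simp)
      have := Ins.succ _ [] (V ++ X) c r (by simpa using this) hr
      simpa using this

/-! free group facts -/
theorem red_single_split {L : List (α × Bool)} {y : α × Bool} (h : FreeGroup.Red L [y]) :
    ∃ C D, L = C ++ y :: D ∧ FreeGroup.mk C = 1 ∧ FreeGroup.mk D = 1 := by
  generalize hw : [y] = w at h
  induction h using Relation.ReflTransGen.head_induction_on with
  | refl => exact ⟨[], [], by simpa using hw.symm, rfl, rfl⟩
  | @head a b hab hbc ih =>
    obtain ⟨C, D, rfl, hC, hD⟩ := ih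
    generalize hb : C ++ y :: D = b' at hab
    cases hab with
    | @not L1 L2 x bb =>
      rcases List.append_eq_append_iff.1 hb with ⟨c, rfl, hc⟩ | ⟨c, rfl, rfl⟩
      · rcases c with _ | ⟨z, c⟩
        · simp at hc
          subst hc
          refine ⟨C ++ [(x, bb), (x, !bb)], D, by simp, ?_, hD⟩
          rw [mk_append, hC, one_mul]; exact mk_pair (x, bb)
        · simp at hc
          obtain ⟨rfl, rfl⟩ := hc
          refine ⟨C, c ++ (x, bb) :: (x, !bb) :: L2, by simp, hC, ?_⟩
          rw [← hD]; exact Quot.sound FreeGroup.Red.Step.not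
      · refine ⟨L1 ++ (x, bb) :: (x, !bb) :: c, D, by simp, ?_, hD⟩
        rw [← hC]; exact Quot.sound FreeGroup.Red.Step.not

theorem head_partner {x : α × Bool} {Q : List (α × Bool)} (h : FreeGroup.mk (x :: Q) = 1) :
    ∃ C D, Q = C ++ ilt x :: D ∧ FreeGroup.mk C = 1 ∧ FreeGroup.mk D = 1 := by
  have h2 : FreeGroup.Red (x :: Q) [] := by
    have := FreeGroup.Red.exact.1 (h.trans FreeGroup.one_eq_mk)
    obtain ⟨c, hc1, hc2⟩ := this
    have := FreeGroup.Red.nil_iff.1 hc2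
    rwa [this] at hc1
  obtain ⟨x1, x2⟩ := x
  have h3 := FreeGroup.Red.cons_nil_iff_singleton.1 h2
  exact red_single_split h3

theorem mk_swap {A B : List (α × Bool)} (h : FreeGroup.mk (A ++ B) = 1) : FreeGroup.mk (B ++ A) = 1 := by
  rw [mk_append] at h ⊢
  exact mul_eq_one_comm.1 h

theorem relocate {x : α × Bool} {M Q : List (α × Bool)}
    (h : FreeGroup.mk (x :: (M ++ ilt x :: Q)) = 1) :
    ∃ M1 M2 Q1 Q2, M = M1 ++ M2 ∧ Q = Q1 ++ Q2 ∧ FreeGroup.mk (Q1 ++ (M2 ++ M1) ++ Q2) = 1 := by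
  obtain ⟨C, D, hCD, hC, hD⟩ := head_partner h
  rcases List.append_eq_append_iff.1 hCD with ⟨c, rfl, hc⟩ | ⟨c, rfl, hc⟩
  · rcases c with _ | ⟨z, c⟩
    · simp at hc
      subst hc
      simp at hC
      exact ⟨M, [], [], Q, by simp, by simp, by simp [mk_append, hC, hD]⟩
    · simp at hc
      obtain ⟨rfl, rfl⟩ := hc
      -- Q = c ++ ilt x :: D, M ++ ilt x :: c = 1
      have h1 : FreeGroup.mk (ilt x :: (c ++ M)) = 1 := by
        have := mk_swap hC; simpa using this
      obtain ⟨A, B, hAB, hA, hB⟩ := head_partner h1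
      rw [ilt_ilt] at hAB
      rcases List.append_eq_append_iff.1 hAB with ⟨e, rfl, rfl⟩ | ⟨e, rfl, he⟩
      · refine ⟨e, x :: B, [], c ++ ilt x :: D, by simp, by simp, ?_⟩
        have : FreeGroup.mk e = (FreeGroup.mk c)⁻¹ := by
          rw [mk_append] at hA; exact eq_inv_of_mul_eq_one_right hA
        rw [List.nil_append, mk_append, mk_append, mk_append, mk_cons x B, mk_cons _ D, hB, hD, mk_ilt, this]; group
      · rcases e with _ | ⟨z, e⟩
        · simp at he
          subst he
          refine ⟨[], x :: B, A, ilt x :: D, by simp, by simp, ?_⟩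
          rw [mk_append, mk_append, mk_append, mk_cons x B, mk_cons _ D, hA, hB, hD, mk_ilt, ← FreeGroup.one_eq_mk]
          group
        · simp at he
          obtain ⟨rfl, rfl⟩ := he
          refine ⟨M, [], A ++ x :: e, ilt x :: D, by simp, by simp, ?_⟩
          rw [mk_append] at hB
          have h5 : FreeGroup.mk e = (FreeGroup.mk M)⁻¹ := eq_inv_of_mul_eq_one_left hB
          rw [List.nil_append, mk_append, mk_append, mk_append, mk_cons x e, mk_cons _ D, hA, hD, mk_ilt, h5]
          group
  · -- M = C ++ ilt x :: c
    rcases c with _ | ⟨z, c⟩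
    · simp at hc
      subst hc
      exact ⟨C, [], [], D, by simp, by simp, by simp [mk_append, hC, hD]⟩
    simp at hc
    obtain ⟨rfl, rfl⟩ := hc
    refine ⟨C ++ [ilt x], c, [], Q, by simp, by simp, ?_⟩
    rw [mk_append, mk_cons] at hD
    rw [List.nil_append, mk_append, mk_append, mk_append, hC, one_mul, mul_assoc, hD]

variable (R) in
def Fill (N : ℕ) (w : List (α × Bool)) : Prop := ∃ Z, Ins R N w Z ∧ FreeGroup.mk Z = 1

theorem Fill.del (hR : SymR R) {N : ℕ} {X Y : List (α × Bool)} {x : α × Bool}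
    (h : Fill R N (X ++ x :: ilt x :: Y)) : Fill R N (X ++ Y) := by
  obtain ⟨Z, hZ, h1⟩ := h
  obtain ⟨N1, N2, Z1, Z2, rfl, rfl, hX, h2⟩ := hZ.split
  obtain ⟨N3, N4, Z3, Z4, rfl, rfl, h3, h4⟩ := Ins.split (U := [x]) h2
  obtain ⟨N5, N6, Z5, Z6, rfl, rfl, h5, h6⟩ := Ins.split (U := [ilt x]) h4
  obtain ⟨n1, n2, A1, A2, rfl, rfl, a1, a2⟩ := h3.single
  obtain ⟨n3, n4, A3, A4, rfl, rfl, a3, a4⟩ := h5.single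
  have e : FreeGroup.mk (x :: ((A2 ++ A3) ++ ilt x :: ((A4 ++ Z6) ++ (Z1 ++ A1)))) = 1 := by
    have := mk_swap (A := Z1 ++ A1) (B := x :: (A2 ++ A3 ++ ilt x :: (A4 ++ Z6))) (by simpa using h1)
    simpa using this
  obtain ⟨M1, M2, Q1, Q2, hM, hQ, hf⟩ := relocate e
  have hMi : Ins R (n2 + n3) [] (A2 ++ A3) := by simpa using a2.app a3
  rw [hM] at hMi
  have hMr := hMi.rot hR
  have hL : Ins R (N1 + n1) X (Z1 ++ A1) := by simpa using hX.app a1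
  have hRr : Ins R (n4 + N6) Y (A4 ++ Z6) := by simpa using a4.app h6
  have hLR := hL.app hRr
  have eN : N1 + (n1 + n2 + (n3 + n4 + N6)) = (n2 + n3) + (N1 + n1 + (n4 + N6)) := by omega
  rw [eN]
  rcases List.append_eq_append_iff.1 hQ with ⟨c, hc1, hc2⟩ | ⟨c, hc1, hc2⟩
  · -- Q1 = (A4++Z6) ++ c, Z1 ++ A1 = c ++ Q2
    rw [hc2] at hLR
    refine ⟨_, Ins.nest hMr (A := c) (B := Q2 ++ (A4 ++ Z6)) (by simpa using hLR), ?_⟩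
    rw [hc1] at hf
    have := mk_swap (A := A4 ++ Z6) (B := c ++ (M2 ++ M1) ++ Q2) (by simpa using hf)
    simpa using this
  · rw [hc1] at hLR
    refine ⟨_, Ins.nest hMr (A := (Z1 ++ A1) ++ Q1) (B := c) (by simpa using hLR), ?_⟩
    rw [hc2] at hf
    have := mk_swap (A := Q1 ++ (M2 ++ M1) ++ c) (B := Z1 ++ A1) (by simpa using hf)
    simpa using this

theorem Fill.add {N : ℕ} {X Y : List (α × Bool)} {x : α × Bool}
    (h : Fill R N (X ++ Y)) : Fill R N (X ++ x :: ilt x :: Y) := by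
  obtain ⟨Z, hZ, h1⟩ := h
  obtain ⟨N1, N2, Z1, Z2, rfl, rfl, hX, h2⟩ := hZ.split
  refine ⟨Z1 ++ x :: ilt x :: Z2, hX.app ?_, ?_⟩
  · simpa using (Ins.zero (R := R) [x, ilt x]).app h2
  · rw [← h1]; obtain ⟨x1, x2⟩ := x; exact Quot.sound FreeGroup.Red.Step.not

theorem Fill.red (hR : SymR R) {N : ℕ} {w w' : List (α × Bool)} (h : FreeGroup.Red w w') :
    Fill R N w ↔ Fill R N w' := by
  induction h with
  | refl => rfl
  | tail _ hs ih =>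
    rw [ih]
    cases hs with
    | @not L1 L2 x b => exact ⟨fun h => Fill.del hR (x := (x, b)) h, fun h => Fill.add (x := (x, b)) h⟩

theorem Fill.congr (hR : SymR R) {N : ℕ} {w w' : List (α × Bool)} (h : FreeGroup.mk w = FreeGroup.mk w')
    (hf : Fill R N w) : Fill R N w' := by
  obtain ⟨c, h1, h2⟩ := FreeGroup.Red.exact.1 h
  exact (Fill.red hR h2).2 ((Fill.red hR h1).1 hf)

theorem Prd.fill (hR : SymR R) {k : ℕ} {g : FreeGroup α} (h : Prd R k g) :
    ∀ w, FreeGroup.mk w = g → Fill R k w := by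
  induction h with
  | one => intro w hw; exact ⟨w, .zero _, hw⟩
  | mul k g c r h hr ih =>
    intro w hw
    obtain ⟨w0, rfl⟩ := Quot.exists_rep g
    obtain ⟨c, rfl⟩ := Quot.exists_rep c
    obtain ⟨Z, hZ, h1⟩ := ih w0 rfl
    have : Fill R (k + 1) (w0 ++ (c ++ r ++ FreeGroup.invRev c)) := by
      have h2 := hZ.app (Ins.zero (R := R) (c ++ r ++ FreeGroup.invRev c))
      refine ⟨_, Ins.succ k _ (Z ++ c ++ r) (FreeGroup.invRev c) (FreeGroup.invRev r) (by simpa using h2) (hR.inv r hr), ?_⟩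
      simp only [mk_append, h1, ← FreeGroup.inv_mk]; group
    refine Fill.congr hR ?_ this
    rw [hw]; simp only [mk_append, ← FreeGroup.inv_mk]; rfl

end words
end Part1


section Part2
open FreeGroup
section nests
variable {α : Type*} {P : Type*}

inductive Nest : List P → List (List P) → List P → Prop
  | base (W : List P) : Nest W [] W
  | ins (W : List P) (Bs : List (List P)) (X Y B : List P) : Nest W Bs (X ++ Y) → Nest W (B :: Bs) (X ++ B ++ Y)

theorem Nest.perm {W : List P} {Bs : List (List P)} {L : List P} (h : Nest W Bs L) :
    L.Perm (W ++ Bs.flatten) := by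
  induction h with
  | base => simp
  | ins Bs X Y B h ih =>
    rw [List.flatten_cons]
    have h1 : (X ++ B ++ Y).Perm (B ++ (X ++ Y)) := by
      rw [← List.append_assoc]
      exact (List.perm_append_comm).append_right Y
    refine h1.trans ((ih.append_left B).trans ?_)
    rw [← List.append_assoc, ← List.append_assoc]
    exact (List.perm_append_comm).append_right _

theorem Nest.lift {R : Set (List (α × Bool))} {N : ℕ} {w Z : List (α × Bool)} (h : Ins R N w Z) (ℓ : P → α × Bool) :
    ∀ L : List P, L.map ℓ = Z → ∃ W Bs, Nest W Bs L ∧ W.map ℓ = w ∧ (∀ B ∈ Bs, B.map ℓ ∈ R) ∧ Bs.length = N := by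
  induction h with
  | zero w => intro L hL; exact ⟨L, [], .base _, hL, by simp, rfl⟩
  | succ n w X Y r h hr ih =>
    intro L hL
    obtain ⟨L1, L3, rfl, h1, h3⟩ := List.map_eq_append_iff.1 hL
    obtain ⟨L1, L2, rfl, h1, h2⟩ := List.map_eq_append_iff.1 h1
    obtain ⟨W, Bs, hN, hW, hB, hl⟩ := ih (L1 ++ L3) (by simp [h1, h3])
    refine ⟨W, L2 :: Bs, .ins _ _ _ _ _ hN, hW, ?_, by simp [hl]⟩
    intro B hB'
    rcases List.mem_cons.1 hB' with rfl | hB'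
    · rw [h2]; exact hr
    · exact hB B hB'

theorem Nest.lower (ℓ : P → α × Bool) {Z : List (α × Bool)} (h : FreeGroup.Red Z []) :
    ∀ L : List P, L.map ℓ = Z → ∃ Ps, Nest [] Ps L ∧ ∀ p ∈ Ps, ∃ i j, p = [i, j] ∧ ℓ j = ilt (ℓ i) := by
  induction h using Relation.ReflTransGen.head_induction_on with
  | refl => intro L hL; simp at hL; subst hL; exact ⟨[], .base _, by simp⟩
  | head hs _ ih =>
    intro L hL
    cases hs with
    | @not L1 L2 x b =>
      obtain ⟨A, C, rfl, h1, h3⟩ := List.map_eq_append_iff.1 hL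
      obtain ⟨i, C, rfl, hi, h3⟩ := List.map_eq_cons_iff.1 h3
      obtain ⟨j, C, rfl, hj, h3⟩ := List.map_eq_cons_iff.1 h3
      obtain ⟨Ps, hN, hP⟩ := ih (A ++ C) (by simp [h1, h3])
      refine ⟨[i, j] :: Ps, ?_, ?_⟩
      · simpa using Nest.ins [] Ps A C [i, j] hN
      · intro p hp
        rcases List.mem_cons.1 hp with rfl | hp
        · exact ⟨i, j, rfl, by rw [hi, hj]; rfl⟩
        · exact hP p hp

theorem Nest.remove {R : Set (List (α × Bool))} (h : P → FreeGroup α) {W : List P} {Bs : List (List P)} {L : List P}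
    (hN : Nest W Bs L) :
    (∀ B ∈ Bs, (B.map h).prod = 1 ∨ (B.map h).prod ∈ FreeGroup.mk '' R) →
    ∃ k x, k ≤ Bs.length ∧ ((∃ B ∈ Bs, (B.map h).prod = 1) → k < Bs.length) ∧ Prd R k x ∧
      (L.map h).prod = (W.map h).prod * x := by
  induction hN with
  | base => intro _; exact ⟨0, 1, by simp, by simp, .one, by simp⟩
  | ins Bs X Y B hN ih =>
    intro h1
    obtain ⟨k, x, hk1, hk2, hp, he⟩ := ih (fun B hB => h1 B (by simp [hB]))
    rw [List.map_append, List.prod_append] at he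
    by_cases h0 : (B.map h).prod = 1
    · refine ⟨k, x, by simp; omega, by intro _; simp; omega, hp, ?_⟩
      simp only [List.map_append, List.prod_append, h0, mul_one]
      rw [he]
    · rcases h1 B (by simp) with h2 | ⟨r, hr, h2⟩
      · exact absurd h2 h0
      · refine ⟨k + 1, _, by simp; omega, ?_, Prd.mul k x ((Y.map h).prod)⁻¹ r hp hr, ?_⟩
        · rintro ⟨B', hB', h3⟩
          rcases List.mem_cons.1 hB' with rfl | hB'
          · exact absurd h3 h0
          · have := hk2 ⟨B', hB', h3⟩
            simp; omega
        · simp only [List.map_append, List.prod_append]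
          rw [← mul_assoc, ← he, ← h2]; group

variable [DecidableEq P]

def pre {H : Type*} [Group H] (h : P → H) (L : List P) (i : P) : H := ((L.take (L.idxOf i)).map h).prod

theorem pre_eq {H : Type*} [Group H] (h : P → H) {L1 L2 : List P} {i : P} (hi : i ∉ L1) :
    pre h (L1 ++ i :: L2) i = (L1.map h).prod := by
  unfold pre
  rw [List.idxOf_append_of_notMem hi]
  simp

theorem Nest.key {H : Type*} [Group H] (h : P → H) {W : List P} {Bs : List (List P)} {L : List P}
    (hN : Nest W Bs L) (hnd : L.Nodup) (h1 : ∀ B ∈ W :: Bs, (B.map h).prod = 1) :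
    ∀ B ∈ W :: Bs, ∃ κ : H, ∀ (k : ℕ) (hk : k < B.length), pre h L B[k] = κ * ((B.take k).map h).prod := by
  induction hN with
  | base =>
    intro B hB
    simp at hB; subst hB
    refine ⟨1, fun k hk => ?_⟩
    unfold pre
    rw [hnd.idxOf_getElem, one_mul]
  | ins Bs X Y B hN ih =>
    have hnd2 : (X ++ Y).Nodup := by
      refine hnd.sublist ?_
      rw [List.append_assoc]
      exact List.Sublist.append_left (List.sublist_append_right _ _) _
    have hXBY : ∀ i ∈ X ++ Y, pre h (X ++ B ++ Y) i = pre h (X ++ Y) i := by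
      intro i hi
      rcases List.mem_append.1 hi with hi | hi
      · obtain ⟨X1, X2, rfl, hx⟩ := List.eq_append_cons_of_mem hi
        have e1 : X1 ++ i :: X2 ++ B ++ Y = X1 ++ i :: (X2 ++ B ++ Y) := by simp
        have e2 : X1 ++ i :: X2 ++ Y = X1 ++ i :: (X2 ++ Y) := by simp
        rw [e1, e2, pre_eq h hx, pre_eq h hx]
      · obtain ⟨Y1, Y2, rfl, hx⟩ := List.eq_append_cons_of_mem hi
        have e1 : X ++ B ++ (Y1 ++ i :: Y2) = (X ++ B ++ Y1) ++ i :: Y2 := by simp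
        have e2 : X ++ (Y1 ++ i :: Y2) = (X ++ Y1) ++ i :: Y2 := by simp
        have n1 : i ∉ X ++ B ++ Y1 := by
          rw [e1] at hnd
          intro hm
          exact (List.disjoint_of_nodup_append hnd) hm (by simp)
        have n2 : i ∉ X ++ Y1 := by
          intro hm; apply n1
          simp at hm ⊢; tauto
        rw [e1, e2, pre_eq h n1, pre_eq h n2]
        simp [h1 B (by simp)]
    intro B' hB'
    have hor : B' = B ∨ B' ∈ W :: Bs := by simp at hB' ⊢; tauto
    rcases hor with rfl | hB'
    · refine ⟨(X.map h).prod, fun k hk => ?_⟩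
      have e1 : X ++ B' ++ Y = (X ++ B'.take k) ++ B'[k] :: (B'.drop (k+1) ++ Y) := by
        have e0 : B' = B'.take k ++ B'[k] :: B'.drop (k + 1) := by
          rw [← List.drop_eq_getElem_cons hk, List.take_append_drop]
        calc X ++ B' ++ Y = X ++ (B'.take k ++ B'[k] :: B'.drop (k + 1)) ++ Y := by rw [← e0]
          _ = _ := by simp only [List.append_assoc, List.cons_append]
      have n1 : B'[k] ∉ X ++ B'.take k := by
        rw [e1] at hnd
        intro hm
        exact (List.disjoint_of_nodup_append hnd) hm (by simp)
      rw [e1, pre_eq h n1]; simp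
    · have := ih hnd2 (fun B'' hB'' => h1 B'' (by simp at hB'' ⊢; tauto)) B' hB'
      obtain ⟨κ, hκ⟩ := this
      refine ⟨κ, fun k hk => ?_⟩
      rw [hXBY _ ?_, hκ k hk]
      rw [hN.perm.mem_iff]
      have : B'[k] ∈ B' := List.getElem_mem hk
      rcases List.mem_cons.1 hB' with rfl | hB'
      · simp
      · rw [List.mem_append]; right
        exact List.mem_flatten.2 ⟨B', hB', this⟩

theorem Nest.next {H : Type*} [Group H] (h : P → H) {W : List P} {Bs : List (List P)} {L : List P}
    (hN : Nest W Bs L) (hnd : L.Nodup) (h1 : ∀ B ∈ W :: Bs, (B.map h).prod = 1)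
    (B : List P) (hB : B ∈ W :: Bs) (hBn : B.Nodup) (i : P) (hi : i ∈ B) :
    pre h L (B.formPerm i) = pre h L i * h i := by
  obtain ⟨κ, hκ⟩ := hN.key h hnd h1 B hB
  obtain ⟨k, hk, rfl⟩ := List.getElem_of_mem hi
  rw [List.formPerm_apply_getElem _ hBn k hk, hκ k hk, hκ]
  rcases Nat.lt_or_ge (k+1) B.length with h2 | h2
  · simp only [Nat.mod_eq_of_lt h2]
    rw [List.take_succ_eq_append_getElem hk, List.map_append, List.prod_append]
    simp [mul_assoc]
  · have e : k + 1 = B.length := by omega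
    have e2 : ((B.take k).map h).prod * h B[k] = 1 := by
      rw [← h1 B hB]
      conv_rhs => rw [← List.take_length (l := B), ← e, List.take_succ_eq_append_getElem hk, List.map_append, List.prod_append]
      simp
    simp only [e, Nat.mod_self, List.take_zero, List.map_nil, List.prod_nil]
    rw [mul_assoc, e2]

theorem exists_blockPerm (Cs : List (List P)) (hnd : Cs.flatten.Nodup) :
    ∃ π : Equiv.Perm P, ∀ B ∈ Cs, ∀ i ∈ B, π i = B.formPerm i := by
  have : ∃ π : Equiv.Perm P, (∀ B ∈ Cs, ∀ i ∈ B, π i = B.formPerm i) ∧ ∀ i, i ∉ Cs.flatten → π i = i := by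
    induction Cs with
    | nil => exact ⟨1, by simp, by simp⟩
    | cons B Cs ih =>
      rw [List.flatten_cons] at hnd
      obtain ⟨π, h1, h2⟩ := ih (hnd.sublist (List.sublist_append_right _ _))
      have hdis := List.disjoint_of_nodup_append hnd
      refine ⟨π * B.formPerm, ?_, ?_⟩
      · intro B' hB' i hi
        rcases List.mem_cons.1 hB' with rfl | hB'
        · rw [Equiv.Perm.mul_apply]
          apply h2
          exact fun hm => hdis (List.formPerm_apply_mem_of_mem hi) hm
        · have : i ∉ B := fun hm => hdis hm (List.mem_flatten.2 ⟨B', hB', hi⟩)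
          rw [Equiv.Perm.mul_apply, List.formPerm_apply_of_notMem this]
          exact h1 B' hB' i hi
      · intro i hi
        rw [List.flatten_cons, List.mem_append, not_or] at hi
        rw [Equiv.Perm.mul_apply, List.formPerm_apply_of_notMem hi.1]
        exact h2 i hi.2
  obtain ⟨π, h, _⟩ := this
  exact ⟨π, h⟩

end nests
end Part2


section Part3
open FreeGroup
section diag
set_option linter.unusedSectionVars false
variable {α : Type*}

structure Dgm (R : Set (List (α × Bool))) (P : Type) [Fintype P] [DecidableEq P] where
  L : List P
  W : List P
  Bs : List (List P)
  Ps : List (List P)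
  ℓ : P → α × Bool
  π : Equiv.Perm P
  τ : Equiv.Perm P
  nodup : L.Nodup
  cov : ∀ i, i ∈ L
  nW : Nest W Bs L
  nP : Nest [] Ps L
  cell : ∀ B ∈ Bs, B.map ℓ ∈ R
  pair : ∀ p ∈ Ps, ∃ i j, p = [i, j] ∧ ℓ j = ilt (ℓ i)
  hπ : ∀ B ∈ W :: Bs, ∀ i ∈ B, π i = B.formPerm i
  hτ : ∀ p ∈ Ps, ∀ i ∈ p, τ i = p.formPerm i

theorem exists_dgm {R : Set (List (α × Bool))} {N : ℕ} {w : List (α × Bool)} (h : Fill R N w) :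
    ∃ (n : ℕ) (D : Dgm R (Fin n)), D.W.map D.ℓ = w ∧ D.Bs.length = N := by
  obtain ⟨Z, hZ, h1⟩ := h
  have h2 : FreeGroup.Red Z [] := by
    obtain ⟨c, hc1, hc2⟩ := FreeGroup.Red.exact.1 (h1.trans FreeGroup.one_eq_mk)
    have := FreeGroup.Red.nil_iff.1 hc2
    rwa [this] at hc1
  let ℓ : Fin Z.length → α × Bool := fun i => Z[i]
  have hL : (List.finRange Z.length).map ℓ = Z := by
    simp [ℓ]
  obtain ⟨W, Bs, hN, hW, hB, hl⟩ := Nest.lift hZ ℓ _ hL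
  obtain ⟨Ps, hP, hpp⟩ := Nest.lower ℓ h2 _ hL
  have nd := List.nodup_finRange Z.length
  obtain ⟨π, hπ⟩ := exists_blockPerm (W :: Bs) (hN.perm.nodup_iff.1 nd)
  obtain ⟨τ, hτ⟩ := exists_blockPerm Ps (by simpa using hP.perm.nodup_iff.1 nd)
  exact ⟨Z.length, ⟨_, W, Bs, Ps, ℓ, π, τ, nd, List.mem_finRange, hN, hP, hB, hpp, hπ, hτ⟩, hW, hl⟩

namespace Dgm
variable {R : Set (List (α × Bool))} {P : Type} [Fintype P] [DecidableEq P] (D : Dgm R P)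

theorem flat_nodup : (D.W :: D.Bs).flatten.Nodup := D.nW.perm.nodup_iff.1 D.nodup
theorem cover (i : P) : ∃ B ∈ D.W :: D.Bs, i ∈ B := by
  have := D.nW.perm.mem_iff.1 (D.cov i)
  have : i ∈ (D.W :: D.Bs).flatten := this
  simpa using List.mem_flatten.1 this
theorem coverP (i : P) : ∃ B ∈ D.Ps, i ∈ B := by
  have := D.nP.perm.mem_iff.1 (D.cov i)
  have : i ∈ (D.Ps).flatten := by simpa using this
  exact List.mem_flatten.1 this
theorem blk_nodup {B : List P} (h : B ∈ D.W :: D.Bs) : B.Nodup :=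
  (List.nodup_flatten.1 D.flat_nodup).1 B h
theorem blkP_nodup {B : List P} (h : B ∈ D.Ps) : B.Nodup :=
  (List.nodup_flatten.1 (by simpa using D.nP.perm.nodup_iff.1 D.nodup : D.Ps.flatten.Nodup)).1 B h

theorem tau_spec (i : P) : D.τ (D.τ i) = i ∧ D.τ i ≠ i ∧ D.ℓ (D.τ i) = ilt (D.ℓ i) ∧
    ∃ p ∈ D.Ps, (p = [i, D.τ i] ∨ p = [D.τ i, i]) := by
  obtain ⟨p, hp, hi⟩ := D.coverP i
  obtain ⟨a, b, rfl, hl⟩ := D.pair p hp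
  have hab : a ≠ b := by simpa using D.blkP_nodup hp
  have ha : D.τ a = b := by rw [D.hτ _ hp a (by simp), List.formPerm_pair]; simp
  have hb : D.τ b = a := by rw [D.hτ _ hp b (by simp), List.formPerm_pair]; simp
  simp at hi
  rcases hi with rfl | rfl
  · rw [ha]; exact ⟨hb, hab.symm, hl, _, hp, Or.inl rfl⟩
  · rw [hb]; exact ⟨ha, hab, by rw [hl, ilt_ilt], _, hp, Or.inr rfl⟩

theorem tau_tau (i : P) : D.τ (D.τ i) = i := (D.tau_spec i).1
theorem tau_ne (i : P) : D.τ i ≠ i := (D.tau_spec i).2.1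
theorem tau_lab (i : P) : D.ℓ (D.τ i) = ilt (D.ℓ i) := (D.tau_spec i).2.2.1

theorem pi_next {H : Type*} [Group H] (h : P → H) (h1 : ∀ B ∈ D.W :: D.Bs, (B.map h).prod = 1) (i : P) :
    pre h D.L (D.π i) = pre h D.L i * h i := by
  obtain ⟨B, hB, hi⟩ := D.cover i
  rw [D.hπ B hB i hi]
  exact D.nW.next h D.nodup h1 B hB (D.blk_nodup hB) i hi

theorem tau_next {H : Type*} [Group H] (h : P → H) (h1 : ∀ i, h i * h (D.τ i) = 1) (i : P) :
    pre h D.L (D.τ i) = pre h D.L i * h i := by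
  obtain ⟨B, hB, hi⟩ := D.coverP i
  rw [D.hτ B hB i hi]
  refine D.nP.next h D.nodup ?_ B (by simp [hB]) (D.blkP_nodup hB) i hi
  intro B hB
  rcases List.mem_cons.1 hB with rfl | hB
  · simp
  · obtain ⟨a, b, rfl, hl⟩ := D.pair B hB
    have ha : D.τ a = b := by rw [D.hτ _ hB a (by simp), List.formPerm_pair]; simp
    have := h1 a
    rw [ha] at this
    simpa using this

def φ : Equiv.Perm P := D.τ * D.π
theorem φ_apply (i : P) : D.φ i = D.τ (D.π i) := rfl

theorem post_inv {H : Type*} [Group H] (h : P → H) (h1 : ∀ B ∈ D.W :: D.Bs, (B.map h).prod = 1)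
    (h2 : ∀ i, h i * h (D.τ i) = 1) (i : P) :
    pre h D.L (D.φ i) * h (D.φ i) = pre h D.L i * h i := by
  rw [φ_apply, D.tau_next h h2, mul_assoc, h2, mul_one, D.pi_next h h1]

/-! Euler formula -/
def lsum (l : List P) : (P → ℚ) →ₗ[ℚ] ℚ :=
  (l.map (fun i => (LinearMap.proj i : (P → ℚ) →ₗ[ℚ] ℚ))).sum
theorem lsum_apply (l : List P) (h : P → ℚ) : lsum l h = (l.map h).sum := by
  induction l with
  | nil => simp [lsum]
  | cons a l ih => simp [lsum] at ih ⊢; exact ih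

theorem prod_ofAdd (l : List P) (h : P → ℚ) :
    (l.map (fun i => Multiplicative.ofAdd (h i))).prod = Multiplicative.ofAdd (l.map h).sum := by
  induction l with
  | nil => rfl
  | cons a l ih => simp [ih]

theorem len_Ps : 2 * D.Ps.length = Fintype.card P := by
  have h1 : D.L.length = Fintype.card P := by
    rw [← List.toFinset_card_of_nodup D.nodup]
    have : D.L.toFinset = Finset.univ := by ext i; simp [D.cov i]
    rw [this]; rfl
  have h2 := D.nP.perm.length_eq
  rw [h1] at h2
  rw [h2]
  simp only [List.nil_append, List.length_flatten]
  have : D.Ps.map List.length = D.Ps.map (fun _ => 2) := by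
    apply List.map_congr_left
    intro p hp
    obtain ⟨i, j, rfl, _⟩ := D.pair p hp
    rfl
  rw [this]; simp [mul_comm]

open Classical in
theorem euler [Nonempty P] : Fintype.card P + 2 ≤
    2 * D.Bs.length + 2 * Fintype.card (Quotient (Equiv.Perm.SameCycle.setoid D.φ)) := by
  let Q := Quotient (Equiv.Perm.SameCycle.setoid D.φ)
  let Cs := D.Ps ++ D.Bs
  let T : (P → ℚ) →ₗ[ℚ] (Fin Cs.length → ℚ) := LinearMap.pi (fun k => lsum Cs[k])
  let K := LinearMap.ker T
  have hdim : Fintype.card P ≤ Module.finrank ℚ K + (D.Ps.length + D.Bs.length) := by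
    have h1 : Module.finrank ℚ (LinearMap.range T) + Module.finrank ℚ K = Fintype.card P := by
      rw [← Module.finrank_pi ℚ (ι := P)]
      exact LinearMap.finrank_range_add_finrank_ker T
    have h2 : Module.finrank ℚ (LinearMap.range T) ≤ Module.finrank ℚ (Fin Cs.length → ℚ) :=
      Submodule.finrank_le _
    rw [Module.finrank_pi, Fintype.card_fin] at h2
    have h4 : Cs.length = D.Ps.length + D.Bs.length := List.length_append
    omega
  let pst : P → List P := fun i => D.L.take (D.L.idxOf i) ++ [i]
  let S : (K × ℚ) →ₗ[ℚ] (Q → ℚ) := LinearMap.pi (fun q =>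
    (lsum (pst q.out)).comp (K.subtype.comp (LinearMap.fst ℚ K ℚ)) + LinearMap.snd ℚ K ℚ)
  have hinj : Function.Injective S := by
    rw [← LinearMap.ker_eq_bot, LinearMap.ker_eq_bot']
    rintro ⟨⟨h, hh⟩, c⟩ hS
    have hT : ∀ B ∈ Cs, (B.map h).sum = 0 := by
      intro B hB
      obtain ⟨k, hk, rfl⟩ := List.getElem_of_mem hB
      have : T h = 0 := hh
      have := congrFun this ⟨k, hk⟩
      simpa [T, lsum_apply] using this
    let g : P → Multiplicative ℚ := fun i => Multiplicative.ofAdd (h i)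
    have hPs : ∀ i, h i + h (D.τ i) = 0 := by
      intro i
      obtain ⟨p, hp, h3⟩ := (D.tau_spec i).2.2.2
      have h4 := hT p (by simp [Cs, hp])
      rcases h3 with rfl | rfl
      · simpa using h4
      · rw [add_comm]; simpa using h4
    have h2 : ∀ i, g i * g (D.τ i) = 1 := by
      intro i
      change Multiplicative.ofAdd (h i + h (D.τ i)) = 1
      rw [hPs i]; rfl
    have hW : (D.W.map h).sum = 0 := by
      have e1 := (D.nW.perm.map h).sum_eq
      have e2 := (D.nP.perm.map h).sum_eq
      have z : ∀ Xs : List (List P), (∀ B ∈ Xs, (B.map h).sum = 0) → (Xs.flatten.map h).sum = 0 := by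
        intro Xs
        induction Xs with
        | nil => simp
        | cons B Xs ih => 
          intro hX
          rw [List.flatten_cons, List.map_append, List.sum_append, hX B (by simp), ih (fun B hB => hX B (by simp [hB])), add_zero]
      rw [List.map_append, List.sum_append, z D.Bs (fun B hB => hT B (by simp [Cs, hB]))] at e1
      rw [List.nil_append, z D.Ps (fun B hB => hT B (by simp [Cs, hB]))] at e2
      linarith
    have h1 : ∀ B ∈ D.W :: D.Bs, (B.map g).prod = 1 := by
      intro B hB
      rw [prod_ofAdd]
      have : (B.map h).sum = 0 := by
        rcases List.mem_cons.1 hB with rfl | hB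
        · exact hW
        · exact hT B (by simp [Cs, hB])
      rw [this]; rfl
    have pp : ∀ i, pre g D.L i * g i = Multiplicative.ofAdd (((pst i).map h).sum) := by
      intro i
      simp only [pst, pre, g, prod_ofAdd, List.map_append, List.sum_append]
      simp
    have inv1 : ∀ q : Q, ((pst q.out).map h).sum + c = 0 := by
      intro q
      have := congrFun hS q
      simpa [S, lsum_apply] using this
    have inv0 : ∀ i, pre g D.L i * g i = Multiplicative.ofAdd (-c) := by
      intro i
      let q : Q := Quotient.mk _ i
      have hs : D.φ.SameCycle q.out i := Quotient.mk_out (s := Equiv.Perm.SameCycle.setoid D.φ) i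
      have hconst : ∀ (m : ℤ) (j : P), pre g D.L ((D.φ ^ m) j) * g ((D.φ ^ m) j) = pre g D.L j * g j := by
        intro m
        induction m using Int.induction_on with
        | zero => simp
        | succ m ih => intro j; rw [add_comm, zpow_add, zpow_one, Equiv.Perm.mul_apply, D.post_inv g h1 h2, ih]
        | pred m ih =>
          intro j
          rw [← ih j, sub_eq_add_neg, add_comm, zpow_add, Equiv.Perm.mul_apply]
          rw [← D.post_inv g h1 h2 ((D.φ ^ (-1 : ℤ)) _)]
          simp
      obtain ⟨m, hm⟩ := hs
      rw [← hm, hconst m, pp]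
      congr 1
      linarith [inv1 q]
    obtain ⟨i0⟩ := ‹Nonempty P›
    have hLne : D.L ≠ [] := fun h0 => by have := D.cov i0; simp [h0] at this
    obtain ⟨x, xs, hx⟩ := List.exists_cons_of_ne_nil hLne
    have hx0 : pre g D.L x = 1 := by rw [hx]; simp [pre]
    have hpre : ∀ i, pre g D.L i = Multiplicative.ofAdd (-c) := by
      intro i
      have := D.pi_next g h1 (D.π.symm i)
      rw [Equiv.apply_symm_apply, inv0] at this
      exact this
    have hc : c = 0 := by
      have := hpre x
      rw [hx0] at this
      have : (0 : ℚ) = -c := this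
      linarith
    have hg : ∀ i, h i = 0 := by
      intro i
      have := inv0 i
      rw [hpre i] at this
      have : -c + h i = -c := this
      linarith
    have hh0 : h = 0 := funext hg
    subst hh0; subst hc; rfl
  have h3 := LinearMap.finrank_le_finrank_of_injective hinj
  have h4 : Module.finrank ℚ (Q → ℚ) = Fintype.card (Quotient (Equiv.Perm.SameCycle.setoid D.φ)) := by
    rw [Module.finrank_pi]
  rw [Module.finrank_prod, h4, Module.finrank_self] at h3
  have := D.len_Ps
  omega

open Classical in
theorem cyc_count (φ : Equiv.Perm P) (h : ∀ i, φ i ≠ i) :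
    6 * Fintype.card (Quotient (Equiv.Perm.SameCycle.setoid φ)) ≤
      2 * Fintype.card P + (Finset.univ.filter (fun i => φ (φ i) = i)).card := by
  set Q := Quotient (Equiv.Perm.SameCycle.setoid φ)
  let f : P → Q := Quotient.mk _
  have hf : ∀ i, f (φ i) = f i := fun i => Quotient.sound (by
    change φ.SameCycle (φ i) i
    exact (Equiv.Perm.sameCycle_apply_left).2 (Equiv.Perm.SameCycle.refl _ _))
  have e1 : 2 * Fintype.card P + (Finset.univ.filter (fun i => φ (φ i) = i)).card =
      ∑ i : P, (2 + if φ (φ i) = i then 1 else 0) := by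
    rw [Finset.sum_add_distrib, Finset.sum_const, Finset.card_filter]
    simp [mul_comm]
  rw [e1, ← Finset.sum_fiberwise Finset.univ f]
  have e2 : 6 * Fintype.card Q = ∑ _q : Q, 6 := by simp [mul_comm]
  rw [e2]
  apply Finset.sum_le_sum
  intro q _
  obtain ⟨i, rfl⟩ := Quotient.exists_rep q
  have hm0 : i ∈ Finset.univ.filter (fun j => f j = f i) := by simp
  have hm1 : φ i ∈ Finset.univ.filter (fun j => f j = f i) := by simp [hf]
  have hm2 : φ (φ i) ∈ Finset.univ.filter (fun j => f j = f i) := by simp [hf]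
  change 6 ≤ ∑ x ∈ Finset.univ.filter (fun j => f j = f i), _
  by_cases hc : φ (φ i) = i
  · have hsub : ({i, φ i} : Finset P) ⊆ Finset.univ.filter (fun j => f j = f i) := by
      intro j hj; simp only [Finset.mem_insert, Finset.mem_singleton] at hj
      rcases hj with rfl | rfl <;> assumption
    refine le_trans ?_ (Finset.sum_le_sum_of_subset hsub)
    rw [Finset.sum_pair (h i).symm]
    simp [hc]
  · have hsub : ({i, φ i, φ (φ i)} : Finset P) ⊆ Finset.univ.filter (fun j => f j = f i) := by
      intro j hj; simp only [Finset.mem_insert, Finset.mem_singleton] at hj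
      rcases hj with rfl | rfl | rfl <;> assumption
    refine le_trans ?_ (Finset.sum_le_sum_of_subset hsub)
    rw [Finset.sum_insert, Finset.sum_pair (h (φ i)).symm]
    · omega
    · simp [(h i).symm, Ne.symm hc]

end Dgm
end diag
end Part3


section Part4
open FreeGroup
section diag2
set_option linter.unusedSectionVars false
variable {α : Type*}
namespace Dgm
variable {R : Set (List (α × Bool))} {P : Type} [Fintype P] [DecidableEq P] (D : Dgm R P)

theorem blk_uniq {B B' : List P} (hB : B ∈ D.W :: D.Bs) (hB' : B' ∈ D.W :: D.Bs) {i : P} (h : i ∈ B) (h' : i ∈ B') :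
    B = B' := by
  by_contra hne
  have hp := (List.nodup_flatten.1 D.flat_nodup).2
  have : Std.Symm (List.Disjoint (α := P)) := ⟨fun _ _ h => h.symm⟩
  have := hp.forall hB hB' hne
  exact this h h'

theorem pi_mem {B : List P} (hB : B ∈ D.W :: D.Bs) {i : P} : D.π i ∈ B ↔ i ∈ B := by
  have hf : ∀ B ∈ D.W :: D.Bs, ∀ i ∈ B, D.π i ∈ B := by
    intro B hB i hi
    rw [D.hπ B hB i hi]; exact List.formPerm_apply_mem_of_mem hi
  refine ⟨fun h => ?_, hf B hB i⟩
  obtain ⟨B', hB', hi⟩ := D.cover i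
  rw [D.blk_uniq hB hB' h (hf B' hB' i hi)]; exact hi

theorem pow_mem {B : List P} (hB : B ∈ D.W :: D.Bs) {i : P} (k : ℕ) : (D.π ^ k) i ∈ B ↔ i ∈ B := by
  induction k with
  | zero => simp
  | succ k ih => rw [pow_succ', Equiv.Perm.mul_apply, D.pi_mem hB, ih]

/-- rotated block beginning at `i`. -/
theorem cyc_spec {B B1 B2 : List P} {i : P} (hB : B ∈ D.W :: D.Bs) (h : B = B1 ++ i :: B2) (k : ℕ)
    (hk : k % B.length < (i :: (B2 ++ B1)).length) :
    (D.π ^ k) i = (i :: (B2 ++ B1))[k % B.length] := by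
  have hnd := D.blk_nodup hB
  have hrot : B.rotate B1.length = i :: (B2 ++ B1) := by
    rw [h, List.rotate_append_length_eq]; simp
  have hnd2 : (i :: (B2 ++ B1)).Nodup := by rw [← hrot]; exact List.nodup_rotate.2 hnd
  have hfp : (i :: (B2 ++ B1)).formPerm = B.formPerm := by
    rw [← hrot]; exact List.formPerm_rotate _ hnd _
  have hlen : B.length = (i :: (B2 ++ B1)).length := by rw [← hrot]; simp
  have hi : i ∈ B := by rw [h]; simp
  have e1 : (D.π ^ k) i = ((i :: (B2 ++ B1)).formPerm ^ k) i := by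
    clear hk
    induction k with
    | zero => simp
    | succ k ih =>
      rw [pow_succ', pow_succ', Equiv.Perm.mul_apply, Equiv.Perm.mul_apply, ← ih, hfp]
      exact D.hπ B hB _ ((D.pow_mem hB k).2 hi)
  rw [e1]
  have := List.formPerm_pow_apply_getElem (i :: (B2 ++ B1)) hnd2 k 0 (by simp)
  simp only [List.getElem_cons_zero, zero_add] at this
  rw [this]
  simp only [hlen]

theorem cyc_spec' {B B1 B2 : List P} {i : P} (hB : B ∈ D.W :: D.Bs) (h : B = B1 ++ i :: B2) (k : ℕ)
    (hk : k < (i :: (B2 ++ B1)).length) :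
    (D.π ^ k) i = (i :: (B2 ++ B1))[k] := by
  have hl : B.length = (i :: (B2 ++ B1)).length := by rw [h]; simp; omega
  have e : k % B.length = k := Nat.mod_eq_of_lt (by rw [hl]; exact hk)
  rw [D.cyc_spec hB h k (by rw [e]; exact hk)]
  simp only [e]

theorem pow_len {B : List P} {i : P} (hB : B ∈ D.W :: D.Bs) (hi : i ∈ B) : (D.π ^ B.length) i = i := by
  obtain ⟨B1, B2, h⟩ := List.append_of_mem hi
  rw [D.cyc_spec hB h _ (by simp)]; simp

theorem cyc_spec_inv {B B1 B2 : List P} {i : P} (hB : B ∈ D.W :: D.Bs) (h : B = B1 ++ i :: B2) (k : ℕ)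
    (hk : k < (i :: (B2 ++ B1).reverse).length) :
    (D.π ^ k)⁻¹ i = (i :: (B2 ++ B1).reverse)[k] := by
  have hi : i ∈ B := by rw [h]; simp
  have hl : B.length = (B2 ++ B1).length + 1 := by rw [h]; simp; omega
  rw [Equiv.Perm.inv_eq_iff_eq]
  rcases k with _ | k
  · simp
  · simp only [List.length_cons, List.length_reverse] at hk
    have e := D.cyc_spec' hB h ((B2 ++ B1).length - k) (by simp)
    have e2 : (i :: (B2 ++ B1).reverse)[k + 1] = (D.π ^ ((B2 ++ B1).length - k)) i := by
      rw [e, List.getElem_cons_succ, List.getElem_reverse]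
      have : (B2 ++ B1).length - k = (B2 ++ B1).length - 1 - k + 1 := by omega
      simp only [this, List.getElem_cons_succ]
    rw [e2, ← Equiv.Perm.mul_apply, ← pow_add]
    have : k + 1 + ((B2 ++ B1).length - k) = B.length := by omega
    rw [this, D.pow_len hB hi]

theorem reach {B : List P} {i j : P} (hB : B ∈ D.W :: D.Bs) (hi : i ∈ B) (hj : j ∈ B) :
    ∃ k < B.length, (D.π ^ k) i = j := by
  obtain ⟨B1, B2, h⟩ := List.append_of_mem hi
  have hl : B.length = (i :: (B2 ++ B1)).length := by rw [h]; simp; omega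
  have : j ∈ i :: (B2 ++ B1) := by rw [h] at hj; simp at hj ⊢; tauto
  obtain ⟨k, hk, e⟩ := List.getElem_of_mem this
  exact ⟨k, by rw [hl]; exact hk, by rw [D.cyc_spec' hB h k hk, e]⟩

theorem cell_rot (hR : SymR R) {B B1 B2 : List P} {i : P} (hB : B ∈ D.Bs) (h : B = B1 ++ i :: B2) :
    (i :: (B2 ++ B1)).map D.ℓ ∈ R := by
  have h1 := D.cell B hB
  rw [h, List.map_append] at h1
  have := hR.rot _ _ h1
  simpa using this

theorem map_ilt_reverse (l : List (α × Bool)) : (l.map ilt).reverse = FreeGroup.invRev l := by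
  rfl

theorem cell_inv (hR : SymR R) {B B1 B2 : List P} {i : P} (hB : B ∈ D.Bs) (h : B = B1 ++ i :: B2) :
    (i :: (B2 ++ B1).reverse).map (fun x => ilt (D.ℓ x)) ∈ R := by
  have h1 := D.cell_rot hR hB h
  have h2 : (B2 ++ B1).map D.ℓ ++ [D.ℓ i] ∈ R := hR.rot [D.ℓ i] _ (by simpa using h1)
  have h3 := hR.inv _ h2
  rw [FreeGroup.invRev_append] at h3
  convert h3 using 1
  simp [FreeGroup.invRev, ilt, Function.comp_def]

/-- mirror cells -/
theorem mirror_false (hR : SymR R) (hmin : ∀ k < D.Bs.length, ¬ Prd R k (FreeGroup.mk (D.W.map D.ℓ)))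
    {B B' B1 B2 B1' B2' : List P} {j : P} (hB : B ∈ D.Bs) (hB' : B' ∈ D.Bs)
    (h : B = B1 ++ j :: B2) (h' : B' = B1' ++ D.τ j :: B2')
    (hm : (j :: (B2 ++ B1)).map D.ℓ = (D.τ j :: (B2' ++ B1').reverse).map (fun x => ilt (D.ℓ x))) : False := by
  have hBm : B ∈ D.W :: D.Bs := by simp [hB]
  have hBm' : B' ∈ D.W :: D.Bs := by simp [hB']
  have hjB : j ∈ B := by rw [h]; simp
  have htB : D.τ j ∈ B' := by rw [h']; simp
  by_cases hbb : B = B'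
  · subst hbb
    obtain ⟨m, hm1, hm2⟩ := D.reach hBm hjB htB
    have hl : B.length = (j :: (B2 ++ B1)).length := by rw [h]; simp; omega
    have hl' : B.length = (D.τ j :: (B2' ++ B1').reverse).length := by rw [h']; simp; omega
    have hs : ∀ s ≤ m, D.ℓ ((D.π ^ s) j) = ilt (D.ℓ ((D.π ^ (m - s)) j)) := by
      intro s hs
      have e1 := D.cyc_spec' hBm h s (by omega)
      have e2 := D.cyc_spec_inv hBm h' s (by omega)
      have e3 : (D.π ^ s)⁻¹ (D.τ j) = (D.π ^ (m - s)) j := by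
        rw [Equiv.Perm.inv_eq_iff_eq, ← Equiv.Perm.mul_apply, ← pow_add, ← hm2]
        congr 2; omega
      rw [← e3, e2, e1]
      have := congrArg (fun l => l[s]?) hm
      simp only [List.getElem?_map] at this
      rw [List.getElem?_eq_getElem (by omega), List.getElem?_eq_getElem (by omega)] at this
      simpa using this
    rcases Nat.even_or_odd' m with ⟨k, hk | hk⟩
    · have := hs k (by omega)
      rw [show m - k = k by omega] at this
      exact ilt_ne _ this.symm
    · have := hs k (by omega)
      rw [show m - k = k + 1 by omega] at this
      have e1 := D.cyc_spec' hBm h k (by omega)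
      have e2 := D.cyc_spec' hBm h (k + 1) (by omega)
      rw [e1, e2] at this
      have hr := hR.red _ (D.cell_rot hR hB h)
      have hch := List.isChain_iff_getElem.1 hr k (by rw [List.length_map]; omega)
      simp only [List.getElem_map] at hch
      rw [this] at hch
      simp [ilt] at hch
  · have hjB' : j ∉ B' := fun hx => hbb (D.blk_uniq hBm hBm' hjB hx)
    have htB2 : D.τ j ∉ B := fun hx => hbb (D.blk_uniq hBm hBm' hx htB)
    have hnB := D.blk_nodup hBm
    have hnB' := D.blk_nodup hBm'
    set X := FreeGroup.mk ((B2 ++ B1).map D.ℓ) with hX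
    have hX' : FreeGroup.mk ((B2' ++ B1').map D.ℓ) = X⁻¹ := by
      rw [List.map_cons, List.map_cons] at hm
      have := (List.cons.inj hm).2
      rw [hX, this, FreeGroup.inv_mk]
      congr 1
      simp [FreeGroup.invRev, ilt, Function.comp_def]
    let g : P → FreeGroup α := fun i => if i = j then X⁻¹ else if i = D.τ j then X else FreeGroup.mk [D.ℓ i]
    have gother : ∀ l : List P, j ∉ l → D.τ j ∉ l → (l.map g).prod = FreeGroup.mk (l.map D.ℓ) := by
      intro l
      induction l with
      | nil => intros; rfl
      | cons a l ih =>
        intro h1 h2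
        simp only [List.mem_cons, not_or] at h1 h2
        rw [List.map_cons, List.prod_cons, ih h1.2 h2.2, List.map_cons, mk_cons]
        simp only [g, if_neg (Ne.symm h1.1), if_neg (Ne.symm h2.1)]
    have hgB : (B.map g).prod = 1 := by
      have hn1 : j ∉ B1 ∧ j ∉ B2 := by
        rw [h] at hnB; rw [List.nodup_middle, List.nodup_cons] at hnB; simpa using hnB.1
      have hn2 : D.τ j ∉ B1 ∧ D.τ j ∉ B2 := by
        rw [h] at htB2; simp at htB2; tauto
      rw [h, List.map_append, List.prod_append, List.map_cons, List.prod_cons, gother _ hn1.1 hn2.1, gother _ hn1.2 hn2.2]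
      have : g j = X⁻¹ := by simp [g]
      rw [this, hX, List.map_append, mk_append]; group
    have hgB' : (B'.map g).prod = 1 := by
      have hn1 : D.τ j ∉ B1' ∧ D.τ j ∉ B2' := by
        rw [h'] at hnB'; rw [List.nodup_middle, List.nodup_cons] at hnB'; simpa using hnB'.1
      have hn2 : j ∉ B1' ∧ j ∉ B2' := by
        rw [h'] at hjB'; simp at hjB'; tauto
      rw [h', List.map_append, List.prod_append, List.map_cons, List.prod_cons, gother _ hn2.1 hn1.1, gother _ hn2.2 hn1.2]
      have : g (D.τ j) = X := by simp [g, D.tau_ne j]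
      rw [List.map_append, mk_append] at hX'
      rw [this, ← inv_inv X, ← hX']; group
    have hoth : ∀ C ∈ D.W :: D.Bs, C ≠ B → C ≠ B' → (C.map g).prod = FreeGroup.mk (C.map D.ℓ) := by
      intro C hC h1 h2
      exact gother C (fun hx => h1 (D.blk_uniq hC hBm hx hjB)) (fun hx => h2 (D.blk_uniq hC hBm' hx htB))
    have hblk : ∀ C ∈ D.Bs, (C.map g).prod = 1 ∨ (C.map g).prod ∈ FreeGroup.mk '' R := by
      intro C hC
      by_cases h1 : C = B
      · left; rw [h1]; exact hgB
      by_cases h2 : C = B'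
      · left; rw [h2]; exact hgB'
      right; rw [hoth C (by simp [hC]) h1 h2]
      exact ⟨_, D.cell C hC, rfl⟩
    obtain ⟨k, x, _, hk2, hp, he⟩ := D.nW.remove g hblk
    have hlow : (D.L.map g).prod = 1 := by
      have hz : ∀ C ∈ D.Ps, (C.map g).prod = 1 := by
        intro C hC
        obtain ⟨a, b, rfl, hl⟩ := D.pair C hC
        have hab : a ≠ b := by simpa using D.blkP_nodup hC
        have ha : D.τ a = b := by rw [D.hτ _ hC a (by simp), List.formPerm_pair]; simp
        have hb : D.τ b = a := by rw [D.hτ _ hC b (by simp), List.formPerm_pair]; simp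
        subst ha
        simp only [List.map_cons, List.map_nil, List.prod_cons, List.prod_nil, mul_one]
        by_cases h1 : a = j
        · subst h1; simp [g, D.tau_ne a]
        · by_cases h2 : a = D.τ j
          · subst h2
            simp [g, D.tau_tau, D.tau_ne j]
          · have h3 : D.τ a ≠ j := by rintro rfl; exact h2 (D.tau_tau a).symm
            have h4 : D.τ a ≠ D.τ j := fun hx => h1 (D.τ.injective hx)
            simp only [g, if_neg h1, if_neg h2, if_neg h3, if_neg h4, hl, mk_ilt, mul_inv_cancel]
      obtain ⟨k', x', _, _, hp', he'⟩ := D.nP.remove (R := ∅) g (fun C hC => Or.inl (hz C hC))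
      rw [he']
      have : x' = 1 := by
        cases hp' with
        | one => rfl
        | mul _ _ _ _ _ hr => exact absurd hr (by simp)
      simp [this]
    have hk := hk2 ⟨B, hB, hgB⟩
    have hWne : D.W ≠ B ∧ D.W ≠ B' := by
      have hp := (List.nodup_flatten.1 D.flat_nodup).2
      rw [List.pairwise_cons] at hp
      constructor
      · intro e; exact hp.1 B hB (e ▸ hjB) hjB
      · intro e; exact hp.1 B' hB' (e ▸ htB) htB
    rw [hlow, hoth D.W (by simp) hWne.1 hWne.2] at he
    refine hmin k hk ?_
    have : FreeGroup.mk (D.W.map D.ℓ) = x⁻¹ := eq_inv_of_mul_eq_one_left he.symm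
    rw [this]; exact hp.inv hR

end Dgm
end diag2
end Part4


section Part5
open FreeGroup
section diag3
set_option linter.unusedSectionVars false
variable {α : Type*}

theorem SymR.piece' {R : Set (List (α × Bool))} (hR : SymR R) {r1 r2 : List (α × Bool)} (h1 : r1 ∈ R) (h2 : r2 ∈ R)
    {k : ℕ} (hk1 : k ≤ r1.length) (hk2 : k ≤ r2.length) (he : ∀ s, s < k → r1[s]? = r2[s]?)
    (hl : r1.length < 15 * k ∨ r2.length < 15 * k) : r1 = r2 := by
  have ht : r1.take k = r2.take k := by
    apply List.ext_getElem?
    intro s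
    by_cases hs : s < k
    · rw [List.getElem?_take_of_lt hs, List.getElem?_take_of_lt hs, he s hs]
    · rw [List.getElem?_eq_none (by simp; omega), List.getElem?_eq_none (by simp; omega)]
  have e1 := List.take_append_drop k r1
  have e2 := List.take_append_drop k r2
  have hq : (r1.take k).length = k := by simp [hk1]
  have : r1.drop k = r2.drop k := by
    rcases hl with hl | hl
    · refine hR.piece (r1.take k) _ _ ?_ ?_ ?_
      · rw [e1]; exact h1
      · rw [ht, e2]; exact h2
      · rw [e1, hq]; exact hl
    · refine (hR.piece (r1.take k) _ _ ?_ ?_ ?_).symm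
      · rw [ht, e2]; exact h2
      · rw [e1]; exact h1
      · rw [hq, ht, e2]; exact hl
  rw [← e1, ← e2, ht, this]

namespace Dgm
variable {R : Set (List (α × Bool))} {P : Type} [Fintype P] [DecidableEq P] (D : Dgm R P)

/-- good corners: interior bigons away from the base. -/
def γ (base i : P) : Prop := D.φ (D.φ i) = i ∧ i ≠ base ∧ i ≠ D.φ base

theorem pi_pow (s : ℕ) (j : P) : D.π ((D.π ^ s) j) = (D.π ^ (s + 1)) j := by
  rw [pow_succ', Equiv.Perm.mul_apply]

variable {D} {base : P}
theorem γ_phi {i : P} (h : D.γ base i) : D.φ i ≠ base ∧ D.φ i ≠ D.φ base :=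
  ⟨fun e => h.2.2 (by rw [← e, h.1]), fun e => h.2.1 (D.φ.injective e)⟩

theorem γ_inv {i : P} (h : D.γ base i) : D.γ base (D.φ i) :=
  ⟨by rw [h.1], γ_phi h⟩

theorem run {j : P} {t : ℕ} (h : ∀ s < t, D.γ base ((D.π ^ s) j)) :
    ∀ s ≤ t, (D.π ^ s) (D.τ ((D.π ^ s) j)) = D.τ j := by
  intro s
  induction s with
  | zero => intro _; rfl
  | succ s ih =>
    intro hs
    have hx := (h s (by omega)).1
    rw [φ_apply, φ_apply] at hx
    have hx2 : D.π (D.τ (D.π ((D.π ^ s) j))) = D.τ ((D.π ^ s) j) := by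
      rw [← D.tau_tau (D.π _), hx]
    rw [← ih (by omega)]
    conv_lhs => rw [pow_succ, Equiv.Perm.mul_apply]
    congr 1
    rw [← hx2, D.pi_pow, ← pow_succ]

theorem run_inv {j : P} {t : ℕ} (h : ∀ s < t, D.γ base ((D.π ^ s) j)) :
    ∀ s ≤ t, D.τ ((D.π ^ s) j) = (D.π ^ s)⁻¹ (D.τ j) := by
  intro s hs
  rw [eq_comm, Equiv.Perm.inv_eq_iff_eq, run h s hs]

theorem run_end {j : P} {t : ℕ} (h : ∀ s < t, D.γ base ((D.π ^ s) j)) {r : ℕ} (hr : r ≤ t) :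
    (D.π ^ r) (D.τ ((D.π ^ t) j)) = D.τ ((D.π ^ (t - r)) j) := by
  have h1 := run h t le_rfl
  have h2 := run h (t - r) (by omega)
  rw [← h1, ← Nat.sub_add_cancel hr, pow_add (D.π) (t - r) r, Equiv.Perm.mul_apply] at h2
  rw [Nat.sub_add_cancel hr] at h2
  have := (D.π ^ (t - r)).injective h2
  rw [this]
  congr 2
  rw [← pow_add, Nat.sub_add_cancel hr]

theorem run_short (hR : SymR R) (hmin : ∀ k < D.Bs.length, ¬ Prd R k (FreeGroup.mk (D.W.map D.ℓ)))
    {B B' : List P} {j : P} (hB : B ∈ D.Bs) (hB' : B' ∈ D.Bs) (hj : j ∈ B) {t : ℕ}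
    (h : ∀ s < t, D.γ base ((D.π ^ s) j)) (ht : t < B.length) (hj' : D.τ ((D.π ^ t) j) ∈ B') :
    15 * (t + 1) ≤ B.length := by
  by_contra hc
  have hBm : B ∈ D.W :: D.Bs := by simp [hB]
  have hBm' : B' ∈ D.W :: D.Bs := by simp [hB']
  have htj : D.τ j ∈ B' := by
    rw [← run h t le_rfl]; exact (D.pow_mem hBm' t).2 hj'
  obtain ⟨B1, B2, e⟩ := List.append_of_mem hj
  obtain ⟨B1', B2', e'⟩ := List.append_of_mem htj
  have hl : B.length = (j :: (B2 ++ B1)).length := by rw [e]; simp; omega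
  have hl' : B'.length = (D.τ j :: (B2' ++ B1').reverse).length := by rw [e']; simp; omega
  refine D.mirror_false hR hmin hB hB' e e' ?_
  refine hR.piece' (D.cell_rot hR hB e) (D.cell_inv hR hB' e') (k := min (t + 1) B'.length) ?_ ?_ ?_ ?_
  · rw [List.length_map, ← hl]; omega
  · rw [List.length_map, ← hl']; omega
  · intro s hs
    have e1 := D.cyc_spec' hBm e s (by omega)
    have e2 := D.cyc_spec_inv hBm' e' s (by omega)
    rw [List.getElem?_map, List.getElem?_map, List.getElem?_eq_getElem (by omega),
      List.getElem?_eq_getElem (by omega), ← e1, ← e2, ← run_inv h s (by omega), Option.map_some, Option.map_some,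
      D.tau_lab, ilt_ilt]
  · rw [List.length_map, List.length_map, ← hl, ← hl']
    rcases le_total (t + 1) B'.length with h | h
    · left; rw [min_eq_left h]; omega
    · right; rw [min_eq_right h]
      have : 0 < B'.length := List.length_pos_of_mem htj
      omega

theorem run_W (hb : D.W.getLast? = some base) {j : P} {t : ℕ}
    (h : ∀ s < t, D.γ base ((D.π ^ s) j)) (hW : D.τ ((D.π ^ t) j) ∈ D.W) :
    ∃ a, ∀ r ≤ t, D.W[a + r]? = some (D.τ ((D.π ^ (t - r)) j)) := by
  obtain ⟨a, ha, hae⟩ := List.getElem_of_mem hW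
  refine ⟨a, fun r => ?_⟩
  induction r with
  | zero => intro _; simp [← hae]
  | succ r ih =>
    intro hr
    have ih := ih (by omega)
    obtain ⟨hlt, he⟩ := List.getElem?_eq_some_iff.1 ih
    have hne : a + r + 1 ≠ D.W.length := by
      intro hx
      rw [List.getLast?_eq_getElem?, show D.W.length - 1 = a + r by omega, ih] at hb
      have hb := Option.some.inj hb
      have := (γ_phi (h (t - r - 1) (by omega))).1
      apply this
      rw [φ_apply, ← hb, D.pi_pow]
      congr 3; omega
    have hlt2 : a + (r + 1) < D.W.length := by omega
    rw [List.getElem?_eq_getElem hlt2]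
    congr 1
    have hnd : D.W.Nodup := D.blk_nodup (by simp)
    have hp := List.formPerm_apply_getElem _ hnd (a + r) hlt
    rw [← D.hπ D.W (by simp) _ (List.getElem_mem _)] at hp
    simp only [Nat.mod_eq_of_lt (show a + r + 1 < D.W.length by omega)] at hp
    refine hp.symm.trans ?_
    rw [he, ← run_end h (by omega : r ≤ t), D.pi_pow, run_end h hr]

theorem run_W_infix (hb : D.W.getLast? = some base) {B B1 B2 : List P} {j : P} {t : ℕ} (hB : B ∈ D.Bs)
    (e : B = B1 ++ j :: B2) (ht : t < B.length)
    (h : ∀ s < t, D.γ base ((D.π ^ s) j)) (hW : D.τ ((D.π ^ t) j) ∈ D.W) :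
    FreeGroup.invRev (((j :: (B2 ++ B1)).map D.ℓ).take (t + 1)) <:+: D.W.map D.ℓ := by
  obtain ⟨a, ha⟩ := run_W hb h hW
  have hBm : B ∈ D.W :: D.Bs := by simp [hB]
  have hl : B.length = (j :: (B2 ++ B1)).length := by rw [e]; simp; omega
  have : FreeGroup.invRev (((j :: (B2 ++ B1)).map D.ℓ).take (t + 1)) = ((D.W.map D.ℓ).drop a).take (t + 1) := by
    have hla := (List.getElem?_eq_some_iff.1 (ha t le_rfl)).1
    apply List.ext_getElem?
    intro r
    by_cases hr : r < t + 1
    · rw [List.getElem?_take_of_lt hr, List.getElem?_drop, List.getElem?_map, ha r (by omega)]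
      unfold FreeGroup.invRev
      have hlen : (((List.map D.ℓ (j :: (B2 ++ B1))).take (t+1)).map (fun g : α × Bool => (g.1, !g.2))).length = t + 1 := by
        rw [List.length_map, List.length_take, List.length_map, ← hl]; omega
      rw [List.getElem?_reverse (by omega), hlen, List.getElem?_map, List.getElem?_take_of_lt (by omega),
        List.getElem?_map, List.getElem?_eq_getElem (by omega), ← D.cyc_spec' hBm e _ (by omega)]
      simp only [Option.map_some]
      rw [D.tau_lab]
      simp only [ilt]
      rw [show t + 1 - 1 - r = t - r by omega]
    · rw [List.getElem?_eq_none (by rw [FreeGroup.invRev_length]; simp; omega), List.getElem?_eq_none (by simp; omega)]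
  rw [this]
  exact (List.take_prefix _ _).isInfix.trans (List.drop_suffix _ _).isInfix

end Dgm
end diag3
end Part5


section Part6
open FreeGroup
section diag4
set_option linter.unusedSectionVars false
variable {α : Type*}
namespace Dgm
variable {R : Set (List (α × Bool))} {P : Type} [Fintype P] [DecidableEq P] {D : Dgm R P} {base : P}

/-- fibre bounds -/
theorem exists_runs (p : P → Prop) {B : List P} (hB : B ∈ D.W :: D.Bs) (hS : ∃ d ∈ B, p d) :
    ∃ t : P → ℕ, ∀ j ∈ B, t j < B.length ∧ p ((D.π ^ (t j)) j) ∧ ∀ s < t j, ¬ p ((D.π ^ s) j) := by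
  classical
  obtain ⟨d, hd, hpd⟩ := hS
  refine ⟨fun j => if h : ∃ k, p ((D.π ^ k) j) then Nat.find h else 0, fun j hj => ?_⟩
  obtain ⟨k, hk, e⟩ := D.reach hB hj hd
  have h : ∃ k, p ((D.π ^ k) j) := ⟨k, by rw [e]; exact hpd⟩
  simp only [dif_pos h]
  exact ⟨(Nat.find_min' h (by rw [e]; exact hpd)).trans_lt hk, Nat.find_spec h, fun s hs => Nat.find_min h hs⟩

open Classical in
theorem fib_card {B : List P} (t : P → ℕ) (d : P) (M : ℕ)
    (hM : ∀ j ∈ B, (D.π ^ (t j)) j = d → t j < M) :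
    (B.toFinset.filter (fun j => (D.π ^ (t j)) j = d)).card ≤ M := by
  rw [← Finset.card_range M]
  refine Finset.card_le_card_of_injOn t ?_ ?_
  · intro j hj
    simp at hj ⊢
    exact hM j hj.1 hj.2
  · intro j hj j' hj' e
    simp at hj hj'
    have := hj.2.trans hj'.2.symm
    rw [e] at this
    exact (D.π ^ (t j')).injective this

theorem corner_W {H : Type*} [Group H] (h : P → H) (h1 : ∀ B ∈ D.W :: D.Bs, (B.map h).prod = 1)
    (h2 : ∀ i, h i * h (D.τ i) = 1)
    (hinj : ∀ i ∈ D.W, ∀ j ∈ D.W, pre h D.L i * h i = pre h D.L j * h j → i = j)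
    {d : P} (hd1 : D.τ d ∈ D.W) (hd2 : D.τ (D.π d) ∈ D.W) : D.φ (D.φ d) = d := by
  have hy : D.π.symm (D.τ d) ∈ D.W := by
    rw [← D.pi_mem (B := D.W) (by simp)]; simpa using hd1
  have e1 : D.φ (D.π.symm (D.τ d)) = d := by
    rw [φ_apply]; simp [D.tau_tau]
  have := hinj _ hy _ (by rw [φ_apply]; exact hd2 : D.φ d ∈ D.W) ?_
  · rw [← this, e1]
  · rw [← D.post_inv h h1 h2 (D.π.symm (D.τ d)), e1, D.post_inv h h1 h2 d]

open Classical in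
theorem per_cell (hR : SymR R) (hmin : ∀ k < D.Bs.length, ¬ Prd R k (FreeGroup.mk (D.W.map D.ℓ)))
    (hb : D.W.getLast? = some base)
    (hchunk : ∀ u v, u ++ v ∈ R → u <:+: D.W.map D.ℓ → (u ++ v).length < 5 * v.length)
    {H : Type*} [Group H] (h : P → H) (h1 : ∀ B ∈ D.W :: D.Bs, (B.map h).prod = 1)
    (h2 : ∀ i, h i * h (D.τ i) = 1)
    (hinj : ∀ i ∈ D.W, ∀ j ∈ D.W, pre h D.L i * h i = pre h D.L j * h j → i = j)
    {B : List P} (hB : B ∈ D.Bs) :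
    6 ≤ (B.toFinset.filter (fun d => ¬ D.γ base d)).card +
      (B.toFinset.filter (fun d => ¬ D.γ base d ∧ D.τ d ∈ D.W)).card +
      2 * (B.toFinset.filter (fun d => d = D.φ base)).card := by
  have hBm : B ∈ D.W :: D.Bs := by simp [hB]
  have hne : B ≠ [] := by
    intro e; have := hR.ne _ (D.cell B hB); simp [e] at this
  have hWB : ∀ i, i ∈ D.W → i ∉ B := by
    intro i hi hi'
    have hp := (List.nodup_flatten.1 D.flat_nodup).2
    rw [List.pairwise_cons] at hp
    exact hp.1 B hB hi hi'
  have hbW : base ∈ D.W := List.mem_of_getLast? hb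
  -- bounds for runs
  have hcell : ∀ j ∈ B, ∀ t < B.length, (∀ s < t, D.γ base ((D.π ^ s) j)) → D.τ ((D.π ^ t) j) ∉ D.W →
      15 * (t + 1) ≤ B.length := by
    intro j hj t ht hs hn
    obtain ⟨B', hB', hm⟩ := D.cover (D.τ ((D.π ^ t) j))
    have hB' : B' ∈ D.Bs := by
      rcases List.mem_cons.1 hB' with rfl | h
      · exact absurd hm hn
      · exact h
    exact run_short hR hmin hB hB' hj hs ht hm
  have hbd : ∀ j ∈ B, ∀ t < B.length, (∀ s < t, D.γ base ((D.π ^ s) j)) → D.τ ((D.π ^ t) j) ∈ D.W →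
      5 * (t + 1) < 4 * B.length := by
    intro j hj t ht hs hn
    obtain ⟨B1, B2, e⟩ := List.append_of_mem hj
    have hl : B.length = (j :: (B2 ++ B1)).length := by rw [e]; simp; omega
    have hin := run_W_infix hb hB e ht hs hn
    have hr := hR.inv _ (D.cell_rot hR hB e)
    rw [← List.take_append_drop (t + 1) (List.map D.ℓ _), FreeGroup.invRev_append] at hr
    have := hchunk _ _ (hR.rot _ _ hr) hin
    rw [List.length_append, FreeGroup.invRev_length, FreeGroup.invRev_length, List.length_take, List.length_drop,
      List.length_map, ← hl] at this
    omega
  set p : P → Prop := fun d => ¬ D.γ base d with hp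
  have hS : ∃ d ∈ B, p d := by
    by_contra hc
    push Not at hc
    have hc : ∀ d ∈ B, D.γ base d := fun d hd => not_not.1 (hc d hd)
    obtain ⟨j, hj⟩ := List.exists_mem_of_ne_nil B hne
    have hall : ∀ s, D.γ base ((D.π ^ s) j) := fun s => hc _ ((D.pow_mem hBm s).2 hj)
    have hpos := List.length_pos_of_mem hj
    by_cases hW : D.τ ((D.π ^ D.W.length) j) ∈ D.W
    · obtain ⟨a, ha⟩ := run_W hb (fun s _ => hall s) hW
      have := (List.getElem?_eq_some_iff.1 (ha D.W.length le_rfl)).1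
      omega
    · have hW2 : D.τ ((D.π ^ (B.length - 1)) j) ∉ D.W := by
        intro hx
        apply hW
        have h1 := run (t := D.W.length) (fun s _ => hall s) _ le_rfl
        have h2 := run (t := B.length - 1) (fun s _ => hall s) _ le_rfl
        rw [← D.pow_mem (by simp) D.W.length, h1, ← h2, D.pow_mem (by simp)]
        exact hx
      have := hcell j hj (B.length - 1) (by omega) (fun s _ => hall s) hW2
      omega
  obtain ⟨t, ht⟩ := exists_runs p hBm hS
  have hγ : ∀ j ∈ B, ∀ s < t j, D.γ base ((D.π ^ s) j) := fun j hj s hs => not_not.1 ((ht j hj).2.2 s hs)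
  set E : P → P := fun j => (D.π ^ (t j)) j with hE
  have hEB : ∀ j ∈ B, E j ∈ B := fun j hj => (D.pow_mem hBm _).2 hj
  set S := B.toFinset.filter (fun d => ¬ D.γ base d) with hSdef
  set T := B.toFinset.filter (fun d => ¬ D.γ base d ∧ D.τ d ∈ D.W) with hTdef
  have hTS : T ⊆ S := by intro d; simp [S, T]; tauto
  have hES : ∀ j ∈ B, E j ∈ S := by
    intro j hj; simp only [S, Finset.mem_filter, List.mem_toFinset]
    exact ⟨hEB j hj, (ht j hj).2.1⟩
  have hcard : B.length = ∑ d ∈ S, (B.toFinset.filter (fun j => E j = d)).card := by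
    rw [← List.toFinset_card_of_nodup (D.blk_nodup hBm)]
    exact Finset.card_eq_sum_card_fiberwise (fun j hj => hES j (by simpa using hj))
  have hpos : 0 < B.length := List.length_pos_iff.2 hne
  have hbT : ∀ d ∈ T, 5 * (B.toFinset.filter (fun j => E j = d)).card < 4 * B.length := by
    intro d hd
    have := fib_card (D := D) (B := B) t d ((4 * B.length - 1) / 5) (by
      intro j hj e
      have := hbd j hj (t j) (ht j hj).1 (hγ j hj) (by rw [e]; simp [T] at hd; exact hd.2.2)
      omega)
    simp only [hE]
    omega
  have hbS : ∀ d ∈ S \ T, 15 * (B.toFinset.filter (fun j => E j = d)).card ≤ B.length := by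
    intro d hd
    have := fib_card (D := D) (B := B) t d (B.length / 15) (by
      intro j hj e
      have := hcell j hj (t j) (ht j hj).1 (hγ j hj) (by rw [e]; simp [S, T] at hd; tauto)
      omega)
    simp only [hE]
    omega
  rw [← Finset.sum_sdiff hTS] at hcard
  have hsum1 : 15 * ∑ d ∈ S \ T, (B.toFinset.filter (fun j => E j = d)).card ≤ (S \ T).card * B.length := by
    rw [Finset.mul_sum]
    exact Finset.sum_le_card_nsmul _ _ _ hbS
  have hsd : (S \ T).card + T.card = S.card := Finset.card_sdiff_add_card_eq_card hTS
  rcases Nat.lt_or_ge T.card 3 with hT3 | hT3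
  swap
  · omega
  rcases Nat.lt_or_ge T.card 1 with hT | hT
  · have : T = ∅ := by rw [← Finset.card_eq_zero]; omega
    rw [this] at hcard hsum1 hsd
    simp at hcard hsum1 hsd
    rw [← hcard] at hsum1
    have : 15 ≤ S.card := le_of_mul_le_mul_right hsum1 hpos
    omega
  rcases Nat.lt_or_ge T.card 2 with hT' | hT'
  · obtain ⟨d, hd⟩ := Finset.card_eq_one.1 (show T.card = 1 by omega)
    have h5 := hbT d (by rw [hd]; simp)
    have : ∑ d ∈ T, (B.toFinset.filter (fun j => E j = d)).card = (B.toFinset.filter (fun j => E j = d)).card := by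
      rw [hd]; simp
    rw [this] at hcard
    by_contra hlt
    have h3 : (S \ T).card ≤ 3 := by omega
    have := Nat.mul_le_mul_right B.length h3
    omega
  · by_contra hlt
    -- σ argument
    have hσ : ∀ d ∈ S, ∀ d' ∈ S, E (D.π d) = E (D.π d') → d = d' := by
      have key : ∀ d ∈ S, ∀ d' ∈ S, E (D.π d) = E (D.π d') → t (D.π d) ≤ t (D.π d') → d = d' := by
        intro d hd d' hd' e hle
        simp only [hE] at e
        simp only [S, Finset.mem_filter, List.mem_toFinset] at hd hd'
        obtain ⟨q, hq⟩ := Nat.exists_eq_add_of_le hle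
        rw [hq, pow_add, Equiv.Perm.mul_apply] at e
        have e := (D.π ^ t (D.π d)).injective e
        rcases q with _ | q
        · simpa using e
        · rw [← D.pi_pow] at e
          have e := D.π.injective e
          exfalso
          have := hγ (D.π d') ((D.pi_mem hBm).2 hd'.1) q (by omega)
          rw [← e] at this
          exact hd.2 this
      intro d hd d' hd' e
      rcases le_total (t (D.π d)) (t (D.π d')) with hle | hle
      · exact key d hd d' hd' e hle
      · exact (key d' hd' d hd e.symm hle).symm
    have hex : ∃ d ∈ T, E (D.π d) ∈ T := by
      by_contra hno
      push Not at hno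
      have : T.card ≤ (S \ T).card := by
        refine Finset.card_le_card_of_injOn (fun d => E (D.π d)) ?_ ?_
        · intro d hd
          have hd := Finset.mem_coe.1 hd
          rw [Finset.mem_coe, Finset.mem_sdiff]
          refine ⟨hES _ ((D.pi_mem hBm).2 ?_), hno d hd⟩
          simp [T] at hd; exact hd.1
        · intro d hd d' hd' e
          exact hσ d (hTS hd) d' (hTS hd') e
      omega
    obtain ⟨d, hd, hd'⟩ := hex
    simp only [T, Finset.mem_filter, List.mem_toFinset] at hd hd'
    have hπd : D.π d ∈ B := (D.pi_mem hBm).2 hd.1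
    obtain ⟨a, ha⟩ := run_W hb (hγ _ hπd) hd'.2.2
    have h0 := ha (t (D.π d)) le_rfl
    rw [Nat.sub_self] at h0
    have h0 := List.mem_of_getElem? h0
    have hbig := corner_W h h1 h2 hinj hd.2.2 (by simpa using h0)
    have hdb : d = D.φ base := by
      by_contra hx
      exact hd.2.1 ⟨hbig, fun e => hWB base hbW (e ▸ hd.1), hx⟩
    have : 1 ≤ (B.toFinset.filter (fun d => d = D.φ base)).card := by
      rw [Nat.one_le_iff_ne_zero, Finset.card_ne_zero]
      exact ⟨d, by simp [hd.1, ← hdb]⟩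
    omega

end Dgm
end diag4
end Part6


section Part7
open FreeGroup
section diag5
set_option linter.unusedSectionVars false
variable {α : Type*}
namespace Dgm
variable {R : Set (List (α × Bool))} {P : Type} [Fintype P] [DecidableEq P] {D : Dgm R P} {base : P}

theorem cardF (p : P → Prop) [DecidablePred p] {l : List P} (h : l.Nodup) : (l.toFinset.filter p).card = l.countP (fun i => decide (p i)) := by
  have : l.toFinset.filter p = (l.filter (fun i => decide (p i))).toFinset := by ext; simp
  rw [this, List.toFinset_card_of_nodup (h.filter _), List.countP_eq_length_filter]

theorem no_mono (hR : SymR R) (hcyc : ∀ i ∈ D.W, D.ℓ (D.π i) ≠ ilt (D.ℓ i)) (i : P) : D.φ i ≠ i := by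
  intro h
  have hπ : D.π i = D.τ i := by rw [← D.tau_tau (D.π i), ← D.φ_apply, h]
  have hl : D.ℓ (D.π i) = ilt (D.ℓ i) := by rw [hπ, D.tau_lab]
  obtain ⟨B, hB, hi⟩ := D.cover i
  rcases List.mem_cons.1 hB with rfl | hB'
  · exact hcyc i hi hl
  · obtain ⟨B1, B2, e⟩ := List.append_of_mem hi
    have hr := hR.red _ (D.cell_rot hR hB' e)
    by_cases hc : 1 < (i :: (B2 ++ B1)).length
    · have e1 := D.cyc_spec' hB e 1 hc
      have hch := List.isChain_iff_getElem.1 hr 0 (by rw [List.length_map]; omega)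
      rw [pow_one] at e1
      simp only [List.getElem_map] at hch
      rw [e1] at hl
      simp only [zero_add] at hch
      rw [hl] at hch
      simp [ilt] at hch
    · have hlB : B.length = 1 := by
        have : B.length = (i :: (B2 ++ B1)).length := by rw [e]; simp; omega
        have : 0 < (i :: (B2 ++ B1)).length := by simp
        omega
      have := D.pow_len hB hi
      rw [hlB, pow_one, hπ] at this
      exact D.tau_ne i this

open Classical in
theorem contra (hR : SymR R) (hmin : ∀ k < D.Bs.length, ¬ Prd R k (FreeGroup.mk (D.W.map D.ℓ)))
    (hb : D.W.getLast? = some base)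
    (hchunk : ∀ u v, u ++ v ∈ R → u <:+: D.W.map D.ℓ → (u ++ v).length < 5 * v.length)
    (hcyc : ∀ i ∈ D.W, D.ℓ (D.π i) ≠ ilt (D.ℓ i))
    {H : Type*} [Group H] (h : P → H) (h1 : ∀ B ∈ D.W :: D.Bs, (B.map h).prod = 1)
    (h2 : ∀ i, h i * h (D.τ i) = 1)
    (hinj : ∀ i ∈ D.W, ∀ j ∈ D.W, pre h D.L i * h i = pre h D.L j * h j → i = j) : False := by
  have hne : Nonempty P := ⟨base⟩
  have heu := D.euler
  have hcy := cyc_count D.φ (no_mono hR hcyc)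
  set N := D.Bs.length with hN
  let p : P → Prop := fun d => ¬ D.γ base d
  let q : P → Prop := fun d => ¬ D.γ base d ∧ D.τ d ∈ D.W
  let z : P → Prop := fun d => d = D.φ base
  have hfn : D.Bs.flatten.Nodup := by
    have := D.flat_nodup
    rw [List.flatten_cons] at this
    exact this.of_append_right
  have hsum : ∀ Bs : List (List P), (∀ B ∈ Bs, B ∈ D.Bs) → 6 * Bs.length ≤ Bs.flatten.countP (fun i => decide (p i)) +
      Bs.flatten.countP (fun i => decide (q i)) + 2 * Bs.flatten.countP (fun i => decide (z i)) := by
    intro Bs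
    induction Bs with
    | nil => intro _; simp
    | cons B Bs ih =>
      intro hBs
      have ih := ih (fun B hB => hBs B (by simp [hB]))
      have hB := hBs B (by simp)
      have hnd : B.Nodup := D.blk_nodup (by simp [hB])
      have hpc := per_cell hR hmin hb hchunk h h1 h2 hinj hB
      rw [cardF _ hnd, cardF _ hnd, cardF _ hnd] at hpc
      simp only [List.flatten_cons, List.countP_append, List.length_cons]
      have e1 : B.countP (fun i => decide (p i)) = B.countP (fun i => decide (¬ D.γ base i)) := rfl
      have e2 : B.countP (fun i => decide (q i)) = B.countP (fun i => decide (¬ D.γ base i ∧ D.τ i ∈ D.W)) := rfl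
      have e3 : B.countP (fun i => decide (z i)) = B.countP (fun i => decide (i = D.φ base)) := rfl
      rw [e1, e2, e3]
      omega
  have hs := hsum D.Bs (fun _ h => h)
  rw [← cardF _ hfn, ← cardF _ hfn, ← cardF _ hfn] at hs
  have hz : (D.Bs.flatten.toFinset.filter z).card ≤ 1 := by
    rw [Finset.card_le_one]
    intro a ha b hb
    simp [z] at ha hb
    rw [ha.2, hb.2]
  have hWn : D.W.Nodup := D.blk_nodup (by simp)
  have hdisj : ∀ i, i ∈ D.W → i ∉ D.Bs.flatten := by
    have := D.flat_nodup
    rw [List.flatten_cons] at this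
    exact fun i hi => List.disjoint_of_nodup_append this hi
  have hq : (D.Bs.flatten.toFinset.filter q).card ≤ (D.W.toFinset.filter p).card := by
    refine Finset.card_le_card_of_injOn (fun d => D.φ.symm d) ?_ ?_
    · intro d hd
      simp [q] at hd
      have e : D.φ.symm d = D.π.symm (D.τ d) := by
        rw [Equiv.symm_apply_eq, φ_apply]; simp [D.tau_tau]
      rw [Finset.mem_coe, Finset.mem_filter, List.mem_toFinset]
      constructor
      · simp only [e]
        rw [← D.pi_mem (B := D.W) (by simp)]; simpa using hd.2.2
      · intro hg
        have := γ_inv hg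
        simp at this
        exact hd.2.1 this
    · intro d _ d' _ e
      exact D.φ.symm.injective e
  have hdu : (D.Bs.flatten.toFinset.filter p).card + (D.W.toFinset.filter p).card ≤ (Finset.univ.filter p).card := by
    rw [← Finset.card_union_of_disjoint]
    · apply Finset.card_le_card
      intro d hd
      simp at hd ⊢
      tauto
    · rw [Finset.disjoint_left]
      intro d hd hd'
      rw [Finset.mem_filter, List.mem_toFinset] at hd hd'
      exact hdisj d hd'.1 hd.1
  have hbe : (Finset.univ.filter (fun i => D.φ (D.φ i) = i)).card ≤ (Finset.univ.filter (fun i => D.γ base i)).card + 2 := by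
    have : (Finset.univ.filter (fun i => D.φ (D.φ i) = i)) ⊆ (Finset.univ.filter (fun i => D.γ base i)) ∪ {base, D.φ base} := by
      intro i hi
      simp only [Finset.mem_filter, Finset.mem_union, Finset.mem_insert, Finset.mem_singleton, Finset.mem_univ, true_and] at hi ⊢
      unfold γ
      tauto
    refine (Finset.card_le_card this).trans ((Finset.card_union_le _ _).trans ?_)
    have := Finset.card_le_two (a := base) (b := D.φ base)
    omega
  have htot : (Finset.univ.filter (fun i => D.γ base i)).card + (Finset.univ.filter p).card = Fintype.card P := by
    rw [← Finset.card_univ, ← Finset.card_filter_add_card_filter_not (s := Finset.univ) (fun i => D.γ base i)]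
  omega
end Dgm

theorem green_aux {R : Set (List (α × Bool))} (hR : SymR R) {w : List (α × Bool)} (hw : FreeGroup.IsReduced w) (hne : w ≠ [])
    (hmem : FreeGroup.mk w ∈ Subgroup.normalClosure (FreeGroup.mk '' R))
    (hprop : ∀ u, u <:+: w → u ≠ [] → u.length < w.length → FreeGroup.mk u ∉ Subgroup.normalClosure (FreeGroup.mk '' R))
    (hchunk : ∀ u v, u ++ v ∈ R → u <:+: w → (u ++ v).length < 5 * v.length) : False := by
  classical
  set NC := Subgroup.normalClosure (FreeGroup.mk '' R) with hNC
  have hex := Prd.of_normalClosure hR hmem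
  obtain ⟨n, D, hDw, hDN⟩ := exists_dgm (Prd.fill hR (Nat.find_spec hex) w rfl)
  have hWne : D.W ≠ [] := by rintro e; rw [e] at hDw; exact hne hDw.symm
  obtain ⟨base, hb⟩ : ∃ b, D.W.getLast? = some b := ⟨_, List.getLast?_eq_getLast_of_ne_nil hWne⟩
  have hlen : D.W.length = w.length := by rw [← hDw, List.length_map]
  have hWn : D.W.Nodup := D.blk_nodup (by simp)
  let h : Fin n → FreeGroup α ⧸ NC := fun i => QuotientGroup.mk (FreeGroup.mk [D.ℓ i])
  have hprod : ∀ l : List (Fin n), (l.map h).prod = QuotientGroup.mk (FreeGroup.mk (l.map D.ℓ)) := by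
    intro l
    induction l with
    | nil => rfl
    | cons a l ih =>
      rw [List.map_cons, List.prod_cons, ih, List.map_cons, mk_cons]; rfl
  have h1 : ∀ B ∈ D.W :: D.Bs, (B.map h).prod = 1 := by
    intro B hB
    rw [hprod, QuotientGroup.eq_one_iff]
    rcases List.mem_cons.1 hB with rfl | hB
    · rw [hDw]; exact hmem
    · exact Subgroup.subset_normalClosure ⟨_, D.cell B hB, rfl⟩
  refine Dgm.contra (D := D) (base := base) hR ?_ hb ?_ ?_ h h1 ?_ ?_
  · intro k hk
    rw [hDw]; rw [hDN] at hk
    exact Nat.find_min hex hk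
  · rw [hDw]; exact hchunk
  · intro i hi e
    obtain ⟨k, hk, rfl⟩ := List.getElem_of_mem hi
    rw [D.hπ D.W (by simp) _ (List.getElem_mem _), List.formPerm_apply_getElem _ hWn k hk] at e
    by_cases hk1 : k + 1 < D.W.length
    · simp only [Nat.mod_eq_of_lt hk1] at e
      have hch := List.isChain_iff_getElem.1 hw k (by omega)
      simp only [← hDw, List.getElem_map] at hch
      rw [e] at hch
      simp [ilt] at hch
    · have hk2 : k + 1 = D.W.length := by omega
      simp only [hk2, Nat.mod_self] at e
      rcases hD : D.W with _ | ⟨x, W'⟩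
      · exact hWne hD
      · rcases List.eq_nil_or_concat W' with rfl | ⟨W'', y, rfl⟩
        · simp only [hD] at e hk2
          simp at hk2
          subst hk2
          exact ilt_ne _ (by simpa using e.symm)
        · have hk3 : k = W''.length + 1 := by rw [hD] at hk2; simp at hk2; omega
          subst hk3
          simp [hD] at e
          rw [hD] at hDw
          simp at hDw
          have hW'' : W''.map D.ℓ ≠ [] := by
            intro e0
            have hch := List.isChain_iff_getElem.1 hw 0 (by rw [← hDw]; simp)
            simp only [← hDw, e0] at hch
            simp [e, ilt] at hch
          refine hprop (W''.map D.ℓ) ?_ hW'' ?_ ?_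
          · rw [← hDw]; exact ⟨[D.ℓ x], [D.ℓ y], by simp⟩
          · rw [← hDw]; simp
          · have hm := hmem
            rw [← hDw, mk_cons, mk_append, e, mk_ilt] at hm
            have hn : NC.Normal := Subgroup.normalClosure_normal
            have := hn.conj_mem _ hm (FreeGroup.mk [D.ℓ y])
            convert this using 1
            group
  · intro i
    change (QuotientGroup.mk _ : FreeGroup α ⧸ NC) * QuotientGroup.mk _ = 1
    rw [D.tau_lab, mk_ilt, ← QuotientGroup.mk_mul, mul_inv_cancel]; rfl
  · have key : ∀ a b (ha : a < D.W.length) (hb : b < D.W.length),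
        pre h D.L D.W[a] * h D.W[a] = pre h D.L D.W[b] * h D.W[b] → ¬ a < b := by
      intro a b ha hb e hab
      obtain ⟨κ, hκ⟩ := D.nW.key h D.nodup h1 D.W (by simp)
      have hpost : ∀ k (hk : k < D.W.length), pre h D.L D.W[k] * h D.W[k] = κ * ((D.W.take (k+1)).map h).prod := by
        intro k hk
        rw [hκ k hk, List.take_succ_eq_append_getElem hk, List.map_append, List.prod_append, mul_assoc]
        simp only [List.map_cons, List.map_nil, List.prod_cons, List.prod_nil, mul_one]
      rw [hpost a ha, hpost b hb] at e
      have e := mul_left_cancel e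
      have hsplit : D.W.take (b+1) = D.W.take (a+1) ++ (D.W.drop (a+1)).take (b - a) := by
        rw [show b + 1 = (a + 1) + (b - a) by omega, List.take_add]
      rw [hsplit, List.map_append, List.prod_append] at e
      have e := (mul_eq_left.1 e.symm)
      rw [hprod, QuotientGroup.eq_one_iff] at e
      have hl : ((D.W.drop (a+1)).take (b - a)).length = b - a := by simp; omega
      refine hprop _ ?_ ?_ ?_ e
      · rw [← hDw]
        exact ((List.take_prefix _ _).isInfix.trans (List.drop_suffix _ _).isInfix).map _
      · intro e0
        have := congrArg List.length e0
        rw [List.length_map, hl] at this; simp at this; omega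
      · rw [List.length_map, hl]; omega
    intro i hi j hj e
    obtain ⟨a, ha, rfl⟩ := List.getElem_of_mem hi
    obtain ⟨b, hb, rfl⟩ := List.getElem_of_mem hj
    have := key a b ha hb e
    have := key b a hb ha e.symm
    have : a = b := by omega
    subst this; rfl

/-- Greendlinger-type lemma. -/
theorem green {R : Set (List (α × Bool))} (hR : SymR R) : ∀ (n : ℕ) (w : List (α × Bool)), w.length = n → FreeGroup.IsReduced w → w ≠ [] →
    FreeGroup.mk w ∈ Subgroup.normalClosure (FreeGroup.mk '' R) →
    ∃ u v, u ++ v ∈ R ∧ u <:+: w ∧ 5 * v.length ≤ (u ++ v).length := by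
  intro n
  induction n using Nat.strong_induction_on with
  | _ n ih =>
    intro w hn hw hne hmem
    by_contra hc
    push Not at hc
    refine green_aux hR hw hne hmem ?_ hc
    intro u hu hune hul hmu
    obtain ⟨u', v', h1, h2, h3⟩ := ih u.length (by omega) u rfl (hw.infix hu) hune hmu
    exact absurd h3 (not_le.2 (hc u' v' h1 (h2.trans hu)))
end diag5
end Part7


section Part8
open FreeGroup
section blocks
variable {α : Type*}

theorem symR_of_sig (Rp : Set (List (α × Bool))) (Sig : Set (List (α × Bool)))
    (hne : ∀ r ∈ Rp, r ≠ []) (hred : ∀ r ∈ Rp, FreeGroup.IsReduced r)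
    (hrot : ∀ u v, u ++ v ∈ Rp → v ++ u ∈ Rp)
    (hex : ∀ q t, q ++ t ∈ Rp → (q ++ t).length < 15 * q.length → ∃ σ ∈ Sig, σ <:+: q)
    (huniq : ∀ σ ∈ Sig, ∀ t1 t2, σ ++ t1 ∈ Rp → σ ++ t2 ∈ Rp → t1 = t2)
    (hninv : ∀ σ ∈ Sig, ∀ t, FreeGroup.invRev (σ ++ t) ∉ Rp) :
    SymR (Rp ∪ {r | FreeGroup.invRev r ∈ Rp}) := by
  have hredinv : ∀ r : List (α × Bool), FreeGroup.IsReduced (FreeGroup.invRev r) → FreeGroup.IsReduced r := by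
    intro r hr
    have := hr
    unfold FreeGroup.IsReduced FreeGroup.invRev at this
    rw [List.isChain_reverse, List.isChain_map] at this
    unfold FreeGroup.IsReduced
    refine this.imp ?_
    intro a b h e
    have := h e.symm
    simpa using this.symm
  -- positive case
  have key : ∀ q t1 t2, q ++ t1 ∈ Rp → (q ++ t2 ∈ Rp ∨ FreeGroup.invRev (q ++ t2) ∈ Rp) →
      (q ++ t1).length < 15 * q.length → t1 = t2 := by
    intro q t1 t2 h1 h2 hl
    obtain ⟨σ, hσ, s, s', rfl⟩ := hex q t1 h1 hl
    have e1 : σ ++ (s' ++ t1 ++ s) ∈ Rp := by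
      have := hrot s (σ ++ (s' ++ t1)) (by simpa using h1)
      simpa using this
    rcases h2 with h2 | h2
    · have e2 : σ ++ (s' ++ t2 ++ s) ∈ Rp := by
        have := hrot s (σ ++ (s' ++ t2)) (by simpa using h2)
        simpa using this
      have := huniq σ hσ _ _ e1 e2
      simpa using this
    · exfalso
      refine hninv σ hσ (s' ++ t2 ++ s) ?_
      have := hrot (FreeGroup.invRev (σ ++ (s' ++ t2))) (FreeGroup.invRev s) (by
        rw [← FreeGroup.invRev_append]; simpa using h2)
      rw [← FreeGroup.invRev_append] at this
      simpa using this
  refine ⟨?_, ?_, ?_, ?_, ?_⟩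
  · rintro r (h | h) rfl
    · exact hne _ h rfl
    · exact hne _ h (by simp)
  · rintro r (h | h)
    · exact hred _ h
    · exact hredinv r (hred _ h)
  · rintro r (h | h)
    · right; show FreeGroup.invRev (FreeGroup.invRev r) ∈ Rp; rw [FreeGroup.invRev_invRev]; exact h
    · left; exact h
  · rintro u v (h | h)
    · left; exact hrot _ _ h
    · right
      change FreeGroup.invRev _ ∈ Rp at h
      change FreeGroup.invRev _ ∈ Rp
      rw [FreeGroup.invRev_append] at h ⊢
      exact hrot _ _ h
  · rintro q t1 t2 (h1 | h1) h2 hl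
    · exact key q t1 t2 h1 h2 hl
    · change FreeGroup.invRev _ ∈ Rp at h1
      rw [FreeGroup.invRev_append] at h1
      have h1 := hrot _ _ h1
      have h2' : FreeGroup.invRev q ++ FreeGroup.invRev t2 ∈ Rp ∨ FreeGroup.invRev (FreeGroup.invRev q ++ FreeGroup.invRev t2) ∈ Rp := by
        rcases h2 with h2 | h2
        · right; rw [FreeGroup.invRev_append, FreeGroup.invRev_invRev, FreeGroup.invRev_invRev]; exact hrot _ _ h2
        · left
          change FreeGroup.invRev _ ∈ Rp at h2
          rw [FreeGroup.invRev_append] at h2; exact hrot _ _ h2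
      have := key _ _ _ h1 h2' (by simpa [FreeGroup.invRev_length] using hl)
      exact FreeGroup.invRev_injective this

abbrev Blk (α : Type*) := List (α × Bool) × ℕ
def bw (y : α) (β : Blk α) : List (α × Bool) := β.1 ++ List.replicate β.2 (y, true)
def bwd (y : α) (Bl : List (Blk α)) : List (α × Bool) := (Bl.map (bw y)).flatten
structure OKB (y : α) (β : Blk α) : Prop where
  ne : β.1 ≠ []
  pos : 0 < β.2
  nm : ∀ l ∈ β.1, l.1 ≠ y
  red : FreeGroup.IsReduced β.1

@[simp] theorem bwd_nil (y : α) : bwd y [] = [] := rfl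
@[simp] theorem bwd_cons (y : α) (β : Blk α) (L) : bwd y (β :: L) = bw y β ++ bwd y L := rfl
@[simp] theorem bwd_append (y : α) (L L' : List (Blk α)) : bwd y (L ++ L') = bwd y L ++ bwd y L' := by
  simp [bwd]

theorem bsplit (y : α) : ∀ (Bl : List (Blk α)) (u v : List (α × Bool)), bwd y Bl = u ++ v → v ≠ [] →
    ∃ L1 β L2 t1 t2, Bl = L1 ++ β :: L2 ∧ bw y β = t1 ++ t2 ∧ t2 ≠ [] ∧ u = bwd y L1 ++ t1 ∧ v = t2 ++ bwd y L2 := by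
  intro Bl
  induction Bl with
  | nil => intro u v h hv; simp at h; exact absurd h.2 hv
  | cons β Bl ih =>
    intro u v h hv
    rw [bwd_cons, List.append_eq_append_iff] at h
    rcases h with ⟨c, h1, h2⟩ | ⟨c, h1, h2⟩
    · obtain ⟨L1, β', L2, t1, t2, e1, e2, e3, e4, e5⟩ := ih c v h2 hv
      exact ⟨β :: L1, β', L2, t1, t2, by simp [e1], e2, e3, by simp [h1, e4], e5⟩
    · by_cases hc : c = []
      · subst hc
        obtain ⟨L1, β', L2, t1, t2, e1, e2, e3, e4, e5⟩ := ih [] v (by simpa using h2.symm) hv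
        refine ⟨β :: L1, β', L2, t1, t2, by simp [e1], e2, e3, ?_, e5⟩
        have h1 : u = bw y β := by simpa using h1.symm
        rw [h1, bwd_cons, List.append_assoc, ← e4]; simp
      · exact ⟨[], β, Bl, u, c, rfl, h1, hc, by simp, h2⟩

theorem OKB.ynot {y : α} {β : Blk α} (h : OKB y β) : (y, true) ∉ β.1 := fun hm => h.nm _ hm rfl

/-- nonempty suffixes of blocks end in `y` -/
theorem bw_suffix {y : α} {β : Blk α} (h : OKB y β) {t1 t2 : List (α × Bool)} (e : bw y β = t1 ++ t2) (ht : t2 ≠ []) :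
    ∃ t, t2 = t ++ [(y, true)] := by
  obtain ⟨n, hn⟩ := Nat.exists_eq_succ_of_ne_zero h.pos.ne'
  unfold bw at e
  rw [hn, List.replicate_succ'] at e
  rcases List.eq_nil_or_concat t2 with h0 | ⟨t, x, rfl⟩
  · exact absurd h0 ht
  · refine ⟨t, ?_⟩
    rw [List.concat_eq_append] at e ⊢
    have : (β.1 ++ List.replicate n (y, true)) ++ [(y, true)] = (t1 ++ t) ++ [x] := by simpa using e
    have := (List.append_inj' this rfl).2
    rw [this]

theorem align {y : α} {Bl : List (Blk α)} (hok : ∀ β ∈ Bl, OKB y β) {u v : List (α × Bool)} (h : bwd y Bl = u ++ v)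
    {z : α × Bool} {v' : List (α × Bool)} (hv : v = z :: v') (hz : z ≠ (y, true)) (hu : u = [] ∨ ∃ u', u = u' ++ [(y, true)]) :
    ∃ L1 L2, Bl = L1 ++ L2 ∧ u = bwd y L1 ∧ v = bwd y L2 := by
  obtain ⟨L1, β, L2, t1, t2, e1, e2, e3, e4, e5⟩ := bsplit y Bl u v h (by simp [hv])
  have hβ := hok β (by simp [e1])
  have ht1 : t1 = [] := by
    by_contra hne
    have ht1 : ∃ t, t1 = t ++ [(y, true)] := by
      rcases List.eq_nil_or_concat t1 with h0 | ⟨t, x, rfl⟩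
      · exact absurd h0 hne
      · rcases hu with hu | ⟨u', hu⟩
        · rw [hu] at e4; simp at e4
        · rw [hu, List.concat_eq_append, ← List.append_assoc] at e4
          have := (List.append_inj' e4 rfl).2
          exact ⟨t, by rw [this]; simp⟩
    have hz2 : ∃ t2', t2 = z :: t2' := by
      rcases t2 with _ | ⟨a, t2'⟩
      · exact absurd rfl e3
      · rw [hv] at e5; simp at e5; exact ⟨t2', by rw [e5.1]⟩
    obtain ⟨t, ht⟩ := ht1
    obtain ⟨t2', ht2⟩ := hz2
    unfold bw at e2
    rcases List.append_eq_append_iff.1 e2 with ⟨c, h1, h2⟩ | ⟨c, h1, h2⟩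
    · have : z ∈ List.replicate β.2 (y, true) := by rw [h2, ht2]; simp
      exact hz (List.eq_of_mem_replicate this)
    · exact hβ.ynot (by rw [h1, ht]; simp)
  subst ht1
  refine ⟨L1, β :: L2, e1, by simpa using e4, ?_⟩
  rw [e5, bwd_cons, e2]; simp

theorem parse1 {Y : α × Bool} : ∀ {U U' : List (α × Bool)} {e e' : ℕ} {r r' : List (α × Bool)},
    U ++ (List.replicate e Y ++ r) = U' ++ (List.replicate e' Y ++ r') → Y ∉ U → Y ∉ U' → 0 < e → 0 < e' →
    r.head? ≠ some Y → r'.head? ≠ some Y → U = U' ∧ e = e' ∧ r = r' := by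
  have rep : ∀ {e e' : ℕ} {r r' : List (α × Bool)}, List.replicate e Y ++ r = List.replicate e' Y ++ r' →
      r.head? ≠ some Y → r'.head? ≠ some Y → e = e' ∧ r = r' := by
    intro e
    induction e with
    | zero =>
      intro e' r r' h h1 h2
      rcases e' with _ | e'
      · simpa using h
      · simp [List.replicate_succ] at h; rw [h] at h1; simp at h1
    | succ e ih =>
      intro e' r r' h h1 h2
      rcases e' with _ | e'
      · simp [List.replicate_succ] at h; rw [← h] at h2; simp at h2
      · simp only [List.replicate_succ, List.cons_append, List.cons.injEq, true_and] at h
        have := ih h h1 h2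
        exact ⟨by omega, this.2⟩
  intro U
  induction U with
  | nil =>
    intro U' e e' r r' h h1 h2 he he' h3 h4
    rcases U' with _ | ⟨a, U'⟩
    · exact ⟨rfl, rep h h3 h4⟩
    · exfalso
      obtain ⟨n, rfl⟩ := Nat.exists_eq_succ_of_ne_zero he.ne'
      simp [List.replicate_succ] at h
      exact h2 (by rw [h.1]; simp)
  | cons b U ih =>
    intro U' e e' r r' h h1 h2 he he' h3 h4
    rcases U' with _ | ⟨a, U'⟩
    · exfalso
      obtain ⟨n, rfl⟩ := Nat.exists_eq_succ_of_ne_zero he'.ne'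
      simp [List.replicate_succ] at h
      exact h1 (by rw [h.1]; simp)
    · simp only [List.cons_append, List.cons.injEq] at h
      have := ih h.2 (fun hh => h1 (by simp [hh])) (fun hh => h2 (by simp [hh])) he he' h3 h4
      exact ⟨by rw [h.1, this.1], this.2⟩

theorem bwd_head {y : α} {Bl : List (Blk α)} (hok : ∀ β ∈ Bl, OKB y β) : (bwd y Bl).head? ≠ some (y, true) := by
  rcases Bl with _ | ⟨β, L⟩
  · simp
  · have h := hok β (by simp)
    rcases hU : β.1 with _ | ⟨a, U⟩
    · exact absurd hU h.ne
    · simp only [bwd_cons, bw, hU, List.cons_append, List.head?_cons]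
      intro e
      have := Option.some.inj e
      exact h.ynot (by rw [hU, this]; simp)

theorem first_blk {y : α} {L : List (Blk α)} (hok : ∀ β ∈ L, OKB y β) {U : List (α × Bool)} {e : ℕ} {r : List (α × Bool)}
    (hU : (y, true) ∉ U) (he : 0 < e) (hr : r.head? ≠ some (y, true)) (h : bwd y L = U ++ (List.replicate e (y, true) ++ r)) :
    ∃ L', L = (U, e) :: L' ∧ bwd y L' = r := by
  rcases L with _ | ⟨β, L⟩
  · have := congrArg List.length h
    simp at this; omega
  · have hβ := hok β (by simp)
    have hL : ∀ β ∈ L, OKB y β := fun β hb => hok β (by simp [hb])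
    rw [bwd_cons, bw, List.append_assoc] at h
    obtain ⟨h1, h2, h3⟩ := parse1 h hβ.ynot hU hβ.pos he (bwd_head hL) hr
    exact ⟨L, by rw [← h1, ← h2], h3⟩

theorem bwd_inj {y : α} : ∀ {L L' : List (Blk α)}, (∀ β ∈ L, OKB y β) → (∀ β ∈ L', OKB y β) → bwd y L = bwd y L' → L = L' := by
  intro L
  induction L with
  | nil =>
    intro L' _ h' h
    rcases L' with _ | ⟨β, L'⟩
    · rfl
    · have := congrArg List.length h
      have h2 := (h' β (by simp)).pos
      simp [bw] at this; omega
  | cons β L ih =>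
    intro L' h1 h2 h
    have hβ := h1 β (by simp)
    have hL : ∀ β ∈ L, OKB y β := fun β hb => h1 β (by simp [hb])
    obtain ⟨L'', e1, e2⟩ := first_blk h2 hβ.ynot hβ.pos (bwd_head hL) (by rw [← h, bwd_cons, bw, List.append_assoc])
    rw [e1, ih hL (fun β hb => h2 β (by simp [e1, hb])) e2.symm]

theorem nodup_split {γ : Type*} {a : γ} : ∀ {L1 L2 L1' L2' : List γ}, (L1 ++ a :: L2).Nodup → L1 ++ a :: L2 = L1' ++ a :: L2' →
    L1 = L1' ∧ L2 = L2' := by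
  intro L1
  induction L1 with
  | nil =>
    intro L2 L1' L2' hn h
    rcases L1' with _ | ⟨b, L1'⟩
    · simpa using h
    · simp at h hn
      exact absurd (by rw [h.2]; simp) hn.1
  | cons c L1 ih =>
    intro L2 L1' L2' hn h
    rcases L1' with _ | ⟨b, L1'⟩
    · simp at h hn
      exact absurd h.1 (by tauto)
    · simp only [List.cons_append, List.cons.injEq] at h
      have := ih (by simp at hn ⊢; tauto) h.2
      exact ⟨by rw [h.1, this.1], this.2⟩

/-- a rotation beginning with a signature is aligned -/
theorem sig_align {y : α} {Bl : List (Blk α)} (hok : ∀ β ∈ Bl, OKB y β) {u v : List (α × Bool)} (h : bwd y Bl = u ++ v)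
    {U : List (α × Bool)} {e : ℕ} {z : α × Bool} {t : List (α × Bool)} (hU : ∀ l ∈ U, l.1 ≠ y) (hUne : U ≠ []) (he : 0 < e)
    (hz : z ≠ (y, true)) (hr : v ++ u = [(y, true)] ++ U ++ List.replicate e (y, true) ++ [z] ++ t) :
    ∃ L1 L2, Bl = L1 ++ (U, e) :: L2 ∧ U ++ List.replicate e (y, true) ++ [z] ++ t ++ [(y, true)] = bwd y ((U, e) :: (L2 ++ L1)) := by
  -- rotate by one
  have hyU : (y, true) ∉ U := fun hm => hU _ hm rfl
  obtain ⟨a, U', rfl⟩ := List.exists_cons_of_ne_nil hUne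
  have ha : a ≠ (y, true) := fun e => hU a (by simp) (by rw [e])
  obtain ⟨L1, L2, e1, e2⟩ : ∃ L1 L2, Bl = L1 ++ L2 ∧
      (a :: U') ++ List.replicate e (y, true) ++ [z] ++ t ++ [(y, true)] = bwd y (L2 ++ L1) := by
    rcases v with _ | ⟨x, v⟩
    · have hu : u = (y, true) :: ((a :: U') ++ List.replicate e (y, true) ++ [z] ++ t) := by simpa using hr
      exfalso
      have := bwd_head hok
      rw [h, List.nil_append] at *
      rw [h] at this
      simp [hu] at this
    · simp only [List.cons_append, List.nil_append, List.cons.injEq] at hr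
      obtain ⟨rfl, hr⟩ := hr
      rcases v with _ | ⟨b, v⟩
      · simp only [List.nil_append] at hr
        refine ⟨Bl, [], by simp, ?_⟩
        rw [List.nil_append, h, hr]; simp
      · simp only [List.cons_append, List.cons.injEq] at hr
        obtain ⟨L1, L2, e1, e2, e3⟩ := align hok (u := u ++ [(y, true)]) (v := b :: v) (by rw [h]; simp) rfl
          (by rw [hr.1]; exact ha) (Or.inr ⟨u, rfl⟩)
        refine ⟨L1, L2, e1, ?_⟩
        rw [bwd_append, ← e2, ← e3, hr.1]
        simp only [List.cons_append]
        rw [show v ++ (u ++ [(y, true)]) = (v ++ u) ++ [(y, true)] by simp, hr.2]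
  have hok2 : ∀ β ∈ L2 ++ L1, OKB y β := by
    intro β hb; apply hok; rw [e1]; simp at hb ⊢; tauto
  obtain ⟨L', hL', hL'2⟩ := first_blk (r := [z] ++ t ++ [(y, true)]) hok2 hyU he (by simpa using hz) (by rw [← e2]; simp)
  rw [e2, hL']
  rcases L2 with _ | ⟨c, L2⟩
  · simp at hL'
    refine ⟨[], L', by rw [e1, hL']; simp, by simp⟩
  · simp only [List.cons_append, List.cons.injEq] at hL'
    refine ⟨L1, L2, by rw [e1, hL'.1], by rw [← hL'.2]⟩

/-- existence of signatures -/
theorem sig_exists {y : α} {bad good : List (Blk α)} (hok : ∀ β ∈ bad ++ good, OKB y β) {M : ℕ}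
    (hM : ∀ β ∈ good, (bw y β).length ≤ M) (hg : 4 ≤ good.length) {u v q t : List (α × Bool)}
    (h : bwd y (bad ++ good) = u ++ v) (hq : v ++ u = q ++ t) (hl : (bwd y bad).length + 2 * M + 1 ≤ q.length) :
    ∃ β ∈ good, ∃ z, z ≠ (y, true) ∧ [(y, true)] ++ β.1 ++ List.replicate β.2 (y, true) ++ [z] <:+: q := by
  -- wlog v nonempty
  obtain ⟨u, v, h, hq, hv⟩ : ∃ u v, bwd y (bad ++ good) = u ++ v ∧ v ++ u = q ++ t ∧ v ≠ [] := by
    by_cases hv : v = []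
    · refine ⟨[], u, by rw [h, hv]; simp, by rw [← hq, hv]; simp, ?_⟩
      rintro rfl
      have := congrArg List.length hq
      rw [hv] at this
      simp at this; omega
    · exact ⟨u, v, h, hq, hv⟩
  obtain ⟨L1, β, L2, t1, t2, e1, e2, e3, e4, e5⟩ := bsplit y _ u v h hv
  have hβ := hok β (by rw [e1]; simp)
  obtain ⟨t2', ht2⟩ := bw_suffix hβ e2 e3
  have hfin : ∀ (A : List (Blk α)) (g g' : Blk α) (C : List (α × Bool)), g ∈ good → OKB y g' → 
      q ++ t = t2 ++ bwd y A ++ bw y g ++ bw y g' ++ C → (∀ a ∈ A, OKB y a) →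
      t2.length + (bwd y A).length ≤ (bwd y bad).length + M → 
      ∃ β ∈ good, ∃ z, z ≠ (y, true) ∧ [(y, true)] ++ β.1 ++ List.replicate β.2 (y, true) ++ [z] <:+: q := by
    intro A g g' C hgg hg' hqt hA hlen
    obtain ⟨z, U', hz⟩ := List.exists_cons_of_ne_nil hg'.ne
    have hzy : z ≠ (y, true) := fun e => hg'.ynot (by rw [hz, e]; simp)
    have hpre : t2 ++ bwd y A ++ bw y g ++ [z] <+: q := by
      refine List.prefix_of_prefix_length_le (l₃ := q ++ t) ?_ (List.prefix_append _ _) ?_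
      · exact ⟨U' ++ List.replicate g'.2 (y, true) ++ C, by rw [hqt]; simp [bw, hz]⟩
      · have := hM g hgg
        simp only [List.length_append, List.length_singleton]; omega
    refine ⟨g, hgg, z, hzy, List.IsInfix.trans ?_ hpre.isInfix⟩
    have hend : ∃ T, t2 ++ bwd y A = T ++ [(y, true)] := by
      rcases List.eq_nil_or_concat A with rfl | ⟨A', a, rfl⟩
      · exact ⟨t2', by simp [ht2]⟩
      · obtain ⟨t', ht'⟩ := bw_suffix (hA a (by simp)) (t1 := []) (t2 := bw y a) rfl (by
          have := (hA a (by simp)).ne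
          simp [bw, this])
        exact ⟨t2 ++ bwd y A' ++ t', by simp [ht']⟩
    obtain ⟨T, hT⟩ := hend
    rw [hT]
    exact ⟨T, [], by simp [bw]⟩
  have hqt : q ++ t = t2 ++ bwd y (L2 ++ L1) ++ t1 := by rw [← hq, e4, e5]; simp
  obtain ⟨g1, g2, good', hgood⟩ : ∃ a b l, good = a :: b :: l := by
    rcases good with _ | ⟨a, _ | ⟨b, l⟩⟩
    · simp at hg
    · simp at hg
    · exact ⟨a, b, l, rfl⟩
  have ht2β : t2.length ≤ (bw y β).length := by rw [e2]; simp
  rcases List.append_eq_append_iff.1 e1 with ⟨c, h1, h2⟩ | ⟨c, h1, h2⟩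
  · -- β in good: L1 = bad ++ c
    have hβg : β ∈ good := by rw [h2]; simp
    have hMβ := hM β hβg
    rcases L2 with _ | ⟨g, _ | ⟨g', L2⟩⟩
    · -- then bad, then good
      rcases c with _ | ⟨c1, _ | ⟨c2, c⟩⟩
      · rw [h2] at hg; simp at hg
      · rw [h2] at hg; simp at hg
      · refine hfin bad c1 c2 (bwd y c ++ t1) (by rw [h2]; simp) (hok c2 (by rw [h2]; simp)) ?_ (fun a ha => hok a (by simp [ha])) (by omega)
        rw [hqt, h1]; simp
    · rcases hL1 : L1 with _ | ⟨g', L1'⟩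
      · exfalso
        rw [hL1] at h1
        have := List.append_eq_nil_iff.1 h1.symm
        rw [h2, this.2] at hg; simp at hg
      · refine hfin [] g g' (bwd y L1' ++ t1) (by rw [h2]; simp) (hok g' (by rw [e1, hL1]; simp)) ?_ (by simp) (by simp; omega)
        rw [hqt, hL1]; simp
    · refine hfin [] g g' (bwd y (L2 ++ L1) ++ t1) (by rw [h2]; simp) (hok g' (by rw [h2]; simp)) ?_ (by simp) (by simp; omega)
      rw [hqt]; simp
  · rcases c with _ | ⟨c0, c⟩
    · simp only [List.nil_append] at h2
      rcases L2 with _ | ⟨g, _ | ⟨g', L2⟩⟩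
      · rw [← h2] at hg; simp at hg
      · rw [← h2] at hg; simp at hg
      · have hMβ := hM β (by rw [← h2]; simp)
        refine hfin [] g g' (bwd y (L2 ++ L1) ++ t1) (by rw [← h2]; simp) (hok g' (by rw [← h2]; simp)) ?_ (by simp) (by simp; omega)
        rw [hqt]; simp
    · simp only [List.cons_append, List.cons.injEq] at h2
      obtain ⟨rfl, h2⟩ := h2
      refine hfin c g1 g2 (bwd y (good' ++ L1) ++ t1) (by rw [hgood]; simp) (hok g2 (by rw [hgood]; simp)) ?_ (fun a ha => hok a (by rw [h1]; simp [ha])) ?_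
      · rw [hqt, h2, hgood]; simp
      · rw [h1]; simp; omega

/-- words made of OK blocks are reduced -/
theorem bwd_red {y : α} : ∀ {Bl : List (Blk α)}, (∀ β ∈ Bl, OKB y β) → FreeGroup.IsReduced (bwd y Bl) := by
  intro Bl
  induction Bl with
  | nil => intro _; simp [FreeGroup.IsReduced]
  | cons β L ih =>
    intro h
    have hβ := h β (by simp)
    have hL : ∀ β ∈ L, OKB y β := fun β hb => h β (by simp [hb])
    have hl : ∀ (k : ℕ) (t : List (α × Bool)), FreeGroup.IsReduced t → (∀ z ∈ t.head?, z.1 ≠ y) →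
        FreeGroup.IsReduced (List.replicate k (y, true) ++ t) := by
      intro k t ht hz
      induction k with
      | zero => simpa using ht
      | succ k ihk =>
        rw [List.replicate_succ, List.cons_append]
        unfold FreeGroup.IsReduced at ihk ⊢
        rw [List.isChain_cons]
        refine ⟨?_, ihk⟩
        intro z hzz e
        rcases k with _ | k
        · exact absurd e.symm (hz z (by simpa using hzz))
        · simp [List.replicate_succ] at hzz; rw [← hzz]
    have h1 : FreeGroup.IsReduced (List.replicate β.2 (y, true) ++ bwd y L) := by
      refine hl _ _ (ih hL) ?_
      rcases L with _ | ⟨β', L⟩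
      · simp
      · have hb' := hL β' (by simp)
        obtain ⟨a, U, hU⟩ := List.exists_cons_of_ne_nil hb'.ne
        intro z hz
        simp [bw, hU] at hz
        exact hb'.nm z (by rw [hU, ← hz]; simp)
    rw [bwd_cons, bw, List.append_assoc]
    unfold FreeGroup.IsReduced at h1 ⊢
    rw [List.isChain_append]
    refine ⟨hβ.red, h1, ?_⟩
    intro a ha z hz e
    obtain ⟨n, hn⟩ := Nat.exists_eq_succ_of_ne_zero hβ.pos.ne'
    rw [hn, List.replicate_succ] at hz
    simp at hz
    exact absurd (by rw [e, ← hz]) (hβ.nm a (List.mem_of_getLast? ha))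

theorem rot_red {y : α} {Bl : List (Blk α)} (hok : ∀ β ∈ Bl, OKB y β) {u v : List (α × Bool)} (h : bwd y Bl = u ++ v) :
    FreeGroup.IsReduced (v ++ u) := by
  have : FreeGroup.IsReduced (bwd y (Bl ++ Bl)) := bwd_red (by intro β hb; apply hok; simpa using hb)
  refine this.infix ⟨u, v, ?_⟩
  rw [bwd_append, h]; simp

end blocks
end Part8


section Part9
open FreeGroup
section concrete

theorem rot_split {α : Type*} {l l' : List α} (h : l ~r l') : ∃ u v, l = u ++ v ∧ l' = v ++ u := by
  obtain ⟨n, hn⟩ := h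
  rw [List.rotate_eq_drop_append_take_mod] at hn
  exact ⟨_, _, (List.take_append_drop _ _).symm, hn.symm⟩

theorem rot_app {α : Type*} (u v : List α) : (u ++ v) ~r (v ++ u) := List.isRotated_append

inductive CT {A : Type} : ℕ → GenSym A → GenSym A → Prop
  | v12 : CT 4000 GenSym.f1 GenSym.f2
  | v21 : CT 4000 GenSym.f2 GenSym.f1
  | b1 : CT 1000 GenSym.b GenSym.f1
  | b2 : CT 1000 GenSym.b GenSym.f2
  | c1 : CT 2000 GenSym.c GenSym.f1
  | c2 : CT 2000 GenSym.c GenSym.f2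
  | d1 : CT 3000 GenSym.d GenSym.f1
  | d2 : CT 3000 GenSym.d GenSym.f2
  | ac (a : A) : CT 0 (GenSym.elt a) GenSym.c
  | ad (a : A) : CT 0 (GenSym.elt a) GenSym.d

theorem CT.ne {A : Type} {lo : ℕ} {x y : GenSym A} (h : CT lo x y) : x ≠ y := by cases h <;> simp

theorem CT.lo {A : Type} {lo : ℕ} {x y : GenSym A} (h : CT lo x y) : lo = 0 ∨ lo = 1000 ∨ lo = 2000 ∨ lo = 3000 ∨ lo = 4000 := by
  cases h <;> simp

def chainBl {A : Type} (lo : ℕ) (x : GenSym A) : List (Blk (GenSym A)) :=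
  (List.range 1000).map fun k => ([(x, true)], (lo + k + 1) ^ 2)

def elX {A : Type} {n : ℕ} (as : Fin n → A) : List (GenSym A × Bool) := (List.ofFn as).map fun a => (GenSym.elt a, true)

def wgood {A : Type} (m : ℕ) (X : List (GenSym A × Bool)) : List (Blk (GenSym A)) :=
  (List.range 98).map fun k => (X, 100 * m + k + 2)

def wbad {A : Type} (m : ℕ) (X : List (GenSym A × Bool)) : List (GenSym A × Bool) → List (Blk (GenSym A))
  | [] => [(X, 200 * m + 101)]
  | v :: V => [(X, 100 * m + 100), (v :: V, 100 * m + 1)]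

def WV (S : IndexedStructure) (m : ℕ) (as : Fin (S.arity m) → S.A) (V : List (GenSym S.A × Bool)) : Prop :=
  (¬ S.isFunc m ∧ S.relInterp m as ∧ V = elX as) ∨
  (S.isFunc m ∧ (elX as = (GenSym.elt (S.funcInterp m as), true) :: V ∨
    (V = (GenSym.elt (S.funcInterp m as), false) :: elX as ∧ (elX as).head? ≠ some (GenSym.elt (S.funcInterp m as), true))))

inductive Rl (S : IndexedStructure) : GenSym S.A → List (Blk (GenSym S.A)) → List (Blk (GenSym S.A)) → Prop
  | ch {lo x y} : CT lo x y → Rl S y [] (chainBl lo x)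
  | w {m as V} : 1 ≤ m → WV S m as V → Rl S GenSym.b (wbad m (elX as) V) (wgood m (elX as))

theorem mem_elX {A : Type} {n : ℕ} {as : Fin n → A} {l : GenSym A × Bool} (h : l ∈ elX as) : ∃ a, l = (GenSym.elt a, true) := by
  simp only [elX, List.mem_map] at h
  obtain ⟨a, _, rfl⟩ := h
  exact ⟨a, rfl⟩

theorem elX_len {A : Type} {n : ℕ} (as : Fin n → A) : (elX as).length = n := by simp [elX]

theorem elX_red {A : Type} {n : ℕ} (as : Fin n → A) : FreeGroup.IsReduced (elX as) := by
  unfold FreeGroup.IsReduced elX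
  rw [List.isChain_map]
  exact List.Pairwise.isChain (List.pairwise_of_forall (by simp))

theorem WV.mem {S : IndexedStructure} {m : ℕ} {as : Fin (S.arity m) → S.A} {V} (h : WV S m as V) {l} (hl : l ∈ V) : ∃ a, l.1 = GenSym.elt a := by
  rcases h with ⟨_, _, rfl⟩ | ⟨_, h | ⟨rfl, _⟩⟩
  · obtain ⟨a, rfl⟩ := mem_elX hl; exact ⟨a, rfl⟩
  · obtain ⟨a, rfl⟩ := mem_elX (as := as) (l := l) (by rw [h]; simp [hl]); exact ⟨a, rfl⟩
  · rcases List.mem_cons.1 hl with rfl | hl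
    · exact ⟨_, rfl⟩
    · obtain ⟨a, rfl⟩ := mem_elX hl; exact ⟨a, rfl⟩

theorem WV.red {S : IndexedStructure} {m : ℕ} {as : Fin (S.arity m) → S.A} {V} (h : WV S m as V) : FreeGroup.IsReduced V := by
  rcases h with ⟨_, _, rfl⟩ | ⟨_, h | ⟨rfl, h⟩⟩
  · exact elX_red as
  · have := elX_red as
    rw [h] at this
    exact this.infix ⟨[(GenSym.elt (S.funcInterp m as), true)], [], by simp⟩
  · have := elX_red as
    unfold FreeGroup.IsReduced at this ⊢
    rw [List.isChain_cons]
    refine ⟨?_, this⟩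
    intro z hz e
    obtain ⟨a, rfl⟩ := mem_elX (List.mem_of_head? hz)
    simp at e
    subst e
    exact absurd hz h

theorem WV.len {S : IndexedStructure} {m : ℕ} {as : Fin (S.arity m) → S.A} {V} (h : WV S m as V) : V.length ≤ S.arity m + 1 := by
  rcases h with ⟨_, _, rfl⟩ | ⟨_, h | ⟨rfl, h⟩⟩
  · simp [elX_len]
  · have := congrArg List.length h
    rw [elX_len] at this; simp at this; omega
  · simp [elX_len]

theorem WV.uniq {S : IndexedStructure} {m : ℕ} {as : Fin (S.arity m) → S.A} {V V'} (h : WV S m as V) (h' : WV S m as V') : V = V' := by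
  rcases h with ⟨h0, _, rfl⟩ | ⟨h0, h | ⟨rfl, h⟩⟩ <;> rcases h' with ⟨h1, _, rfl⟩ | ⟨h1, h' | ⟨rfl, h'⟩⟩ <;> try (first | rfl | exact absurd h0 h1 | exact absurd h1 h0)
  · rw [h] at h'; simpa using h'
  · rw [h] at h'; simp at h'
  · rw [h'] at h; simp at h

theorem mem_wbad {A : Type} {m : ℕ} {X V : List (GenSym A × Bool)} {β} (h : β ∈ wbad m X V) :
    β = (X, 200 * m + 101) ∨ β = (X, 100 * m + 100) ∨ (V ≠ [] ∧ β = (V, 100 * m + 1)) := by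
  rcases V with _ | ⟨v, V⟩
  · left; simpa [wbad] using h
  · right; simpa [wbad] using h

theorem mem_wgood {A : Type} {m : ℕ} {X : List (GenSym A × Bool)} {β} (h : β ∈ wgood m X) :
    ∃ k < 98, β = (X, 100 * m + k + 2) := by
  simp only [wgood, List.mem_map, List.mem_range] at h
  obtain ⟨k, hk, rfl⟩ := h
  exact ⟨k, hk, rfl⟩

theorem mem_chainBl {A : Type} {lo : ℕ} {x : GenSym A} {β} (h : β ∈ chainBl lo x) :
    ∃ k < 1000, β = ([(x, true)], (lo + k + 1) ^ 2) := by
  simp only [chainBl, List.mem_map, List.mem_range] at h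
  obtain ⟨k, hk, rfl⟩ := h
  exact ⟨k, hk, rfl⟩

theorem chain_ok {A : Type} {lo : ℕ} {x y : GenSym A} (h : x ≠ y) : ∀ β ∈ chainBl lo x, OKB y β := by
  intro β hb
  obtain ⟨k, hk, rfl⟩ := mem_chainBl hb
  exact ⟨by simp, by positivity, by simpa using h, by simp [FreeGroup.IsReduced]⟩

theorem chain_nodup {A : Type} (lo : ℕ) (x : GenSym A) : (chainBl lo x).Nodup := by
  unfold chainBl
  refine List.Nodup.map ?_ List.nodup_range
  intro a b h
  simp only [Prod.mk.injEq, true_and] at h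
  have := Nat.pow_left_injective (n := 2) (by norm_num) h
  omega

variable {S : IndexedStructure}

theorem Rl.ok {y bad good} (h : Rl S y bad good) : ∀ β ∈ bad ++ good, OKB y β := by
  cases h with
  | ch h => simpa using chain_ok h.ne
  | @w m as V hm hV =>
    have hX : elX as ≠ [] := by
      have := S.arity_pos m hm
      rw [← List.length_pos_iff, elX_len]; omega
    have hXb : ∀ l ∈ elX as, l.1 ≠ GenSym.b := by
      intro l hl; obtain ⟨a, rfl⟩ := mem_elX hl; simp
    intro β hb
    rcases List.mem_append.1 hb with hb | hb
    · rcases mem_wbad hb with rfl | rfl | ⟨hne, rfl⟩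
      · exact ⟨hX, by simp, hXb, elX_red as⟩
      · exact ⟨hX, by simp, hXb, elX_red as⟩
      · refine ⟨hne, by simp, ?_, hV.red⟩
        intro l hl
        obtain ⟨a, ha⟩ := hV.mem hl
        rw [ha]; simp
    · obtain ⟨k, hk, rfl⟩ := mem_wgood hb
      exact ⟨hX, by simp, hXb, elX_red as⟩

theorem Rl.glen {y bad good} (h : Rl S y bad good) : 4 ≤ good.length := by
  cases h <;> simp [chainBl, wgood]

theorem Rl.nodup {y bad good} (h : Rl S y bad good) : (bad ++ good).Nodup := by
  cases h with
  | ch h => simpa using chain_nodup _ _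
  | @w m as V hm hV =>
    rw [List.nodup_append]
    refine ⟨?_, ?_, ?_⟩
    · rcases V with _ | ⟨v, V⟩
      · simp [wbad]
      · simp [wbad]
    · unfold wgood
      refine List.Nodup.map ?_ List.nodup_range
      intro a b h
      simp at h; exact h
    · intro β hb β' hb' e
      obtain ⟨k, hk, rfl⟩ := mem_wgood hb'
      rcases mem_wbad hb with rfl | rfl | ⟨hne, rfl⟩ <;> simp at e <;> omega

/-- letters with negative sign are elements -/
theorem Rl.lett {y bad good} (h : Rl S y bad good) : ∀ l ∈ bwd y (bad ++ good), l = (y, true) ∨ (∃ lo x, CT lo x y ∧ bad = [] ∧ good = chainBl lo x ∧ l = (x, true)) ∨ (y = GenSym.b ∧ ∃ a, l.1 = GenSym.elt a) := by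
  intro l hl
  simp only [bwd, List.mem_flatten, List.mem_map] at hl
  obtain ⟨_, ⟨β, hb, rfl⟩, hl⟩ := hl
  rw [bw, List.mem_append] at hl
  rcases hl with hl | hl
  · cases h with
    | @ch lo x _ h =>
      obtain ⟨k, hk, rfl⟩ := mem_chainBl (by simpa using hb)
      right; left
      exact ⟨lo, x, h, rfl, rfl, by simpa using hl⟩
    | @w m as V hm hV =>
      right; right
      refine ⟨rfl, ?_⟩
      rcases List.mem_append.1 hb with hb | hb
      · rcases mem_wbad hb with rfl | rfl | ⟨hne, rfl⟩
        · obtain ⟨a, rfl⟩ := mem_elX hl; exact ⟨a, rfl⟩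
        · obtain ⟨a, rfl⟩ := mem_elX hl; exact ⟨a, rfl⟩
        · exact hV.mem hl
      · obtain ⟨k, hk, rfl⟩ := mem_wgood hb
        obtain ⟨a, rfl⟩ := mem_elX hl; exact ⟨a, rfl⟩
  · left; exact List.eq_of_mem_replicate hl

theorem bwd_len {A : Type} (y : A) (Bl : List (Blk A)) : (bwd y Bl).length = (Bl.map fun β => β.1.length + β.2).sum := by
  induction Bl with
  | nil => simp
  | cons β L ih => simp only [bwd_cons, List.length_append, ih, bw, List.length_replicate, List.map_cons, List.sum_cons]

theorem chain_len {A : Type} (lo : ℕ) (x y : GenSym A) : (bwd y (chainBl lo x)).length = ((List.range 1000).map fun k => 1 + (lo + k + 1) ^ 2).sum := by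
  rw [bwd_len, chainBl, List.map_map]; rfl

theorem CT.len {A : Type} {lo : ℕ} {x y : GenSym A} (h : CT lo x y) :
    15 * (2 * ((lo + 1000) ^ 2 + 1) + 1) ≤ (bwd y (chainBl lo x)).length := by
  rw [chain_len]
  rcases h.lo with rfl | rfl | rfl | rfl | rfl <;> decide +kernel

theorem wgood_len {A : Type} {n : ℕ} (m : ℕ) (as : Fin n → A) : (bwd (GenSym.b) (wgood m (elX as))).length = 98 * n + 9800 * m + 4949 := by
  rw [bwd_len, wgood, List.map_map]
  have : ∀ k, ((fun β : Blk (GenSym A) => β.1.length + β.2) ∘ fun k => (elX as, 100 * m + k + 2)) k = (n + 100 * m) + (k + 2) := by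
    intro k; simp only [Function.comp, elX_len]; ring
  rw [List.map_congr_left (fun k _ => this k), List.sum_map_add]
  have e2 : ((List.range 98).map fun k => k + 2).sum = 4949 := by decide +kernel
  rw [e2, List.map_const', List.sum_replicate, List.length_range, smul_eq_mul]
  ring

theorem Rl.sig {y bad good} (h : Rl S y bad good) {r q t} (hr : bwd y (bad ++ good) ~r r) (hq : r = q ++ t) (hl : r.length < 15 * q.length) :
    ∃ β ∈ good, ∃ z, z ≠ (y, true) ∧ [(y, true)] ++ β.1 ++ List.replicate β.2 (y, true) ++ [z] <:+: q := by
  obtain ⟨u, v, e1, e2⟩ := rot_split hr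
  have hlen : (bwd y (bad ++ good)).length = r.length := hr.perm.length_eq
  have hok := h.ok
  have hg := h.glen
  cases h with
  | @ch lo x _ h =>
    have h1 := h.len
    refine sig_exists (M := (lo + 1000) ^ 2 + 1) hok ?_ hg e1 (by rw [← e2, hq]) ?_
    · intro β hb
      obtain ⟨k, hk, rfl⟩ := mem_chainBl hb
      simp only [bw, List.length_append, List.length_singleton, List.length_replicate]
      have : (lo + k + 1) ^ 2 ≤ (lo + 1000) ^ 2 := Nat.pow_le_pow_left (by omega) 2
      omega
    · simp only [List.nil_append] at hlen
      simp only [bwd_nil, List.length_nil]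
      omega
  | @w m as V hm hV =>
    have hgl := wgood_len m as
    have hbl : (bwd (GenSym.b) (wbad m (elX as) V)).length ≤ 2 * S.arity m + 200 * m + 102 := by
      rw [bwd_len]
      have := hV.len
      rcases V with _ | ⟨v, V⟩
      · simp [wbad, elX_len]; omega
      · simp [wbad, elX_len] at this ⊢; omega
    refine sig_exists (M := S.arity m + 100 * m + 99) hok ?_ hg e1 (by rw [← e2, hq]) ?_
    · intro β hb
      obtain ⟨k, hk, rfl⟩ := mem_wgood hb
      simp only [bw, List.length_append, List.length_replicate, elX_len]
      omega
    · rw [bwd_append, List.length_append] at hlen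
      omega

theorem elX_inj {A : Type} {n : ℕ} {as as' : Fin n → A} (h : elX as = elX as') : as = as' := by
  unfold elX at h
  have := List.map_injective_iff.2 (by intro a b h; simpa using h) h
  exact List.ofFn_injective this

theorem Rl.uniq {y bad good bad' good'} (h : Rl S y bad good) (h' : Rl S y bad' good') {β} (hb : β ∈ good) (hb' : β ∈ bad' ++ good') :
    bad = bad' ∧ good = good' := by
  cases h with
  | @ch lo x _ h =>
    obtain ⟨k, hk, rfl⟩ := mem_chainBl hb
    cases h' with
    | @ch lo' x' _ h' =>
      obtain ⟨k', hk', e⟩ := mem_chainBl (by simpa using hb')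
      simp only [Prod.mk.injEq, List.cons.injEq, and_true] at e
      obtain ⟨rfl, -⟩ := e
      have : lo = lo' := by cases h <;> cases h' <;> rfl
      rw [this]; simp
    | @w m as V hm hV => cases h
  | @w m as V hm hV =>
    obtain ⟨k, hk, rfl⟩ := mem_wgood hb
    generalize hy : (GenSym.b : GenSym S.A) = y at h'
    cases h' with
    | @ch lo' x' _ h' => subst hy; cases h'
    | @w m' as' V' hm' hV' =>
      have hg' : (elX as, 100 * m + k + 2) ∈ wgood m' (elX as') := by
        rcases List.mem_append.1 hb' with hb | hb
        · rcases mem_wbad hb with e | e | ⟨hne, e⟩ <;> simp at e <;> omega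
        · exact hb
      obtain ⟨k', hk', e⟩ := mem_wgood hg'
      simp only [Prod.mk.injEq] at e
      have hmm : m = m' := by omega
      subst hmm
      have := elX_inj e.1
      subst this
      rw [hV.uniq hV']; simp

end concrete
end Part9


section Part10
open FreeGroup
section concrete2
variable {S : IndexedStructure} {p₁ p₂ : ℕ}

theorem rep_infix {α : Type*} {k n : ℕ} (a : α) (h : k ≤ n) : List.replicate k a <:+: List.replicate n a := by
  refine ⟨[], List.replicate (n - k) a, ?_⟩
  rw [List.nil_append, ← List.replicate_add]; congr 1; omega

theorem rep_split {α : Type*} {n : ℕ} {a : α} {u v : List α} (h : List.replicate n a = u ++ v) :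
    u = List.replicate u.length a ∧ v = List.replicate v.length a := by
  have := List.append_eq_replicate_iff.1 h.symm
  exact this.2

/-- `x' x'` never occurs -/
theorem no_xx {α : Type*} {x y : α} (hxy : x ≠ y) : ∀ {Bl : List (Blk α)}, (∀ β ∈ Bl, β.1 = [(x, true)] ∧ 0 < β.2) →
    List.IsChain (fun a b => ¬ (a = (x, true) ∧ b = (x, true))) (bwd y Bl) := by
  intro Bl
  induction Bl with
  | nil => intro _; simp
  | cons β L ih =>
    intro h
    have hβ := h β (by simp)
    have hL := ih (fun β hb => h β (by simp [hb]))
    rw [bwd_cons, bw, hβ.1]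
    have : ∀ k, List.IsChain (fun a b => ¬ (a = (x, true) ∧ b = (x, true))) (List.replicate k (y, true) ++ bwd y L) := by
      intro k
      induction k with
      | zero => simpa using hL
      | succ k ihk =>
        rw [List.replicate_succ, List.cons_append, List.isChain_cons]
        refine ⟨?_, ihk⟩
        rintro z _ ⟨e, _⟩
        simp at e; exact hxy e.symm
    rw [List.append_assoc, List.singleton_append, List.isChain_cons]
    refine ⟨?_, this _⟩
    obtain ⟨n, hn⟩ := Nat.exists_eq_succ_of_ne_zero hβ.2.ne'
    rw [hn, List.replicate_succ]
    rintro z hz ⟨_, e⟩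
    simp at hz; rw [← hz] at e; simp at e; exact hxy e.symm

theorem chain_noxx {A : Type} {lo : ℕ} {x y : GenSym A} (hxy : x ≠ y) {r} (hr : bwd y (chainBl lo x) ~r r)
    (h : [(x, true), (x, true)] <:+: r) : False := by
  obtain ⟨u, v, e1, e2⟩ := rot_split hr
  have h1 := no_xx hxy (Bl := chainBl lo x ++ chainBl lo x) (by
    intro β hb
    obtain ⟨k, hk, rfl⟩ := mem_chainBl (lo := lo) (x := x) (β := β) (by simpa using hb)
    exact ⟨rfl, by positivity⟩)
  have h2 : r <:+: bwd y (chainBl lo x ++ chainBl lo x) := by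
    refine ⟨u, v, ?_⟩
    rw [bwd_append, e1, e2]; simp
  have := List.IsChain.infix h1 (h.trans h2)
  simp at this

def FP {A : Type} (p₁ p₂ : ℕ) (f : GenSym A) (p : ℕ) : Prop := (f = GenSym.f1 ∧ p = p₁) ∨ (f = GenSym.f2 ∧ p = p₂)

variable (S p₁ p₂)
def Rpos : Set (List (GenSym S.A × Bool)) :=
  {r | (∃ y bad good, Rl S y bad good ∧ bwd y (bad ++ good) ~r r) ∨ ∃ f p, FP p₁ p₂ f p ∧ r = List.replicate p (f, true)}

def RR : Set (List (GenSym S.A × Bool)) := Rpos S p₁ p₂ ∪ {r | FreeGroup.invRev r ∈ Rpos S p₁ p₂}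

def SigS (N : ℕ) : Set (List (GenSym S.A × Bool)) :=
  {σ | (∃ f, (f = GenSym.f1 ∨ f = GenSym.f2) ∧ σ = List.replicate N (f, true)) ∨
    ∃ y bad good, Rl S y bad good ∧ ∃ β ∈ good, ∃ z, z ≠ (y, true) ∧ σ = [(y, true)] ++ β.1 ++ List.replicate β.2 (y, true) ++ [z]}
variable {S p₁ p₂}

theorem Rl.y_ne_elt {y bad good} (h : Rl S y bad good) (a : S.A) : y ≠ GenSym.elt a := by
  cases h with
  | ch h => cases h <;> simp
  | w => simp

theorem Rpos.neg {r} (hr : r ∈ Rpos S p₁ p₂) {l : GenSym S.A} (hl : (l, false) ∈ r) : ∃ a, l = GenSym.elt a := by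
  rcases hr with ⟨y, bad, good, h, hr⟩ | ⟨f, p, _, rfl⟩
  · rcases h.lett _ (hr.mem_iff.2 hl) with h | ⟨_, _, _, _, _, h⟩ | ⟨_, a, h⟩
    · simp at h
    · simp at h
    · exact ⟨a, h⟩
  · have := List.eq_of_mem_replicate hl
    simp at this

theorem chainBl_inj {A : Type} {lo lo' : ℕ} {x x' : GenSym A} (h : chainBl lo x = chainBl lo' x') : x = x' := by
  have h1 : ([(x, true)], (lo + 0 + 1) ^ 2) ∈ chainBl lo x := List.mem_map.2 ⟨0, by simp, rfl⟩
  rw [h] at h1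
  obtain ⟨k, _, e⟩ := mem_chainBl h1
  simp at e
  exact e.1

theorem Rl.bad_y {y bad good y' bad' good'} (h : Rl S y bad good) (h' : Rl S y' bad' good') {β} (hb : β ∈ good) {z} {t}
    (hr : bwd y' (bad' ++ good') ~r ([(y, true)] ++ β.1 ++ List.replicate β.2 (y, true) ++ [z]) ++ t) : y' = y := by
  by_contra hyy
  have hβ := h.ok β (by simp [hb])
  have hmem : ∀ l ∈ ([(y, true)] ++ β.1 ++ List.replicate β.2 (y, true) ++ [z]) ++ t, l ∈ bwd y' (bad' ++ good') := fun l hl => hr.mem_iff.2 hl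
  obtain ⟨w, hw⟩ := List.exists_mem_of_ne_nil _ hβ.ne
  have h1 := h'.lett _ (hmem (y, true) (by simp))
  have h2 := h'.lett _ (hmem w (by simp [hw]))
  rcases h1 with h1 | ⟨lo, x, hct, hbad, hgood, h1⟩ | ⟨_, a, h1⟩
  · simp at h1; exact hyy h1.symm
  · simp only [Prod.mk.injEq, and_true] at h1
    subst h1
    have hw1 : w = (y', true) := by
      rcases h2 with h2 | ⟨lo', x', hct', hbad', hgood', h2⟩ | ⟨h2, _⟩
      · exact h2
      · exfalso
        have : x' = y := by
          rw [hgood] at hgood'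
          exact (chainBl_inj hgood').symm
        exact hβ.nm w hw (by rw [h2, this])
      · subst h2; cases hct
    have he : 2 ≤ β.2 := by
      cases h with
      | @ch lo0 x0 _ h0 =>
        obtain ⟨k, hk, rfl⟩ := mem_chainBl hb
        simp at hw; subst hw
        simp at hw1; subst hw1
        have : lo0 = 4000 := by cases hct <;> cases h0 <;> rfl
        subst this
        simp only; nlinarith
      | @w m as V hm hV =>
        obtain ⟨k, hk, rfl⟩ := mem_wgood hb
        simp
    rw [hbad, hgood, List.nil_append] at hr
    refine chain_noxx hct.ne hr ?_
    have e1 : [(y, true), (y, true)] <:+: List.replicate β.2 (y, true) := rep_infix (k := 2) _ he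
    refine e1.trans ⟨[(y, true)] ++ β.1, [z] ++ t, by simp⟩
  · exact h.y_ne_elt a h1

theorem symRR (h1 : 10 ^ 10 < p₁) (h2 : 10 ^ 10 < p₂) : SymR (RR S p₁ p₂) := by
  obtain ⟨N, hN⟩ : ∃ N : ℕ, N = 5 * 10 ^ 7 + 3 := ⟨_, rfl⟩
  have hFP : ∀ (f : GenSym S.A) p, FP p₁ p₂ f p → 10 ^ 10 < p ∧ (f = GenSym.f1 ∨ f = GenSym.f2) := by
    rintro f p (⟨rfl, rfl⟩ | ⟨rfl, rfl⟩)
    · exact ⟨h1, Or.inl rfl⟩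
    · exact ⟨h2, Or.inr rfl⟩
  have hFPu : ∀ (f : GenSym S.A) p p', FP p₁ p₂ f p → FP p₁ p₂ f p' → p = p' := by
    rintro f p p' (⟨rfl, rfl⟩ | ⟨rfl, rfl⟩) (⟨h, rfl⟩ | ⟨h, rfl⟩) <;> first | rfl | cases h
  refine symR_of_sig (Rpos S p₁ p₂) (SigS S N) ?_ ?_ ?_ ?_ ?_ ?_
  · rintro r (⟨y, bad, good, h, hr⟩ | ⟨f, p, hf, rfl⟩) e
    · subst e
      have := hr.perm.length_eq
      have hg := h.glen
      have hok := h.ok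
      rcases good with _ | ⟨β, good⟩
      · simp at hg
      · have := (hok β (by simp)).pos
        simp [bw] at *; omega
    · have := (hFP f p hf).1
      simp at e; omega
  · rintro r (⟨y, bad, good, h, hr⟩ | ⟨f, p, hf, rfl⟩)
    · obtain ⟨u, v, e1, rfl⟩ := rot_split hr
      exact rot_red h.ok e1
    · unfold FreeGroup.IsReduced
      exact List.isChain_replicate_of_rel _ (by simp)
  · rintro u v (⟨y, bad, good, h, hr⟩ | ⟨f, p, hf, e⟩)
    · exact Or.inl ⟨y, bad, good, h, hr.trans (rot_app u v)⟩
    · right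
      refine ⟨f, p, hf, ?_⟩
      obtain ⟨e1, e2⟩ := rep_split e.symm
      have := congrArg List.length e
      simp at this
      rw [e1, e2, ← List.replicate_add]; congr 1; omega
  · rintro q t (⟨y, bad, good, h, hr⟩ | ⟨f, p, hf, e⟩) hl
    · obtain ⟨β, hb, z, hz, hi⟩ := h.sig hr rfl hl
      exact ⟨_, Or.inr ⟨y, bad, good, h, β, hb, z, hz, rfl⟩, hi⟩
    · refine ⟨_, Or.inl ⟨f, (hFP f p hf).2, rfl⟩, ?_⟩
      have := (rep_split e.symm).1
      rw [this]
      refine rep_infix _ ?_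
      have h3 := (hFP f p hf).1
      have := congrArg List.length e
      rw [List.length_replicate] at this
      omega
  · rintro σ (⟨f, hf, rfl⟩ | ⟨y, bad, good, h, β, hb, z, hz, rfl⟩) t1 t2 ht1 ht2
    · have key : ∀ t, List.replicate N (f, true) ++ t ∈ Rpos S p₁ p₂ → ∃ p, FP p₁ p₂ f p ∧ List.replicate N (f, true) ++ t = List.replicate p (f, true) := by
        rintro t (⟨y, bad, good, h, hr⟩ | ⟨f', p, hf', e⟩)
        · exfalso
          cases h with
          | @ch lo x y hct =>
            obtain ⟨u, v, e1, e2⟩ := rot_split hr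
            have hlo : lo ≤ 4000 := by rcases hct.lo with h | h | h | h | h <;> omega
            obtain ⟨β, hb, z, hz, hi⟩ := sig_exists (M := (lo + 1000) ^ 2 + 1) (bad := []) (good := chainBl lo x) (y := y) (by simpa using chain_ok hct.ne) (by
              intro β hb
              obtain ⟨k, hk, rfl⟩ := mem_chainBl hb
              simp only [bw, List.length_append, List.length_singleton, List.length_replicate]
              have : (lo + k + 1) ^ 2 ≤ (lo + 1000) ^ 2 := Nat.pow_le_pow_left (by omega) 2
              omega) (by simp [chainBl]) e1 e2.symm (by
                simp only [bwd_nil, List.length_nil, List.length_replicate]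
                have : (lo + 1000) ^ 2 ≤ 5000 ^ 2 := Nat.pow_le_pow_left (by omega) 2
                rw [hN]; omega)
            have g1 := List.eq_of_mem_replicate (hi.subset (show z ∈ _ by simp))
            have g2 := List.eq_of_mem_replicate (hi.subset (show (y, true) ∈ _ by simp))
            exact hz (g1.trans g2.symm)
          | @w m as V hm hV =>
            have := (Rl.w hm hV).lett (f, true) (hr.mem_iff.2 (by
              refine List.mem_append_left _ (List.mem_replicate.2 ⟨by omega, rfl⟩)))
            rcases this with h | ⟨_, x, h, _⟩ | ⟨_, a, h⟩
            · rcases hf with rfl | rfl <;> simp at h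
            · cases h
            · rcases hf with rfl | rfl <;> simp at h
        · have : (f, true) ∈ List.replicate p (f', true) := by
            rw [← e]; exact List.mem_append_left _ (List.mem_replicate.2 ⟨by omega, rfl⟩)
          have := List.eq_of_mem_replicate this
          simp at this; subst this
          exact ⟨p, hf', e⟩
      obtain ⟨p, g1, g2⟩ := key t1 ht1
      obtain ⟨p', g1', g2'⟩ := key t2 ht2
      rw [hFPu _ _ _ g1' g1, ← g2] at g2'
      exact (List.append_cancel_left g2').symm
    · have hβ := h.ok β (by simp [hb])
      have key : ∀ t, ([(y, true)] ++ β.1 ++ List.replicate β.2 (y, true) ++ [z]) ++ t ∈ Rpos S p₁ p₂ →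
          ∃ L1 L2, bad ++ good = L1 ++ β :: L2 ∧ β.1 ++ List.replicate β.2 (y, true) ++ [z] ++ t ++ [(y, true)] = bwd y (β :: (L2 ++ L1)) := by
        rintro t (⟨y', bad', good', h', hr⟩ | ⟨f', p, hf', e⟩)
        · obtain rfl := h.bad_y h' hb hr
          obtain ⟨u, v, e1, e2⟩ := rot_split hr
          obtain ⟨L1, L2, g1, g2⟩ := sig_align h'.ok e1 hβ.nm hβ.ne hβ.pos hz e2.symm
          obtain ⟨rfl, rfl⟩ := h.uniq h' hb (by rw [g1]; simp)
          exact ⟨L1, L2, g1, g2⟩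
        · exfalso
          obtain ⟨w, hw⟩ := List.exists_mem_of_ne_nil _ hβ.ne
          have g1 : w ∈ List.replicate p (f', true) := by rw [← e]; simp [hw]
          have g2 : (y, true) ∈ List.replicate p (f', true) := by rw [← e]; simp
          exact hβ.nm w hw (by rw [List.eq_of_mem_replicate g1, ← List.eq_of_mem_replicate g2])
      obtain ⟨L1, L2, g1, g2⟩ := key t1 ht1
      obtain ⟨L1', L2', g1', g2'⟩ := key t2 ht2
      obtain ⟨rfl, rfl⟩ := nodup_split (by rw [← g1]; exact h.nodup) (g1.symm.trans g1')
      rw [← g2] at g2'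
      have g3 := List.append_cancel_right g2'
      exact (List.append_cancel_left g3).symm
  · rintro σ hσ t ht
    have : ∃ l, (∀ a, l ≠ GenSym.elt a) ∧ (l, true) ∈ σ := by
      rcases hσ with ⟨f, hf, rfl⟩ | ⟨y, bad, good, h, β, hb, z, hz, rfl⟩
      · refine ⟨f, ?_, List.mem_replicate.2 ⟨by omega, rfl⟩⟩
        rcases hf with rfl | rfl <;> simp
      · exact ⟨y, h.y_ne_elt, by simp⟩
    obtain ⟨l, hl, hm⟩ := this
    obtain ⟨a, ha⟩ := Rpos.neg ht (l := l) (by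
      unfold FreeGroup.invRev
      rw [List.mem_reverse, List.mem_map]
      exact ⟨(l, true), by simp [hm], rfl⟩)
    exact hl a ha

/-! primitivity -/
def Prim {α : Type*} (r : List α) : Prop := ∀ u v, r = u ++ v → r = v ++ u → u = [] ∨ v = []

theorem bwd_prim {α : Type*} {y : α} {Bl : List (Blk α)} (hok : ∀ β ∈ Bl, OKB y β) (hnd : Bl.Nodup) {r} (hr : bwd y Bl ~r r) : Prim r := by
  have base : Prim (bwd y Bl) := by
    intro u v h1 h2
    by_contra hc
    push Not at hc
    obtain ⟨hu, hv⟩ := hc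
    obtain ⟨z, v', hv'⟩ := List.exists_cons_of_ne_nil hv
    have hz : z ≠ (y, true) := by
      have := bwd_head hok
      rw [h2, hv'] at this
      simpa using this
    obtain ⟨L1, β, L2, t1, t2, e1, e2, e3, e4, e5⟩ := bsplit y Bl v u h2 hu
    have huy : ∃ u', u = u' ++ [(y, true)] := by
      rcases List.eq_nil_or_concat L2 with rfl | ⟨L2', b, rfl⟩
      · obtain ⟨t, ht⟩ := bw_suffix (hok β (by rw [e1]; simp)) e2 e3
        exact ⟨t, by rw [e5, ht]; simp⟩
      · have hb := hok b (by rw [e1]; simp)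
        obtain ⟨t, ht⟩ := bw_suffix (t1 := []) (t2 := bw y b) hb rfl (by
          have := hb.ne
          simp [bw, this])
        exact ⟨t2 ++ bwd y L2' ++ t, by rw [e5]; simp [ht]⟩
    obtain ⟨M1, M2, g1, g2, g3⟩ := align hok h1 hv' hz (Or.inr huy)
    have hM1 : ∀ β ∈ M2 ++ M1, OKB y β := by
      intro β hb; apply hok; rw [g1]; simp at hb ⊢; tauto
    have := bwd_inj hok hM1 (by rw [bwd_append, ← g2, ← g3, h2])
    rw [g1] at this hnd
    rcases M1 with _ | ⟨a, M1⟩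
    · exact hu (by simpa using g2)
    · rcases M2 with _ | ⟨b, M2⟩
      · exact hv (by simpa using g3)
      · simp only [List.cons_append, List.cons.injEq] at this
        rw [this.1] at hnd
        simp at hnd
  intro u v h1 h2
  obtain ⟨n, hn⟩ := hr.symm
  have e : r.rotate u.length = r := by
    conv_lhs => rw [h1]
    rw [List.rotate_append_length_eq, h2]
  have e' : (bwd y Bl).rotate u.length = bwd y Bl := by
    rw [← hn, List.rotate_rotate, add_comm, ← List.rotate_rotate, e]
  have hlen : (bwd y Bl).length = u.length + v.length := by
    rw [hr.perm.length_eq, h1]; simp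
  rw [List.rotate_eq_drop_append_take (by omega)] at e'
  rcases base _ _ (List.take_append_drop u.length (bwd y Bl)).symm e'.symm with h | h
  · left
    have := congrArg List.length h
    rw [List.length_take, List.length_nil] at this
    exact List.length_eq_zero_iff.1 (by omega)
  · right
    have := congrArg List.length h
    rw [List.length_drop, List.length_nil] at this
    exact List.length_eq_zero_iff.1 (by omega)

theorem Prim.inv {α : Type*} {r : List (α × Bool)} (h : Prim (FreeGroup.invRev r)) : Prim r := by
  intro u v h1 h2
  rcases h (FreeGroup.invRev u) (FreeGroup.invRev v) (by rw [← FreeGroup.invRev_append, ← h2]) (by rw [← FreeGroup.invRev_append, ← h1]) with h | h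
  · left; have := congrArg List.length h; rw [FreeGroup.invRev_length] at this; exact List.length_eq_zero_iff.1 this
  · right; have := congrArg List.length h; rw [FreeGroup.invRev_length] at this; exact List.length_eq_zero_iff.1 this

end concrete2
end Part10


section Part11
open FreeGroup
section concrete3
variable {S : IndexedStructure} {p₁ p₂ : ℕ}

theorem mk_rep {α : Type*} (n : ℕ) (y : α) : FreeGroup.mk (List.replicate n (y, true)) = FreeGroup.of y ^ n := by
  induction n with
  | zero => rfl
  | succ n ih => rw [List.replicate_succ, mk_cons, ih, pow_succ']; rfl

theorem mk_bwd {α : Type*} (y : α) (Bl : List (Blk α)) :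
    FreeGroup.mk (bwd y Bl) = (Bl.map fun β => FreeGroup.mk β.1 * FreeGroup.of y ^ β.2).prod := by
  induction Bl with
  | nil => rfl
  | cons β L ih => rw [bwd_cons, mk_append, ih, bw, mk_append, mk_rep, List.map_cons, List.prod_cons]

theorem mk_chain {A : Type} (lo : ℕ) (x y : GenSym A) :
    FreeGroup.mk (bwd y (chainBl lo x)) = chainProd lo (FreeGroup.of x) (FreeGroup.of y) := by
  rw [mk_bwd, chainBl, List.map_map, chainProd]; rfl

theorem mk_elX {A : Type} {n : ℕ} (as : Fin n → A) : FreeGroup.mk (elX as) = (List.ofFn fun i => FreeGroup.of (GenSym.elt (as i))).prod := by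
  have : (List.ofFn fun i => FreeGroup.of (GenSym.elt (as i))) = (List.ofFn as).map fun a => FreeGroup.of (GenSym.elt a) := by
    rw [List.map_ofFn]; rfl
  rw [this, elX]
  induction (List.ofFn as) with
  | nil => rfl
  | cons a l ih => rw [List.map_cons, mk_cons, ih, List.map_cons, List.prod_cons]; rfl

theorem mk_w {A : Type} {n m : ℕ} (as : Fin n → A) :
    wProd m (fun i => FreeGroup.of (GenSym.elt (as i))) (FreeGroup.of GenSym.b) =
      FreeGroup.mk (elX as) * FreeGroup.of GenSym.b ^ (100 * m + 1) * FreeGroup.mk (bwd GenSym.b (wgood m (elX as))) *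
      FreeGroup.mk (elX as) * FreeGroup.of GenSym.b ^ (100 * m + 100) := by
  rw [wProd, ← mk_elX, mk_bwd, wgood, List.map_map]
  have e : List.range 100 = 0 :: ((List.range 98).map (fun k => k + 1) ++ [99]) := by decide +kernel
  rw [e, List.map_cons, List.map_append, List.map_map, List.prod_cons, List.prod_append]
  simp only [List.map_cons, List.map_nil, List.prod_cons, List.prod_nil, mul_one, mul_assoc, Function.comp_def, add_assoc, add_zero]

theorem mk_wbad {A : Type} (m : ℕ) (X V : List (GenSym A × Bool)) : FreeGroup.mk (bwd GenSym.b (wbad m X V)) =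
    FreeGroup.mk X * FreeGroup.of GenSym.b ^ (100 * m + 100) * FreeGroup.mk V * FreeGroup.of GenSym.b ^ (100 * m + 1) := by
  rw [mk_bwd]
  rcases V with _ | ⟨v, V⟩
  · simp only [wbad, List.map_cons, List.map_nil, List.prod_cons, List.prod_nil, mul_one]
    rw [← FreeGroup.one_eq_mk, mul_one, mul_assoc, ← pow_add]
    congr 2; omega
  · simp [wbad, mul_assoc]

theorem mk_rot {α : Type*} {N : Subgroup (FreeGroup α)} (hN : N.Normal) {r r' : List (α × Bool)} (h : r ~r r') :
    FreeGroup.mk r ∈ N ↔ FreeGroup.mk r' ∈ N := by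
  obtain ⟨u, v, rfl, rfl⟩ := rot_split h
  rw [mk_append, mk_append]; exact hN.mem_comm_iff

theorem WV.mkV {m : ℕ} {as : Fin (S.arity m) → S.A} {V} (h : WV S m as V) :
    (¬ S.isFunc m → FreeGroup.mk V = FreeGroup.mk (elX as)) ∧ (S.isFunc m → FreeGroup.mk V = (FreeGroup.of (GenSym.elt (S.funcInterp m as)))⁻¹ * FreeGroup.mk (elX as)) := by
  rcases h with ⟨h0, _, rfl⟩ | ⟨h0, h | ⟨rfl, h⟩⟩
  · exact ⟨fun _ => rfl, fun h => absurd h h0⟩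
  · refine ⟨fun h' => absurd h0 h', fun _ => ?_⟩
    rw [h, mk_cons _ V]
    change _ = _ * (FreeGroup.of _ * _)
    rw [inv_mul_cancel_left]
  · refine ⟨fun h' => absurd h0 h', fun _ => ?_⟩
    rw [mk_cons]; rfl

theorem WV.exists {m : ℕ} (as : Fin (S.arity m) → S.A) (h : S.isFunc m ∨ S.relInterp m as) : ∃ V, WV S m as V := by
  by_cases hf : S.isFunc m
  · by_cases hh : (elX as).head? = some (GenSym.elt (S.funcInterp m as), true)
    · rcases hX : elX as with _ | ⟨x, V⟩
      · rw [hX] at hh; simp at hh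
      · rw [hX] at hh; simp at hh
        exact ⟨V, Or.inr ⟨hf, Or.inl (by rw [hX, hh])⟩⟩
    · exact ⟨_, Or.inr ⟨hf, Or.inr ⟨rfl, hh⟩⟩⟩
  · exact ⟨_, Or.inl ⟨hf, by tauto, rfl⟩⟩

theorem w_mem {N : Subgroup (FreeGroup (GenSym S.A))} (hN : N.Normal) {m : ℕ} {as : Fin (S.arity m) → S.A} {V} (h : WV S m as V) :
    (¬ S.isFunc m → (FreeGroup.mk (bwd GenSym.b (wbad m (elX as) V ++ wgood m (elX as))) ∈ N ↔
      wProd m (fun i => FreeGroup.of (GenSym.elt (as i))) (FreeGroup.of GenSym.b) ∈ N)) ∧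
    (S.isFunc m → (FreeGroup.mk (bwd GenSym.b (wbad m (elX as) V ++ wgood m (elX as))) ∈ N ↔
      wProd m (fun i => FreeGroup.of (GenSym.elt (as i))) (FreeGroup.of GenSym.b) * (FreeGroup.of (GenSym.elt (S.funcInterp m as)))⁻¹ ∈ N)) := by
  rw [bwd_append, mk_append, mk_wbad, mk_w]
  constructor
  · intro hf
    rw [h.mkV.1 hf]
    rw [show ∀ a b c d e : FreeGroup (GenSym S.A), a * b * c * d * e = (a * b) * (c * d * e) by intros; group, hN.mem_comm_iff]
    simp only [mul_assoc]
  · intro hf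
    rw [h.mkV.2 hf]
    rw [show ∀ a b c d e f : FreeGroup (GenSym S.A), a * b * (c * d) * e * f = (a * b * c) * (d * e * f) by intros; group, hN.mem_comm_iff]
    simp only [mul_assoc]

theorem RR_mem (N : Subgroup (FreeGroup (GenSym S.A))) (hN : N.Normal) :
    (∀ r ∈ RR S p₁ p₂, FreeGroup.mk r ∈ N) ↔ grpRels S p₁ p₂ ⊆ N := by
  have e1 : (∀ r ∈ RR S p₁ p₂, FreeGroup.mk r ∈ N) ↔ (∀ r ∈ Rpos S p₁ p₂, FreeGroup.mk r ∈ N) := by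
    constructor
    · intro h r hr; exact h r (Or.inl hr)
    · rintro h r (hr | hr)
      · exact h r hr
      · have := h _ hr
        rw [← FreeGroup.inv_mk] at this
        exact (N.inv_mem_iff).1 this
  rw [e1]
  constructor
  · intro h
    have hc : ∀ {lo} {x y : GenSym S.A}, CT lo x y → chainProd lo (FreeGroup.of x) (FreeGroup.of y) ∈ N := by
      intro lo x y hct
      rw [← mk_chain]
      refine h _ (Or.inl ⟨y, [], chainBl lo x, Rl.ch hct, ?_⟩)
      rw [List.nil_append]
    rintro g (((hg | ⟨a, e⟩) | ⟨m, hm, hf, as, e⟩) | ⟨m, hm, hf, as, hrel, e⟩)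
    · simp only [Set.mem_insert_iff, Set.mem_singleton_iff] at hg
      rcases hg with e | e | e | e | e | e | e | e | e | e <;> rw [e]
      · rw [← mk_rep]; exact h _ (Or.inr ⟨_, _, Or.inl ⟨rfl, rfl⟩, rfl⟩)
      · rw [← mk_rep]; exact h _ (Or.inr ⟨_, _, Or.inr ⟨rfl, rfl⟩, rfl⟩)
      · exact hc .v12
      · exact hc .v21
      · exact hc .b1
      · exact hc .b2
      · exact hc .c1
      · exact hc .c2
      · exact hc .d1
      · exact hc .d2
    · rcases e with e | e <;> rw [e]
      · exact hc (.ac a)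
      · exact hc (.ad a)
    · rw [e]
      obtain ⟨V, hV⟩ := WV.exists as (Or.inl hf)
      exact ((w_mem hN hV).2 hf).1 (h _ (Or.inl ⟨_, _, _, Rl.w hm hV, List.IsRotated.refl _⟩))
    · rw [e]
      obtain ⟨V, hV⟩ := WV.exists as (Or.inr hrel)
      exact ((w_mem hN hV).1 hf).1 (h _ (Or.inl ⟨_, _, _, Rl.w hm hV, List.IsRotated.refl _⟩))
  · rintro h r (⟨y, bad, good, hR, hr⟩ | ⟨f, p, hf, rfl⟩)
    · rw [← mk_rot hN hr]
      cases hR with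
      | @ch lo x _ hct =>
        rw [List.nil_append, mk_chain]
        apply h
        refine Or.inl (Or.inl ?_)
        cases hct
        case ac a => exact Or.inr ⟨a, Or.inl rfl⟩
        case ad a => exact Or.inr ⟨a, Or.inr rfl⟩
        all_goals (left; simp only [Set.mem_insert_iff, Set.mem_singleton_iff, true_or, or_true])
      | @w m as V hm hV =>
        by_cases hf : S.isFunc m
        · rw [(w_mem hN hV).2 hf]
          exact h (Or.inl (Or.inr ⟨m, hm, hf, as, rfl⟩))
        · rw [(w_mem hN hV).1 hf]
          have hrel : S.relInterp m as := by
            rcases hV with ⟨_, h, _⟩ | ⟨h, _⟩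
            · exact h
            · exact absurd h hf
          exact h (Or.inr ⟨m, hm, hf, as, hrel, rfl⟩)
    · rw [mk_rep]
      apply h
      refine Or.inl (Or.inl (Or.inl ?_))
      rcases hf with ⟨rfl, rfl⟩ | ⟨rfl, rfl⟩
      · simp only [Set.mem_insert_iff, true_or]
      · simp only [Set.mem_insert_iff, true_or, or_true]

/-- image of a word in the group -/
def ev (S : IndexedStructure) (p₁ p₂ : ℕ) (w : List (GenSym S.A × Bool)) : GA S p₁ p₂ := PresentedGroup.mk (grpRels S p₁ p₂) (FreeGroup.mk w)

theorem ev_app (u v : List (GenSym S.A × Bool)) : ev S p₁ p₂ (u ++ v) = ev S p₁ p₂ u * ev S p₁ p₂ v := by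
  unfold ev; rw [mk_append, _root_.map_mul]

theorem ev_nil : ev S p₁ p₂ [] = 1 := by
  unfold ev; rw [← FreeGroup.one_eq_mk, _root_.map_one]

theorem ev_inv (u : List (GenSym S.A × Bool)) : ev S p₁ p₂ (FreeGroup.invRev u) = (ev S p₁ p₂ u)⁻¹ := by
  unfold ev; rw [← FreeGroup.inv_mk, _root_.map_inv]

theorem ev_surj (g : GA S p₁ p₂) : ∃ w, ev S p₁ p₂ w = g := by
  classical
  obtain ⟨w, rfl⟩ := PresentedGroup.mk_surjective _ g
  exact ⟨w.toWord, by unfold ev; rw [FreeGroup.mk_toWord]⟩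

theorem ev_R {r} (hr : r ∈ RR S p₁ p₂) : ev S p₁ p₂ r = 1 := by
  unfold ev
  rw [PresentedGroup.mk_eq_one_iff]
  exact (RR_mem (p₁ := p₁) (p₂ := p₂) _ inferInstance).2 Subgroup.subset_normalClosure r hr

theorem ev_green (h1 : 10 ^ 10 < p₁) (h2 : 10 ^ 10 < p₂) {w : List (GenSym S.A × Bool)} (hw : FreeGroup.IsReduced w) (hne : w ≠ [])
    (he : ev S p₁ p₂ w = 1) : ∃ u v, u ++ v ∈ RR S p₁ p₂ ∧ u <:+: w ∧ 5 * v.length ≤ (u ++ v).length := by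
  unfold ev at he
  rw [PresentedGroup.mk_eq_one_iff] at he
  refine green (symRR h1 h2) _ w rfl hw hne ?_
  have hN : (Subgroup.normalClosure (FreeGroup.mk '' RR S p₁ p₂)).Normal := inferInstance
  have := (RR_mem (p₁ := p₁) (p₂ := p₂) _ hN).1 (fun r hr => Subgroup.subset_normalClosure ⟨r, hr, rfl⟩)
  exact Subgroup.normalClosure_le_normal this he

theorem ev_gen (g : GenSym S.A) : ev S p₁ p₂ [(g, true)] = gen S p₁ p₂ g := rfl

end concrete3
end Part11


section Part12
open FreeGroup
section api
variable {S : IndexedStructure} {p₁ p₂ : ℕ}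

theorem invRev_rot {α : Type*} {r r' : List (α × Bool)} (h : r ~r r') : FreeGroup.invRev r ~r FreeGroup.invRev r' := by
  obtain ⟨u, v, rfl, rfl⟩ := rot_split h
  rw [FreeGroup.invRev_append, FreeGroup.invRev_append]; exact rot_app _ _

theorem mem_invRev {α : Type*} {r : List (α × Bool)} {l : α} {s : Bool} : (l, s) ∈ FreeGroup.invRev r ↔ (l, !s) ∈ r := by
  unfold FreeGroup.invRev
  rw [List.mem_reverse, List.mem_map]
  constructor
  · rintro ⟨⟨a, b⟩, h, e⟩
    simp at e
    obtain ⟨rfl, rfl⟩ := e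
    simpa using h
  · intro h
    exact ⟨_, h, by simp⟩

theorem invRev_rep {α : Type*} (n : ℕ) (f : α) (s : Bool) : FreeGroup.invRev (List.replicate n (f, s)) = List.replicate n (f, !s) := by
  unfold FreeGroup.invRev
  rw [List.map_replicate, List.reverse_replicate]

def IsCh {A : Type} (r : List (GenSym A × Bool)) : Prop :=
  ∃ lo x y, CT lo x y ∧ (bwd y (chainBl lo x) ~r r ∨ bwd y (chainBl lo x) ~r FreeGroup.invRev r)

theorem IsCh.rot {A : Type} {r r' : List (GenSym A × Bool)} (h : IsCh r) (hr : r ~r r') : IsCh r' := by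
  obtain ⟨lo, x, y, hct, h | h⟩ := h
  · exact ⟨lo, x, y, hct, Or.inl (h.trans hr)⟩
  · exact ⟨lo, x, y, hct, Or.inr (h.trans (invRev_rot hr))⟩

theorem IsCh.inv {A : Type} {r : List (GenSym A × Bool)} (h : IsCh r) : IsCh (FreeGroup.invRev r) := by
  obtain ⟨lo, x, y, hct, h | h⟩ := h
  · exact ⟨lo, x, y, hct, Or.inr (by rwa [FreeGroup.invRev_invRev])⟩
  · exact ⟨lo, x, y, hct, Or.inl h⟩

theorem IsCh.prim {A : Type} {r : List (GenSym A × Bool)} (h : IsCh r) : Prim r := by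
  obtain ⟨lo, x, y, hct, h | h⟩ := h
  · exact bwd_prim (chain_ok hct.ne) (chain_nodup lo x) h
  · exact (bwd_prim (chain_ok hct.ne) (chain_nodup lo x) h).inv

theorem IsCh.len {A : Type} {r : List (GenSym A × Bool)} (h : IsCh r) : 10 ^ 7 ≤ r.length := by
  obtain ⟨lo, x, y, hct, h⟩ := h
  have h1 := hct.len
  have h2 : (bwd y (chainBl lo x)).length = r.length := by
    rcases h with h | h
    · exact h.perm.length_eq
    · rw [h.perm.length_eq, FreeGroup.invRev_length]
  have : 1000 ^ 2 ≤ (lo + 1000) ^ 2 := Nat.pow_le_pow_left (by omega) 2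
  omega

theorem chain_mem {A : Type} {lo : ℕ} {x y : GenSym A} {l} (hl : l ∈ bwd y (chainBl lo x)) : l = (x, true) ∨ l = (y, true) := by
  simp only [bwd, List.mem_flatten, List.mem_map] at hl
  obtain ⟨_, ⟨β, hb, rfl⟩, hl⟩ := hl
  obtain ⟨k, hk, rfl⟩ := mem_chainBl hb
  rw [bw, List.mem_append] at hl
  rcases hl with hl | hl
  · left; simpa using hl
  · right; exact List.eq_of_mem_replicate hl

theorem IsCh.sgn {A : Type} {r : List (GenSym A × Bool)} (h : IsCh r) : ∃ s, ∀ l ∈ r, l.2 = s := by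
  obtain ⟨lo, x, y, hct, h | h⟩ := h
  · refine ⟨true, fun l hl => ?_⟩
    rcases chain_mem (h.mem_iff.2 hl) with rfl | rfl <;> rfl
  · refine ⟨false, fun l hl => ?_⟩
    have : (l.1, !l.2) ∈ FreeGroup.invRev r := mem_invRev.2 (by simpa using hl)
    rcases chain_mem (h.mem_iff.2 this) with e | e <;> simp at e <;> exact e.2

theorem RR_f {f : GenSym S.A} {p : ℕ} (hf : FP p₁ p₂ f p) {r} (hr : r ∈ RR S p₁ p₂) {s : Bool} (hs : (f, s) ∈ r) :
    r = List.replicate p (f, s) ∨ IsCh r := by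
  have key : ∀ r ∈ Rpos S p₁ p₂, ∀ s, (f, s) ∈ r → r = List.replicate p (f, s) ∨ IsCh r := by
    rintro r (⟨y, bad, good, h, hr⟩ | ⟨f', p', hf', rfl⟩) s hs
    · right
      have := h.lett _ (hr.mem_iff.2 hs)
      cases h with
      | @ch lo x y hct =>
        rw [List.nil_append] at hr
        exact ⟨lo, x, y, hct, Or.inl hr⟩
      | w =>
        exfalso
        rcases this with h | ⟨_, x, h, _⟩ | ⟨_, a, h⟩
        · rcases hf with ⟨rfl, _⟩ | ⟨rfl, _⟩ <;> simp at h
        · cases h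
        · rcases hf with ⟨rfl, _⟩ | ⟨rfl, _⟩ <;> simp at h
    · left
      have := List.eq_of_mem_replicate hs
      simp at this
      obtain ⟨rfl, rfl⟩ := this
      rcases hf with ⟨rfl, rfl⟩ | ⟨rfl, rfl⟩ <;> rcases hf' with ⟨h, rfl⟩ | ⟨h, rfl⟩ <;> first | rfl | cases h
  rcases hr with hr | hr
  · exact key r hr s hs
  · rcases key _ hr (!s) (mem_invRev.2 (by simpa using hs)) with h | h
    · left
      rw [← FreeGroup.invRev_invRev (L₁ := r), h, invRev_rep]; simp
    · right
      rw [← FreeGroup.invRev_invRev (L₁ := r)]; exact h.inv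

/-- self-overlaps of chain relators are short -/
theorem selfp {R : Set (List (GenSym S.A × Bool))} (hR : SymR R) {r} (hr : r ∈ R) (hc : IsCh r) {X D t B : List (GenSym S.A × Bool)}
    (hD : D ≠ []) (h1 : r = X ++ (D ++ (t ++ B))) (h2 : ∃ B', r = X ++ (t ++ B')) : 15 * t.length ≤ r.length := by
  by_contra hlt
  push Not at hlt
  obtain ⟨B', h2⟩ := h2
  have e1 : t ++ (B ++ (X ++ D)) ∈ R := by
    have := hR.rot (X ++ D) (t ++ B) (by rw [h1] at hr; simpa using hr)
    simpa using this
  have e2 : t ++ (B' ++ X) ∈ R := by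
    have := hR.rot X (t ++ B') (by rw [h2] at hr; simpa using hr)
    simpa using this
  have hlen1 : r.length = (t ++ (B ++ (X ++ D))).length := by rw [h1]; simp; omega
  have h3 := hR.piece t _ _ e1 e2 (by rw [← hlen1]; exact hlt)
  have h4 : t ++ B' = D ++ (t ++ B) := List.append_cancel_left (h2.symm.trans h1)
  -- D ++ Z = Z ++ D with Z = t ++ B ++ X
  have hZ : D ++ (t ++ B ++ X) = (t ++ B ++ X) ++ D := by
    calc D ++ (t ++ B ++ X) = (D ++ (t ++ B)) ++ X := by simp
      _ = t ++ (B' ++ X) := by rw [← h4]; simp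
      _ = t ++ (B ++ (X ++ D)) := by rw [h3]
      _ = _ := by simp
  have hp : Prim (D ++ (t ++ B ++ X)) := by
    refine (hc.rot ?_).prim
    rw [h1]
    have := rot_app X (D ++ (t ++ B))
    simpa using this
  rcases hp D (t ++ B ++ X) rfl hZ with h | h
  · exact hD h
  · have := congrArg List.length h
    have h6 : 0 < t.length := by omega
    rw [List.length_append, List.length_append, List.length_nil] at this
    omega

theorem selfp' {R : Set (List (GenSym S.A × Bool))} (hR : SymR R) {u v} (hr : u ++ v ∈ R) (hc : IsCh (u ++ v)) {X D t B : List (GenSym S.A × Bool)}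
    (hD : D ≠ []) (h1 : u = X ++ (D ++ (t ++ B))) (h2 : ∃ B', u = X ++ (t ++ B')) : 15 * t.length ≤ (u ++ v).length := by
  obtain ⟨B', h2⟩ := h2
  exact selfp hR hr hc (X := X) (D := D) (t := t) (B := B ++ v) hD (by rw [h1]; simp) ⟨B' ++ v, by rw [h2]; simp⟩

theorem gapb {R : Set (List (GenSym S.A × Bool))} (hR : SymR R) {u v} (hr : u ++ v ∈ R) (hc : IsCh (u ++ v)) {n : ℕ} {l : GenSym S.A × Bool}
    (h : List.replicate n l <:+: u) : 15 * n ≤ (u ++ v).length + 15 := by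
  obtain ⟨X, B, h⟩ := h
  rcases n with _ | n
  · omega
  · have := selfp' hR hr hc (X := X) (D := [l]) (t := List.replicate n l) (B := B) (by simp) (by rw [← h]; simp [List.replicate_succ])
      ⟨[l] ++ B, by rw [← h, List.replicate_succ']; simp⟩
    rw [List.length_replicate] at this
    omega

/-- powers of `f` as words -/
def fp {A : Type*} (f : A) (m : ℤ) : List (A × Bool) := List.replicate m.natAbs (f, decide (0 ≤ m))

theorem fp_len {A : Type*} (f : A) (m : ℤ) : (fp f m).length = m.natAbs := by simp [fp]

theorem fp_zero {A : Type*} (f : A) : fp f 0 = [] := by simp [fp]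

theorem mem_fp {A : Type*} {f : A} {m : ℤ} {l} (h : l ∈ fp f m) : l.1 = f := by
  rw [List.eq_of_mem_replicate h]

theorem fp_ne {A : Type*} {f : A} {m : ℤ} (h : m ≠ 0) : fp f m ≠ [] := by
  simp [fp, h]

theorem ev_fp (f : GenSym S.A) (m : ℤ) : ev S p₁ p₂ (fp f m) = gen S p₁ p₂ f ^ m := by
  have hp : ∀ n : ℕ, ev S p₁ p₂ (List.replicate n (f, true)) = gen S p₁ p₂ f ^ n := by
    intro n
    unfold ev
    rw [mk_rep, _root_.map_pow]; rfl
  by_cases h : 0 ≤ m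
  · obtain ⟨n, rfl⟩ := Int.eq_ofNat_of_zero_le h
    simp only [fp, h, decide_true]
    rw [hp, Int.natAbs_natCast, zpow_natCast]
  · obtain ⟨n, hn⟩ := Int.eq_ofNat_of_zero_le (show 0 ≤ -m by omega)
    have hm : m = -(n : ℤ) := by omega
    have e : fp f m = FreeGroup.invRev (List.replicate n (f, true)) := by
      rw [invRev_rep, hm]; simp [fp]; omega
    rw [e, ev_inv, hp, hm, zpow_neg, zpow_natCast]

theorem rep_parse {α : Type*} {a b : α} : ∀ {n m : ℕ} {c d : α} {l l' : List α}, List.replicate n a ++ c :: l = List.replicate m b ++ d :: l' →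
    c ≠ a → c ≠ b → d ≠ a → d ≠ b → n = m ∧ (0 < n → a = b) ∧ c :: l = d :: l' := by
  intro n
  induction n with
  | zero =>
    intro m c d l l' h h1 h2 h3 h4
    rcases m with _ | m
    · simpa using h
    · simp [List.replicate_succ] at h; exact absurd h.1 h2
  | succ n ih =>
    intro m c d l l' h h1 h2 h3 h4
    rcases m with _ | m
    · simp [List.replicate_succ] at h; exact absurd h.1.symm h3
    · simp only [List.replicate_succ, List.cons_append, List.cons.injEq] at h
      have := ih h.2 h1 h2 h3 h4
      exact ⟨by omega, fun _ => h.1, this.2.2⟩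

theorem fp_parse {A : Type*} {f : A} {m m' : ℤ} {c d : A × Bool} {l l'} (h : fp f m ++ c :: l = fp f m' ++ d :: l') (hc : c.1 ≠ f) (hd : d.1 ≠ f) :
    m = m' := by
  have := rep_parse h (by rintro rfl; exact hc rfl) (by rintro rfl; exact hc rfl) (by rintro rfl; exact hd rfl) (by rintro rfl; exact hd rfl)
  obtain ⟨h1, h2, -⟩ := this
  by_cases h0 : 0 < m.natAbs
  · have := h2 h0
    simp at this
    by_cases h3 : 0 ≤ m <;> by_cases h4 : 0 ≤ m' <;> simp [h3, h4] at this <;> omega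
  · omega

/-- decomposition of infixes of an append -/
theorem infix_app {α : Type*} {u X Y : List α} (h : u <:+: X ++ Y) :
    u <:+: X ∨ u <:+: Y ∨ ∃ s t, s ≠ [] ∧ t ≠ [] ∧ s <:+ X ∧ t <+: Y ∧ u = s ++ t := by
  obtain ⟨a, b, h⟩ := h
  rw [List.append_assoc] at h
  rcases List.append_eq_append_iff.1 h with ⟨c, h1, h2⟩ | ⟨c, h1, h2⟩
  · -- X = a ++ c, u ++ b = c ++ Y
    rcases List.append_eq_append_iff.1 h2 with ⟨d, h3, h4⟩ | ⟨d, h3, h4⟩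
    · left; exact ⟨a, d, by rw [h1, h3]; simp⟩
    · by_cases hc : c = []
      · right; left; exact ⟨[], b, by rw [h4, h3, hc]; simp⟩
      · by_cases hd : d = []
        · left; exact ⟨a, [], by rw [h1, h3, hd]; simp⟩
        · right; right; exact ⟨c, d, hc, hd, ⟨a, h1.symm⟩, ⟨b, h4.symm⟩, h3⟩
  · right; left; exact ⟨c, b, by rw [h2]; simp⟩

theorem pre_app {α : Type*} {u X Y : List α} (h : u <+: X ++ Y) : u <+: X ∨ ∃ t, t <+: Y ∧ t ≠ [] ∧ u = X ++ t := by
  obtain ⟨b, h⟩ := h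
  rcases List.append_eq_append_iff.1 h with ⟨c, h1, h2⟩ | ⟨c, h1, h2⟩
  · left; exact ⟨c, h1.symm⟩
  · by_cases hc : c = []
    · left; exact ⟨[], by rw [h1, hc]; simp⟩
    · right; exact ⟨c, ⟨b, h2.symm⟩, hc, h1⟩

theorem suf_app {α : Type*} {u X Y : List α} (h : u <:+ X ++ Y) : u <:+ Y ∨ ∃ t, t <:+ X ∧ t ≠ [] ∧ u = t ++ Y := by
  obtain ⟨b, h⟩ := h
  rcases List.append_eq_append_iff.1 h with ⟨c, h1, h2⟩ | ⟨c, h1, h2⟩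
  · by_cases hc : c = []
    · left; exact ⟨[], by rw [h2, hc]; simp⟩
    · right; exact ⟨c, ⟨b, h1.symm⟩, hc, h2⟩
  · left; exact ⟨c, h2.symm⟩

def wrd {γ α : Type*} (B : γ → List α) (L : List γ) : List α := (L.map B).flatten

theorem pre_wrd {γ α : Type*} (B : γ → List α) : ∀ {L : List γ} {u : List α}, u <+: wrd B L → u ≠ [] →
    ∃ L2 m1 L3 t, L = L2 ++ m1 :: L3 ∧ t ≠ [] ∧ t <+: B m1 ∧ u = wrd B L2 ++ t := by
  intro L
  induction L with
  | nil => intro u h hu; simp [wrd] at h; exact absurd h hu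
  | cons m L ih =>
    intro u h hu
    rcases pre_app (X := B m) (Y := wrd B L) h with h | ⟨t, h1, h2, h3⟩
    · exact ⟨[], m, L, u, rfl, hu, h, by simp [wrd]⟩
    · obtain ⟨L2, m1, L3, t', e1, e2, e3, e4⟩ := ih h1 h2
      exact ⟨m :: L2, m1, L3, t', by simp [e1], e2, e3, by rw [h3, e4]; simp [wrd]⟩

theorem infix_wrd {γ α : Type*} (B : γ → List α) : ∀ {L : List γ} {u : List α}, u <:+: wrd B L → u ≠ [] →
    (∃ m ∈ L, u <:+: B m) ∨ ∃ L1 m0 L2 m1 L3 s t, L = L1 ++ m0 :: (L2 ++ m1 :: L3) ∧ s ≠ [] ∧ t ≠ [] ∧ s <:+ B m0 ∧ t <+: B m1 ∧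
      u = s ++ (wrd B L2 ++ t) := by
  intro L
  induction L with
  | nil => intro u h hu; simp [wrd] at h; exact absurd h hu
  | cons m L ih =>
    intro u h hu
    rcases infix_app (X := B m) (Y := wrd B L) h with h | h | ⟨s, t, hs, ht, h1, h2, h3⟩
    · left; exact ⟨m, by simp, h⟩
    · rcases ih h hu with ⟨m', h1, h2⟩ | ⟨L1, m0, L2, m1, L3, s, t, e1, e2⟩
      · left; exact ⟨m', by simp [h1], h2⟩
      · right; exact ⟨m :: L1, m0, L2, m1, L3, s, t, by simp [e1], e2⟩
    · obtain ⟨L2, m1, L3, t', e1, e2, e3, e4⟩ := pre_wrd B h2 ht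
      right
      exact ⟨[], m, L2, m1, L3, s, t', by simp [e1], hs, e2, h1, e3, by rw [h3, e4]⟩

end api
end Part12


section Part13
open FreeGroup
section chunks
variable {S : IndexedStructure} {p₁ p₂ : ℕ}

/-- a long piece of a relator -/
def Chk (R : Set (List (GenSym S.A × Bool))) (u v : List (GenSym S.A × Bool)) : Prop := u ++ v ∈ R ∧ 5 * v.length ≤ (u ++ v).length

structure YC (S : IndexedStructure) (p₁ p₂ : ℕ) (f : GenSym S.A) (Y : List (GenSym S.A × Bool)) : Prop where
  ne : Y ≠ []
  red : FreeGroup.IsReduced Y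
  hd : ∀ c l, Y = c :: l → c.1 ≠ f
  lt : ∀ l c, Y = l ++ [c] → c.1 ≠ f
  mn : ∀ u v, u ++ v ∈ RR S p₁ p₂ → u <:+: Y → u.length ≤ v.length

variable {f : GenSym S.A} {p : ℕ} {Y : List (GenSym S.A × Bool)}

theorem YC.pre (hY : YC S p₁ p₂ f Y) {H : List (GenSym S.A × Bool)} (h : H <+: Y) (hne : H ≠ []) : ∃ c l, H = c :: l ∧ c.1 ≠ f := by
  obtain ⟨c, l, e⟩ := List.exists_cons_of_ne_nil hne
  obtain ⟨t, ht⟩ := h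
  exact ⟨c, l, e, hY.hd c (l ++ t) (by rw [← ht, e]; simp)⟩

theorem YC.suf (hY : YC S p₁ p₂ f Y) {H : List (GenSym S.A × Bool)} (h : H <:+ Y) (hne : H ≠ []) : ∃ l c, H = l ++ [c] ∧ c.1 ≠ f := by
  rcases List.eq_nil_or_concat H with e | ⟨l, c, e⟩
  · exact absurd e hne
  obtain ⟨t, ht⟩ := h
  exact ⟨l, c, by simpa using e, hY.lt (t ++ l) c (by rw [← ht, e]; simp)⟩

theorem YC.prem (hY : YC S p₁ p₂ f Y) {H : List (GenSym S.A × Bool)} (h : H <+: Y) (hne : H ≠ []) : ∃ l ∈ H, l.1 ≠ f := by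
  obtain ⟨c, l, e, h⟩ := hY.pre h hne
  exact ⟨c, by simp [e], h⟩

theorem YC.sufm (hY : YC S p₁ p₂ f Y) {H : List (GenSym S.A × Bool)} (h : H <:+ Y) (hne : H ≠ []) : ∃ l ∈ H, l.1 ≠ f := by
  obtain ⟨l, c, e, h⟩ := hY.suf h hne
  exact ⟨c, by simp [e], h⟩

theorem YC.half (hR : SymR (RR S p₁ p₂)) (hY : YC S p₁ p₂ f Y) {a t b : List (GenSym S.A × Bool)} (h : a ++ (t ++ b) ∈ RR S p₁ p₂) (ht : t <:+: Y) :
    2 * t.length ≤ (a ++ (t ++ b)).length := by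
  have h1 := hR.rot a (t ++ b) h
  rw [List.append_assoc] at h1
  have := hY.mn _ _ h1 ht
  simp only [List.length_append] at *
  omega

theorem chunk_core (hR : SymR (RR S p₁ p₂)) (hf : FP p₁ p₂ f p) (hp : 10 ^ 10 < p) (hY : YC S p₁ p₂ f Y) {u v T H : List (GenSym S.A × Bool)} {n : ℕ} {s : Bool}
    (hc : Chk (RR S p₁ p₂) u v) (hu : u = T ++ (List.replicate n (f, s) ++ H)) (hT : T <:+: Y) (hH : H <:+: Y) (hn : 2 * n ≤ p)
    (hTf : 0 < n → T ≠ [] → ∃ l ∈ T, l.1 ≠ f) (hHf : 0 < n → H ≠ [] → ∃ l ∈ H, l.1 ≠ f) :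
    T ≠ [] ∧ H ≠ [] ∧ (u ++ v).length < 15 * T.length ∧ (0 < n → IsCh (u ++ v)) := by
  obtain ⟨hr, h5⟩ := hc
  have hpos : 0 < (u ++ v).length := List.length_pos_iff.2 (hR.ne _ hr)
  have h1 : 2 * T.length ≤ (u ++ v).length := by
    have e : u ++ v = [] ++ (T ++ ((List.replicate n (f, s) ++ H) ++ v)) := by rw [hu]; simp
    rw [e] at hr ⊢
    exact hY.half hR hr hT
  have h2 : 2 * H.length ≤ (u ++ v).length := by
    have e : u ++ v = (T ++ List.replicate n (f, s)) ++ (H ++ v) := by rw [hu]; simp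
    rw [e] at hr ⊢
    exact hY.half hR hr hH
  have hl : u.length = T.length + (n + H.length) := by rw [hu]; simp
  have hl2 : (u ++ v).length = u.length + v.length := List.length_append
  have key : 0 < n → IsCh (u ++ v) := by
    intro h0
    have hm : (f, s) ∈ u ++ v := by rw [hu]; simp [show n ≠ 0 by omega]
    rcases RR_f hf hr hm with h | h
    · exfalso
      have hall : ∀ l ∈ u, l.1 = f := by
        intro l hl
        have : l ∈ u ++ v := List.mem_append_left _ hl
        rw [h] at this
        rw [List.eq_of_mem_replicate this]
      have hT0 : T = [] := by
        by_contra hc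
        obtain ⟨l, h1, h2⟩ := hTf h0 hc
        exact h2 (hall l (by rw [hu]; simp [h1]))
      have hH0 : H = [] := by
        by_contra hc
        obtain ⟨l, h1, h2⟩ := hHf h0 hc
        exact h2 (hall l (by rw [hu]; simp [h1]))
      have hlr : (u ++ v).length = p := by rw [h]; simp
      rw [hT0, hH0] at hl
      simp at hl
      omega
    · exact h
  have hn15 : 15 * n < (u ++ v).length + 30 := by
    by_cases h0 : 0 < n
    · have := gapb hR hr (key h0) (n := n) (l := (f, s)) ⟨T, H, by rw [hu]; simp⟩
      omega
    · omega
  have hbig : 0 < n → 10 ^ 7 ≤ (u ++ v).length := fun h => (key h).len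
  refine ⟨?_, ?_, ?_, key⟩
  · rintro rfl
    simp at hl
    by_cases h0 : 0 < n
    · have := hbig h0; omega
    · omega
  · rintro rfl
    simp at hl
    by_cases h0 : 0 < n
    · have := hbig h0; omega
    · omega
  · by_cases h0 : 0 < n
    · have := hbig h0; omega
    · omega

theorem no_Yf (hR : SymR (RR S p₁ p₂)) (hf : FP p₁ p₂ f p) (hp : 10 ^ 10 < p) (hY : YC S p₁ p₂ f Y) {u v : List (GenSym S.A × Bool)} {m : ℤ}
    (hc : Chk (RR S p₁ p₂) u v) (hm : 2 * m.natAbs ≤ p) (hu : u <:+: Y ++ fp f m) : False := by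
  rcases infix_app hu with h | h | ⟨s, t, hs, ht, h1, h2, h3⟩
  · exact (chunk_core hR hf hp hY (T := u) (H := []) (n := 0) (s := true) hc (by simp) h (List.nil_infix) (by omega) (by simp) (by simp)).2.1 rfl
  · have hu' : u = List.replicate u.length (f, decide (0 ≤ m)) := by
      obtain ⟨a, b, e⟩ := h
      rw [List.append_assoc] at e
      exact (rep_split (rep_split e.symm).2.symm).1
    have hl : u.length ≤ m.natAbs := by have := h.length_le; rwa [fp_len] at this
    exact (chunk_core hR hf hp hY (T := []) (H := []) (n := u.length) hc (by simpa using hu') (List.nil_infix) (List.nil_infix) (by omega) (by simp) (by simp)).2.1 rfl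
  · have ht' : t = List.replicate t.length (f, decide (0 ≤ m)) := by
      obtain ⟨b, e⟩ := h2
      exact (rep_split e.symm).1
    have hl : t.length ≤ m.natAbs := by have := h2.length_le; rwa [fp_len] at this
    exact (chunk_core hR hf hp hY (T := s) (H := []) (n := t.length) hc (by rw [List.append_nil, ← ht', h3]) h1.isInfix (List.nil_infix) (by omega)
      (fun _ h => hY.sufm h1 h) (by simp)).2.1 rfl

theorem chunk_YfY (hR : SymR (RR S p₁ p₂)) (hf : FP p₁ p₂ f p) (hp : 10 ^ 10 < p) (hY : YC S p₁ p₂ f Y) {u v : List (GenSym S.A × Bool)} {m : ℤ}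
    (hc : Chk (RR S p₁ p₂) u v) (hm : 2 * m.natAbs ≤ p) (hu : u <:+: (Y ++ fp f m) ++ Y) :
    ∃ T H, u = T ++ (fp f m ++ H) ∧ T <:+ Y ∧ H <+: Y ∧ T ≠ [] ∧ H ≠ [] ∧ (u ++ v).length < 15 * T.length ∧ (m ≠ 0 → IsCh (u ++ v)) := by
  rcases infix_app hu with h | h | ⟨s, t, hs, ht, h1, h2, h3⟩
  · exact absurd h (fun h => no_Yf hR hf hp hY hc hm h)
  · exfalso
    exact (chunk_core hR hf hp hY (T := u) (H := []) (n := 0) (s := true) hc (by simp) h (List.nil_infix) (by omega) (by simp) (by simp)).2.1 rfl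
  · rcases suf_app h1 with h1 | ⟨T, hT1, hT2, hT3⟩
    · exfalso
      have hs' : s = List.replicate s.length (f, decide (0 ≤ m)) := by
        obtain ⟨b, e⟩ := h1
        exact (rep_split e.symm).2
      have hl : s.length ≤ m.natAbs := by have := h1.length_le; rwa [fp_len] at this
      exact (chunk_core hR hf hp hY (T := []) (H := t) (n := s.length) hc (by rw [List.nil_append, ← hs', h3]) (List.nil_infix) h2.isInfix (by omega)
        (by simp) (fun _ h => hY.prem h2 h)).1 rfl
    · have e : u = T ++ (fp f m ++ t) := by rw [h3, hT3, List.append_assoc]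
      have := chunk_core hR hf hp hY (T := T) (H := t) (n := m.natAbs) hc e hT1.isInfix h2.isInfix (by omega) (fun _ h => hY.sufm hT1 h) (fun _ h => hY.prem h2 h)
      exact ⟨T, t, e, hT1, h2, this.1, this.2.1, this.2.2.1, fun h => this.2.2.2 (by omega)⟩

def Bad (S : IndexedStructure) (p₁ p₂ : ℕ) (f : GenSym S.A) (Y : List (GenSym S.A × Bool)) (m : ℤ) : Prop :=
  ¬ FreeGroup.IsReduced ((Y ++ fp f m) ++ Y) ∨ ∃ u v, Chk (RR S p₁ p₂) u v ∧ u <:+: (Y ++ fp f m) ++ Y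

theorem fp_red {A : Type*} (f : A) (m : ℤ) : FreeGroup.IsReduced (fp f m) := by
  unfold FreeGroup.IsReduced fp
  exact List.isChain_replicate_of_rel _ (by simp)

theorem red_Yf (hY : YC S p₁ p₂ f Y) (m : ℤ) : FreeGroup.IsReduced (Y ++ fp f m) := by
  have h := hY.red
  have h2 := fp_red f m
  unfold FreeGroup.IsReduced at *
  rw [List.isChain_append]
  refine ⟨h, h2, ?_⟩
  intro x hx y hy e
  exfalso
  have hy' := mem_fp (List.mem_of_mem_head? hy)
  obtain ⟨l, rfl⟩ : ∃ l, Y = l ++ [x] := by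
    rcases List.eq_nil_or_concat Y with e | ⟨l, c, e⟩
    · exact absurd e hY.ne
    · rw [e] at hx; simp at hx; exact ⟨l, by rw [e, hx]; simp⟩
  exact hY.lt l x rfl (by rw [e, hy'])

theorem red_YfY (hY : YC S p₁ p₂ f Y) {m : ℤ} (hm : m ≠ 0) : FreeGroup.IsReduced ((Y ++ fp f m) ++ Y) := by
  have h := red_Yf hY m
  have h2 := hY.red
  unfold FreeGroup.IsReduced at *
  rw [List.isChain_append]
  refine ⟨h, h2, ?_⟩
  intro x hx y hy e
  exfalso
  have hx' : x.1 = f := by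
    rw [List.getLast?_append_of_ne_nil _ (fp_ne hm)] at hx
    exact mem_fp (List.mem_of_mem_getLast? hx)
  obtain ⟨l, rfl⟩ : ∃ l, Y = y :: l := by
    obtain ⟨c, l, e⟩ := List.exists_cons_of_ne_nil hY.ne
    rw [e] at hy; simp at hy; exact ⟨l, by rw [e, hy]⟩
  exact hY.hd y l rfl (by rw [← e, hx'])

theorem bad_cc (hR : SymR (RR S p₁ p₂)) (hY : YC S p₁ p₂ f Y) {u v u' v' T H T' H' : List (GenSym S.A × Bool)} {m m' : ℤ}
    (hr : u ++ v ∈ RR S p₁ p₂) (hr' : u' ++ v' ∈ RR S p₁ p₂) (hu : u = T ++ (fp f m ++ H)) (hu' : u' = T' ++ (fp f m' ++ H'))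
    (hT : T <:+ Y) (hT' : T' <:+ Y) (hH : H <+: Y) (hH' : H' <+: Y) (hn : H ≠ []) (hn' : H' ≠ []) (hl : (u ++ v).length < 15 * T.length)
    (hle : T.length ≤ T'.length) : m = m' := by
  obtain ⟨D, hD⟩ : T <:+ T' := List.suffix_of_suffix_length_le hT hT' hle
  have e1 : u ++ v = T ++ (fp f m ++ (H ++ v)) := by rw [hu]; simp
  have e2 : u' ++ v' = D ++ (T ++ (fp f m' ++ (H' ++ v'))) := by rw [hu', ← hD]; simp
  rw [e1] at hr hl
  rw [e2] at hr'
  have h2 := hR.rot _ _ hr'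
  rw [List.append_assoc] at h2
  have h3 := hR.piece _ _ _ hr h2 hl
  obtain ⟨c, l, e, hc⟩ := hY.pre hH hn
  obtain ⟨c', l', e', hc'⟩ := hY.pre hH' hn'
  rw [e, e'] at h3
  refine fp_parse (c := c) (d := c') (l := l ++ v) (l' := l' ++ v' ++ D) (f := f) ?_ hc hc'
  simpa using h3

theorem bad_nc (hY : YC S p₁ p₂ f Y) {u v T H : List (GenSym S.A × Bool)} {m m' : ℤ} (hu : u = T ++ (fp f m ++ H)) (hT : T <:+ Y) (hH : H <+: Y) (hTn : T ≠ [])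
    (hn : H ≠ []) (hch : m ≠ 0 → IsCh (u ++ v)) (hb : ¬ FreeGroup.IsReduced ((Y ++ fp f m') ++ Y)) : m' = m := by
  have hm' : m' = 0 := by
    by_contra h
    exact hb (red_YfY hY h)
  subst hm'
  by_contra hm
  obtain ⟨s, hs⟩ := (hch (Ne.symm hm)).sgn
  apply hb
  have h2 := hY.red
  rw [fp_zero, List.append_nil]
  unfold FreeGroup.IsReduced at *
  rw [List.isChain_append]
  refine ⟨h2, h2, ?_⟩
  intro x hx y hy _
  obtain ⟨l, c, e, -⟩ := hY.suf hT hTn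
  obtain ⟨c', l', e', -⟩ := hY.pre hH hn
  have hx' : x = c := by
    obtain ⟨t, ht⟩ := hT
    rw [← ht, e] at hx; simp at hx; exact hx.symm
  have hy' : y = c' := by
    obtain ⟨t, ht⟩ := hH
    rw [← ht, e'] at hy; simp at hy; exact hy.symm
  rw [hs x (by rw [hu, e, hx']; simp), hs y (by rw [hu, e', hy']; simp)]

theorem bad_uniq (hR : SymR (RR S p₁ p₂)) (hf : FP p₁ p₂ f p) (hp : 10 ^ 10 < p) (hY : YC S p₁ p₂ f Y) {m m' : ℤ}
    (hm : 2 * m.natAbs ≤ p) (hm' : 2 * m'.natAbs ≤ p) (hb : Bad S p₁ p₂ f Y m) (hb' : Bad S p₁ p₂ f Y m') : m = m' := by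
  rcases hb with hb | ⟨u, v, hc, hu⟩ <;> rcases hb' with hb' | ⟨u', v', hc', hu'⟩
  · have h1 : m = 0 := by
      by_contra h
      exact hb (red_YfY hY h)
    have h2 : m' = 0 := by
      by_contra h
      exact hb' (red_YfY hY h)
    rw [h1, h2]
  · obtain ⟨T, H, e, hT, hH, hTn, hHn, hl, hch⟩ := chunk_YfY hR hf hp hY hc' hm' hu'
    exact bad_nc hY e hT hH hTn hHn hch hb
  · obtain ⟨T, H, e, hT, hH, hTn, hHn, hl, hch⟩ := chunk_YfY hR hf hp hY hc hm hu
    exact (bad_nc hY e hT hH hTn hHn hch hb').symm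
  · obtain ⟨T, H, e, hT, hH, hTn, hHn, hl, hch⟩ := chunk_YfY hR hf hp hY hc hm hu
    obtain ⟨T', H', e', hT', hH', hTn', hHn', hl', hch'⟩ := chunk_YfY hR hf hp hY hc' hm' hu'
    rcases le_total T.length T'.length with h | h
    · exact bad_cc hR hY hc.1 hc'.1 e e' hT hT' hH hH' hHn hHn' hl h
    · exact (bad_cc hR hY hc'.1 hc.1 e' e hT' hT hH' hH hHn' hHn hl' h).symm

end chunks
end Part13


section Part14
open FreeGroup
section wordlem
variable {S : IndexedStructure} {p₁ p₂ : ℕ} {f : GenSym S.A} {p : ℕ} {Y : List (GenSym S.A × Bool)}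

theorem wrd_cons {γ α : Type*} (B : γ → List α) (m : γ) (L : List γ) : wrd B (m :: L) = B m ++ wrd B L := by simp [wrd]
theorem wrd_nil {γ α : Type*} (B : γ → List α) : wrd B ([] : List γ) = [] := by simp [wrd]
theorem wrd_append {γ α : Type*} (B : γ → List α) (L L' : List γ) : wrd B (L ++ L') = wrd B L ++ wrd B L' := by simp [wrd]

theorem wrd_red (hY : YC S p₁ p₂ f Y) : ∀ (M : List ℤ) (z : ℤ), (∀ m ∈ M, ¬ Bad S p₁ p₂ f Y m) →
    FreeGroup.IsReduced (wrd (fun m => Y ++ fp f m) (M ++ [z])) := by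
  intro M z
  induction M with
  | nil => intro _; rw [List.nil_append, wrd_cons, wrd_nil, List.append_nil]; exact red_Yf hY z
  | cons m M ih =>
    intro h
    have h1 := ih (fun m hm => h m (by simp [hm]))
    have h2 : FreeGroup.IsReduced ((Y ++ fp f m) ++ Y) := by
      by_contra hc
      exact h m (by simp) (Or.inl hc)
    rw [List.cons_append, wrd_cons]
    obtain ⟨W, hW⟩ : ∃ W, wrd (fun m => Y ++ fp f m) (M ++ [z]) = Y ++ W := by
      rcases M with _ | ⟨m', M⟩
      · exact ⟨fp f z, by simp [wrd]⟩
      · exact ⟨fp f m' ++ wrd (fun m => Y ++ fp f m) (M ++ [z]), by simp [wrd]⟩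
    rw [hW] at h1 ⊢
    have := FreeGroup.IsReduced.append_overlap h2 h1 hY.ne
    simpa using this

/-- the main combinatorial analysis of a long relator chunk in the word `Y f^m₁ Y f^m₂ ⋯` -/
theorem word_chunk (hR : SymR (RR S p₁ p₂)) (hf : FP p₁ p₂ f p) (hp : 10 ^ 10 < p) (hY : YC S p₁ p₂ f Y) {ms M : List ℤ} {z : ℤ}
    (hms : ms = M ++ [z]) (hnb : ∀ m ∈ M, ¬ Bad S p₁ p₂ f Y m) (hnd : ms.Nodup) (hbd : ∀ m ∈ ms, 2 * m.natAbs ≤ p) {u v : List (GenSym S.A × Bool)}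
    (hc : Chk (RR S p₁ p₂) u v) (hu : u <:+: wrd (fun m => Y ++ fp f m) ms) :
    ∃ A m1 m2 m3 B r, ms = A ++ m1 :: m2 :: m3 :: B ∧ IsCh r ∧ Y ++ (fp f m1 ++ (Y ++ (fp f m2 ++ (Y ++ (fp f m3 ++ Y))))) <:+: r := by
  have hr := hc.1
  have h5 := hc.2
  have hpos : 0 < (u ++ v).length := List.length_pos_iff.2 (hR.ne _ hr)
  have hl2 : (u ++ v).length = u.length + v.length := List.length_append
  have hune : u ≠ [] := by
    rintro rfl
    simp at hl2 h5 hpos; omega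
  rcases infix_wrd _ hu hune with ⟨m, hm, h⟩ | ⟨L1, m0, L2, m1, L3, s, t, e1, hs, ht, hs1, ht1, e2⟩
  · exact (no_Yf hR hf hp hY hc (hbd m hm) h).elim
  -- shape of s
  obtain ⟨T, n, σ, hsT, hTY, hn0, hnm⟩ : ∃ T n σ, s = T ++ List.replicate n (f, σ) ∧ T <:+ Y ∧ (n = 0 → m0 = 0) ∧ s <:+ Y ++ fp f m0 := by
    rcases suf_app hs1 with h | ⟨T, h1, h2, h3⟩
    · refine ⟨[], s.length, decide (0 ≤ m0), ?_, List.nil_suffix, ?_, hs1⟩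
      · obtain ⟨b, e⟩ := h
        exact (rep_split e.symm).2
      · intro h; exact absurd (List.length_eq_zero_iff.1 h) hs
    · exact ⟨T, m0.natAbs, decide (0 ≤ m0), h3, h1, fun h => by omega, hs1⟩
  obtain ⟨H, n', σ', htH, hHY, hHne, hHn⟩ : ∃ H n' σ', t = H ++ List.replicate n' (f, σ') ∧ H <+: Y ∧ H ≠ [] ∧ (0 < n' → H = Y) := by
    rcases pre_app ht1 with h | ⟨T, h1, h2, h3⟩
    · exact ⟨t, 0, true, by simp, h, ht, by simp⟩
    · obtain ⟨b, e⟩ := h1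
      exact ⟨Y, T.length, _, by rw [h3]; congr 1; exact (rep_split e.symm).1, List.prefix_rfl, hY.ne, fun _ => rfl⟩
  have hm0M : m0 ∈ M := by
    have : (L1 ++ m0 :: (L2 ++ [m1])) ++ L3 = M ++ [z] := by rw [← hms, e1]; simp
    rcases List.eq_nil_or_concat L3 with h | ⟨L, c, h⟩
    · rw [h, List.append_nil] at this
      have e : (L1 ++ m0 :: L2) ++ [m1] = M ++ [z] := by rw [← this]; simp
      have := (List.append_inj' e rfl).1
      rw [← this]; simp
    · rw [h] at this
      have e : (L1 ++ m0 :: (L2 ++ m1 :: L)) ++ [c] = M ++ [z] := by rw [← this]; simp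
      have := (List.append_inj' e rfl).1
      rw [← this]; simp
  have hndd : ∀ m ∈ L2, m ≠ m0 := by
    intro m hm e
    have hnd' := hnd
    rw [e1] at hnd'
    have h1 := (List.nodup_append.1 hnd').2.1
    rw [List.nodup_cons] at h1
    exact h1.1 (by rw [← e]; simp [hm])
  -- exclude inside `Y f^m0 Y`
  have hnot : L2 ≠ [] ∨ 0 < n' := by
    by_contra hcon
    push Not at hcon
    obtain ⟨rfl, hn'⟩ := hcon
    have hn' : n' = 0 := by omega
    apply hnb m0 hm0M
    refine Or.inr ⟨u, v, hc, ?_⟩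
    obtain ⟨a, ha⟩ := hs1
    obtain ⟨b, hb⟩ := hHY
    refine ⟨a, b, ?_⟩
    rw [e2, htH, hn']
    change a ++ (s ++ ([] ++ (H ++ []))) ++ b = _
    rw [← ha, ← hb]; simp
  -- relator is a chain
  have hfm : ∃ s, (f, s) ∈ u := by
    by_cases h0 : n = 0
    · have := hn0 h0
      rcases hnot with h | h
      · obtain ⟨m2, L, e⟩ := List.exists_cons_of_ne_nil h
        have : m2 ≠ 0 := by rw [← this]; exact hndd m2 (by simp [e])
        refine ⟨decide (0 ≤ m2), ?_⟩
        rw [e2, e, wrd_cons]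
        have : (f, decide (0 ≤ m2)) ∈ fp f m2 := by unfold fp; simp; omega
        simp [this]
      · exact ⟨σ', by rw [e2, htH]; simp; right; right; right; omega⟩
    · exact ⟨σ, by rw [e2, hsT]; simp [h0]⟩
  have hch : IsCh (u ++ v) := by
    obtain ⟨σ'', h⟩ := hfm
    rcases RR_f hf hr (List.mem_append_left v h) with h | h
    · exfalso
      obtain ⟨l, hl1, hl2⟩ := hY.prem hHY hHne
      have : l ∈ u ++ v := by rw [e2, htH]; simp [hl1]
      rw [h] at this
      rw [List.eq_of_mem_replicate this] at hl2
      exact hl2 rfl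
    · exact h
  have hbig := hch.len
  -- length bounds
  have hTb : 15 * T.length ≤ (u ++ v).length := by
    obtain ⟨Y', hY'⟩ := hTY
    obtain ⟨B, hB⟩ : ∃ B, u = s ++ (Y ++ B) := by
      rcases hnot with h | h
      · obtain ⟨m2, L, e⟩ := List.exists_cons_of_ne_nil h
        exact ⟨fp f m2 ++ (wrd (fun m => Y ++ fp f m) L ++ t), by rw [e2, e, wrd_cons]; simp⟩
      · rcases L2 with _ | ⟨m2, L⟩
        · exact ⟨List.replicate n' (f, σ'), by rw [e2, htH, hHn h]; simp [wrd]⟩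
        · exact ⟨fp f m2 ++ (wrd (fun m => Y ++ fp f m) L ++ t), by rw [e2, wrd_cons]; simp⟩
    refine selfp' hR hr hch (X := []) (D := s ++ Y') (t := T) (B := B) (by simp [hs]) ?_ ⟨List.replicate n (f, σ) ++ (Y ++ B), ?_⟩
    · rw [hB, ← hY']; simp
    · rw [hB, hsT]; simp
  have hnb' : 15 * n ≤ (u ++ v).length + 15 :=
    gapb hR hr hch (l := (f, σ)) ⟨T, wrd (fun m => Y ++ fp f m) L2 ++ t, by rw [e2, hsT]⟩
  have hnb2 : 15 * n' ≤ (u ++ v).length + 15 :=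
    gapb hR hr hch (l := (f, σ')) ⟨s ++ (wrd (fun m => Y ++ fp f m) L2 ++ H), [], by rw [e2, htH]; simp⟩
  have hmb : ∀ m ∈ L2, 15 * m.natAbs ≤ (u ++ v).length + 15 := by
    intro m hm
    obtain ⟨A, B, e⟩ := List.append_of_mem hm
    exact gapb hR hr hch (l := (f, decide (0 ≤ m))) ⟨s ++ (wrd (fun m => Y ++ fp f m) A ++ Y), wrd (fun m => Y ++ fp f m) B ++ t, by
      rw [e2, e, wrd_append, wrd_cons]; simp [fp]⟩
  have hsl : s.length = T.length + n := by rw [hsT]; simp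
  have htl : t.length = H.length + n' := by rw [htH]; simp
  have hul : u.length = s.length + ((wrd (fun m => Y ++ fp f m) L2).length + t.length) := by rw [e2]; simp
  have hHl : H.length ≤ Y.length := hHY.length_le
  have hYhalf : 2 * Y.length ≤ (u ++ v).length ∨ (L2 = [] ∧ n' = 0) := by
    rcases L2 with _ | ⟨m2, L⟩
    · rcases Nat.eq_zero_or_pos n' with h | h
      · exact Or.inr ⟨rfl, h⟩
      · left
        have e : u ++ v = s ++ (Y ++ (List.replicate n' (f, σ') ++ v)) := by rw [e2, htH, hHn h]; simp [wrd]
        rw [e] at hr ⊢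
        exact hY.half hR hr List.infix_rfl
    · left
      have e : u ++ v = s ++ (Y ++ (fp f m2 ++ (wrd (fun m => Y ++ fp f m) L ++ t) ++ v)) := by rw [e2, wrd_cons]; simp
      rw [e] at hr ⊢
      exact hY.half hR hr List.infix_rfl
  replace hYhalf : 2 * Y.length ≤ (u ++ v).length := by
    rcases hYhalf with h | ⟨h1, h2⟩
    · exact h
    · rcases hnot with h | h
      · exact absurd h1 h
      · omega
  by_cases hA : 15 * Y.length ≤ (u ++ v).length
  · -- case B
    rcases L2 with _ | ⟨a, _ | ⟨b, _ | ⟨c, _ | ⟨d, L⟩⟩⟩⟩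
    · exfalso
      simp only [wrd_nil, List.length_nil] at hul
      omega
    · exfalso
      simp only [wrd_cons, wrd_nil, List.length_append, List.length_nil, fp_len] at hul
      have := hmb a (by simp)
      omega
    · exfalso
      simp only [wrd_cons, wrd_nil, List.length_append, List.length_nil, fp_len] at hul
      have := hmb a (by simp)
      have := hmb b (by simp)
      omega
    · exfalso
      simp only [wrd_cons, wrd_nil, List.length_append, List.length_nil, fp_len] at hul
      have := hmb a (by simp)
      have := hmb b (by simp)
      have := hmb c (by simp)
      omega
    · refine ⟨L1 ++ [m0], a, b, c, d :: (L ++ m1 :: L3), u ++ v, by rw [e1]; simp, hch, s, fp f d ++ (wrd (fun m => Y ++ fp f m) L ++ (t ++ v)), ?_⟩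
      rw [e2]
      simp [wrd_cons]
  · exfalso
    rcases L2 with _ | ⟨a, _ | ⟨b, L⟩⟩
    · simp only [wrd_nil, List.length_nil] at hul
      omega
    · simp only [wrd_cons, wrd_nil, List.length_append, List.length_nil, fp_len] at hul
      have h1 := hmb a (by simp)
      have h2 : 15 * H.length ≤ (u ++ v).length := by
        obtain ⟨H', hH'⟩ := hHY
        refine selfp' hR hr hch (X := s) (D := Y ++ fp f a) (t := H) (B := List.replicate n' (f, σ')) (by simp [hY.ne]) ?_
          ⟨H' ++ (fp f a ++ t), ?_⟩
        · rw [e2, htH]; simp [wrd_cons, wrd_nil]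
        · rw [e2, ← hH']; simp [wrd_cons, wrd_nil]
      have h3 : n' = 0 := by
        by_contra h
        rw [hHn (by omega)] at h2
        omega
      omega
    · apply hA
      refine selfp' hR hr hch (X := s) (D := Y ++ fp f a) (t := Y) (B := fp f b ++ (wrd (fun m => Y ++ fp f m) L ++ t)) (by simp [hY.ne]) ?_
        ⟨fp f a ++ (Y ++ (fp f b ++ (wrd (fun m => Y ++ fp f m) L ++ t))), ?_⟩
      · rw [e2]; simp [wrd_cons]
      · rw [e2]; simp [wrd_cons]

end wordlem
end Part14


section Part15
open FreeGroup
section caseB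

theorem rot_align {α : Type*} {z : α} {Bl : List (Blk α)} (hok : ∀ β ∈ Bl, OKB z β) {r : List (α × Bool)} (hr : bwd z Bl ~r r)
    {c : α × Bool} {l l' : List (α × Bool)} (h1 : r = c :: l) (hc : c ≠ (z, true)) (h2 : r = l' ++ [(z, true)]) :
    ∃ L1 L2, Bl = L1 ++ L2 ∧ r = bwd z (L2 ++ L1) := by
  obtain ⟨u, v, e1, e2⟩ := rot_split hr
  by_cases hv : v = []
  · exact ⟨[], Bl, rfl, by rw [e2, hv, List.append_nil, e1, hv]; simp⟩
  obtain ⟨c', v', hv'⟩ := List.exists_cons_of_ne_nil hv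
  have hcc : c' = c := by
    rw [h1, hv'] at e2; simp at e2; exact e2.1.symm
  have hu : u = [] ∨ ∃ u', u = u' ++ [(z, true)] := by
    rcases List.eq_nil_or_concat u with h | ⟨u', d, h⟩
    · exact Or.inl h
    · right
      refine ⟨u', ?_⟩
      rw [h2, h] at e2
      have e3 : l' ++ [(z, true)] = (v ++ u') ++ [d] := by rw [e2]; simp
      have := (List.append_inj' e3 rfl).2
      rw [h, this]; simp
  obtain ⟨L1, L2, a1, a2, a3⟩ := align hok e1 hv' (by rw [hcc]; exact hc) hu
  exact ⟨L1, L2, a1, by rw [e2, a2, a3, bwd_append]⟩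

theorem rep_decomp {α : Type*} (a : α) : ∀ l : List α, ∃ e rest, l = List.replicate e a ++ rest ∧ rest.head? ≠ some a := by
  classical
  intro l
  induction l with
  | nil => exact ⟨0, [], by simp, by simp⟩
  | cons b l ih =>
    by_cases h : b = a
    · obtain ⟨e, rest, h1, h2⟩ := ih
      exact ⟨e + 1, rest, by rw [h1, h]; simp [List.replicate_succ], h2⟩
    · exact ⟨0, b :: l, by simp, by simpa using h⟩

theorem caseB_pos {α : Type*} {x z : α} (hxz : x ≠ z) {Bl : List (Blk α)} (hok : ∀ β ∈ Bl, OKB z β) (hx : ∀ β ∈ Bl, β.1 = [(x, true)]) (hnd : Bl.Nodup)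
    (hxx : ∀ r, bwd z Bl ~r r → ¬ [(x, true), (x, true)] <:+: r) {r : List (α × Bool)} (hr : bwd z Bl ~r r)
    (hlet : ∀ l ∈ r, l = (x, true) ∨ l = (z, true)) {Q : List (α × Bool)} {n1 n2 n3 : ℕ}
    (hQh : ∃ l, Q = (x, true) :: l) (hQl : ∃ l, Q = l ++ [(x, true)])
    (h : Q ++ (List.replicate n1 (z, true) ++ (Q ++ (List.replicate n2 (z, true) ++ (Q ++ (List.replicate n3 (z, true) ++ Q))))) <:+: r) :
    Q = [(x, true)] ∧ ∃ L1 L2 L', Bl = L1 ++ L2 ∧ L2 ++ L1 = ([(x, true)], n2) :: ([(x, true)], n3) :: (L' ++ [([(x, true)], n1)]) := by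
  have hxz' : (x, true) ≠ (z, true) := by simp [hxz]
  obtain ⟨Q1, hQ1⟩ := hQh
  obtain ⟨Q2, hQ2⟩ := hQl
  have hpos : ∀ n, Q ++ (List.replicate n (z, true) ++ Q) <:+: r → 0 < n := by
    intro n hn
    by_contra h0
    have h0 : n = 0 := by omega
    apply hxx r hr
    refine List.IsInfix.trans ?_ hn
    subst h0
    refine ⟨Q2, Q1, ?_⟩
    calc Q2 ++ [(x, true), (x, true)] ++ Q1 = (Q2 ++ [(x, true)]) ++ ((x, true) :: Q1) := by simp
      _ = _ := by rw [← hQ2, ← hQ1]; simp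
  have p1 : 0 < n1 := hpos n1 (List.IsInfix.trans ⟨[], List.replicate n2 (z, true) ++ (Q ++ (List.replicate n3 (z, true) ++ Q)), by simp⟩ h)
  have p2 : 0 < n2 := hpos n2 (List.IsInfix.trans ⟨Q ++ List.replicate n1 (z, true), List.replicate n3 (z, true) ++ Q, by simp⟩ h)
  have p3 : 0 < n3 := hpos n3 (List.IsInfix.trans ⟨Q ++ (List.replicate n1 (z, true) ++ (Q ++ List.replicate n2 (z, true))), [], by simp⟩ h)
  obtain ⟨P, E, hPE⟩ := h
  obtain ⟨r2, hr2⟩ : ∃ r2, r2 = Q ++ (List.replicate n2 (z, true) ++ (Q ++ (List.replicate n3 (z, true) ++ (Q ++ (E ++ (P ++ (Q ++ List.replicate n1 (z, true)))))))) := ⟨_, rfl⟩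
  have hrr : bwd z Bl ~r r2 := by
    refine hr.trans ?_
    have := rot_app (P ++ (Q ++ List.replicate n1 (z, true))) (Q ++ (List.replicate n2 (z, true) ++ (Q ++ (List.replicate n3 (z, true) ++ (Q ++ E)))))
    rw [← hPE, hr2]
    simpa using this
  obtain ⟨k, hk⟩ : ∃ k, n1 = k + 1 := ⟨n1 - 1, by omega⟩
  obtain ⟨L1, L2, hB, hb⟩ := rot_align hok hrr (c := (x, true)) (l := Q1 ++ (List.replicate n2 (z, true) ++ (Q ++ (List.replicate n3 (z, true) ++ (Q ++ (E ++ (P ++ (Q ++ List.replicate n1 (z, true))))))))) (by rw [hr2, hQ1]; simp) hxz'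
    (l' := Q ++ (List.replicate n2 (z, true) ++ (Q ++ (List.replicate n3 (z, true) ++ (Q ++ (E ++ (P ++ (Q ++ List.replicate k (z, true))))))))) (by rw [hr2, hk, List.replicate_succ']; simp)
  have hmem : ∀ β ∈ L2 ++ L1, β ∈ Bl := by intro β h; rw [hB]; simp at h ⊢; tauto
  have hok' : ∀ β ∈ L2 ++ L1, OKB z β := fun β h => hok β (hmem β h)
  have hnd' : (L2 ++ L1).Nodup := by
    rw [hB] at hnd
    exact (List.perm_append_comm.nodup_iff).1 hnd
  have hQhead : ∀ t, (Q ++ t).head? ≠ some (z, true) := by intro t; rw [hQ1]; simp [hxz]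
  have hzx : (z, true) ∉ [(x, true)] := by simp [Ne.symm hxz]
  have hQ : Q1 = [] := by
    by_contra hne
    obtain ⟨e, rest, e1, e2⟩ := rep_decomp (z, true) Q1
    have he : 0 < e := by
      by_contra h0
      have h0 : e = 0 := by omega
      obtain ⟨c, l, hcl⟩ := List.exists_cons_of_ne_nil hne
      have hcr : c ∈ r := by rw [← hPE, hQ1, hcl]; simp
      have hcx : c = (x, true) := by
        rcases hlet c hcr with h | h
        · exact h
        · exfalso
          rw [hcl, h0] at e1
          simp at e1
          rw [← e1, h] at e2
          simp at e2
      apply hxx r hr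
      refine List.IsInfix.trans ⟨[], l, ?_⟩ (List.IsInfix.trans (List.infix_append [] Q _) ⟨P, E, hPE⟩)
      rw [hQ1, hcl, hcx]; simp
    have hrest : rest ≠ [] := by
      rintro rfl
      obtain ⟨k, hk⟩ : ∃ k, e = k + 1 := ⟨e - 1, by omega⟩
      have : Q2 ++ [(x, true)] = ((x, true) :: List.replicate k (z, true)) ++ [(z, true)] := by
        rw [← hQ2, hQ1, e1, hk, List.replicate_succ']; simp
      have := (List.append_inj' this rfl).2
      simp [hxz] at this
    have hhead : ∀ t, (rest ++ t).head? ≠ some (z, true) := by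
      intro t
      obtain ⟨c, l, hcl⟩ := List.exists_cons_of_ne_nil hrest
      rw [hcl] at e2 ⊢
      simpa using e2
    have hQe : Q = [(x, true)] ++ (List.replicate e (z, true) ++ rest) := by rw [hQ1, e1]; simp
    obtain ⟨t, ht⟩ : ∃ t, t = List.replicate n3 (z, true) ++ (Q ++ (E ++ (P ++ (Q ++ List.replicate n1 (z, true))))) := ⟨_, rfl⟩
    obtain ⟨La, a1, a2⟩ := first_blk hok' hzx he (hhead (List.replicate n2 (z, true) ++ (Q ++ t))) (by
      rw [← hb, hr2, ← ht]
      conv_lhs => rw [hQe]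
      conv_rhs => rw [hQe]
      simp)
    obtain ⟨k2, hk2⟩ : ∃ k, n2 = k + 1 := ⟨n2 - 1, by omega⟩
    obtain ⟨L3, L4, b1, b2, b3⟩ := align (Bl := La) (fun β h => hok' β (by rw [a1]; simp [h])) (u := rest ++ List.replicate n2 (z, true)) (v := Q ++ t)
      (z := (x, true)) (v' := Q1 ++ t) (by rw [a2]; simp) (by rw [hQ1]; simp) hxz' (Or.inr ⟨rest ++ List.replicate k2 (z, true), by rw [hk2, List.replicate_succ']; simp⟩)
    obtain ⟨Lb, c1, c2⟩ := first_blk (L := L4) (fun β h => hok' β (by rw [a1, b1]; simp [h])) hzx he (hhead t) (by rw [← b3, hQe]; simp)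
    rw [a1, b1, c1] at hnd'
    simp at hnd'
  have hQx : Q = [(x, true)] := by rw [hQ1, hQ]
  refine ⟨hQx, ?_⟩
  obtain ⟨La, a1, a2⟩ := first_blk hok' hzx p2 (hQhead (List.replicate n3 (z, true) ++ (Q ++ (E ++ (P ++ (Q ++ List.replicate n1 (z, true))))))) (by
    rw [← hb, hr2, ← hQx])
  obtain ⟨Lb, b1, b2⟩ := first_blk (L := La) (fun β h => hok' β (by rw [a1]; simp [h])) hzx p3 (hQhead (E ++ (P ++ (Q ++ List.replicate n1 (z, true))))) (by
    rw [a2, ← hQx])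
  rcases List.eq_nil_or_concat Lb with h0 | ⟨Lc, β, hLc⟩
  · exfalso
    rw [h0, hQ1] at b2; simp at b2
  · rw [List.concat_eq_append] at hLc
    have hβ := hx β (hmem β (by rw [a1, b1, hLc]; simp))
    obtain ⟨β1, n⟩ := β
    simp only at hβ
    subst hβ
    refine ⟨L1, L2, Lc, hB, ?_⟩
    rw [a1, b1, hLc]
    have e : List.replicate n (z, true) ++ (x, true) :: (bwd z Lc).reverse = List.replicate n1 (z, true) ++ (x, true) :: (Q ++ (E ++ P)).reverse := by
      have := congrArg List.reverse b2
      rw [hLc, bwd_append, bwd_cons, bwd_nil, hQx] at this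
      rw [hQx]
      simpa [bw] using this
    have := (rep_parse e hxz' hxz' hxz' hxz').1
    rw [this]

theorem cyc {γ : Type*} {N : ℕ} {g : ℕ → γ} {L1 L2 L' : List γ} {a b c : γ} (h : (List.range N).map g = L1 ++ L2)
    (h2 : L2 ++ L1 = a :: b :: (L' ++ [c])) : ∃ j < N, c = g j ∧ a = g ((j + 1) % N) ∧ b = g ((j + 2) % N) := by
  have hN : N = L'.length + 3 := by
    have e1 := congrArg List.length h
    have e2 := congrArg List.length h2
    simp at e1 e2
    omega
  have hrot : ((List.range N).map g).rotate L1.length = a :: b :: (L' ++ [c]) := by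
    rw [h, List.rotate_append_length_eq, h2]
  have hget : ∀ i, i < N → (a :: b :: (L' ++ [c]))[i]? = some (g ((i + L1.length) % N)) := by
    intro i hi
    rw [← hrot, List.getElem?_rotate (by simpa using hi)]
    have hlt : (i + L1.length) % N < N := Nat.mod_lt _ (by omega)
    simp [hlt]
  have h0 := hget 0 (by omega)
  have h1 := hget 1 (by omega)
  have hl := hget (L'.length + 2) (by omega)
  simp at h0 h1 hl
  refine ⟨(L'.length + 2 + L1.length) % N, Nat.mod_lt _ (by omega), hl, ?_, ?_⟩
  · rw [h0, Nat.mod_add_mod, show L'.length + 2 + L1.length + 1 = N + L1.length by omega, Nat.add_mod_left]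
  · rw [h1, Nat.mod_add_mod, show L'.length + 2 + L1.length + 2 = N + (1 + L1.length) by omega, Nat.add_mod_left]

theorem fp_nonneg {A : Type*} (f : A) {m : ℤ} (h : 0 ≤ m) : fp f m = List.replicate m.natAbs (f, true) := by
  unfold fp; simp [h]

theorem caseB_chain {A : Type} {lo : ℕ} {x z f : GenSym A} (hct : CT lo x z) {r} (hr : bwd z (chainBl lo x) ~r r) {Q : List (GenSym A × Bool)} {m1 m2 m3 : ℤ}
    (hQ : Q ≠ []) (hd : ∀ c l, Q = c :: l → c.1 ≠ f) (lt : ∀ l c, Q = l ++ [c] → c.1 ≠ f) (h12 : m1 ≠ m2) (h13 : m1 ≠ m3) (h23 : m2 ≠ m3)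
    (h : Q ++ (fp f m1 ++ (Q ++ (fp f m2 ++ (Q ++ (fp f m3 ++ Q))))) <:+: r) :
    z = f ∧ Q = [(x, true)] ∧ ∃ j < 1000, m1 = (((lo + j + 1) ^ 2 : ℕ) : ℤ) ∧ m2 = (((lo + (j + 1) % 1000 + 1) ^ 2 : ℕ) : ℤ) ∧
      m3 = (((lo + (j + 2) % 1000 + 1) ^ 2 : ℕ) : ℤ) := by
  have hlet : ∀ l ∈ r, l = (x, true) ∨ l = (z, true) := fun l hl => chain_mem (hr.mem_iff.2 hl)
  have hnn : ∀ m, fp f m <:+: r → 0 ≤ m := by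
    intro m hm
    by_contra h0
    have : (f, false) ∈ fp f m := by unfold fp; simp [h0]; omega
    rcases hlet _ (hm.subset this) with h | h <;> simp at h
  have i1 : fp f m1 <:+: r := List.IsInfix.trans ⟨Q, Q ++ (fp f m2 ++ (Q ++ (fp f m3 ++ Q))), by simp⟩ h
  have i2 : fp f m2 <:+: r := List.IsInfix.trans ⟨Q ++ (fp f m1 ++ Q), Q ++ (fp f m3 ++ Q), by simp⟩ h
  have i3 : fp f m3 <:+: r := List.IsInfix.trans ⟨Q ++ (fp f m1 ++ (Q ++ (fp f m2 ++ Q))), Q, by simp⟩ h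
  have q1 := hnn _ i1
  have q2 := hnn _ i2
  have q3 := hnn _ i3
  have hfx : f = x ∨ f = z := by
    have : ∀ m, m ≠ 0 → fp f m <:+: r → f = x ∨ f = z := by
      intro m hm hi
      have : (f, decide (0 ≤ m)) ∈ fp f m := by unfold fp; simp; omega
      rcases hlet _ (hi.subset this) with h | h <;> simp at h
      · exact Or.inl h.1
      · exact Or.inr h.1
    by_cases h0 : m1 = 0
    · exact this m2 (by omega) i2
    · exact this m1 h0 i1
  have hxx : ∀ r, bwd z (chainBl lo x) ~r r → ¬ [(x, true), (x, true)] <:+: r := fun r hr h => chain_noxx hct.ne hr h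
  have hfz : f = z := by
    rcases hfx with h | h
    · exfalso
      have : ∀ m, 0 ≤ m → fp f m <:+: r → m < 2 := by
        intro m hm hi
        by_contra h2
        apply hxx r hr
        refine List.IsInfix.trans ?_ hi
        rw [fp_nonneg f hm, h]
        exact rep_infix (k := 2) _ (by omega)
      have s1 := this m1 q1 i1
      have s2 := this m2 q2 i2
      have s3 := this m3 q3 i3
      omega
    · exact h
  have hinf : Q <:+: r := List.IsInfix.trans ⟨[], fp f m1 ++ (Q ++ (fp f m2 ++ (Q ++ (fp f m3 ++ Q)))), by simp⟩ h
  have hxl : ∀ l ∈ Q, l.1 ≠ f → l = (x, true) := by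
    intro l hl hlf
    rcases hlet l (hinf.subset hl) with h | h
    · exact h
    · rw [h, hfz] at hlf; exact absurd rfl hlf
  have hQh : ∃ l, Q = (x, true) :: l := by
    obtain ⟨c, l, e⟩ := List.exists_cons_of_ne_nil hQ
    exact ⟨l, by rw [e, hxl c (by simp [e]) (hd c l e)]⟩
  have hQl : ∃ l, Q = l ++ [(x, true)] := by
    rcases List.eq_nil_or_concat Q with e | ⟨l, c, e⟩
    · exact absurd e hQ
    · rw [List.concat_eq_append] at e
      exact ⟨l, by rw [e, hxl c (by simp [e]) (lt l c e)]⟩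
  rw [fp_nonneg f q1, fp_nonneg f q2, fp_nonneg f q3, hfz] at h
  obtain ⟨a, L1, L2, L', e1, e2⟩ := caseB_pos hct.ne (chain_ok hct.ne) (by
    intro β hβ; obtain ⟨k, _, rfl⟩ := mem_chainBl hβ; rfl) (chain_nodup lo x) hxx hr hlet hQh hQl h
  refine ⟨hfz.symm, a, ?_⟩
  rw [chainBl] at e1
  obtain ⟨j, hj, c1, c2, c3⟩ := cyc e1 e2
  refine ⟨j, hj, ?_, ?_, ?_⟩
  · have := congrArg Prod.snd c1
    simp only at this
    rw [← this]; omega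
  · have := congrArg Prod.snd c2
    simp only at this
    rw [← this]; omega
  · have := congrArg Prod.snd c3
    simp only at this
    rw [← this]; omega

end caseB
end Part15


section Part16
open FreeGroup
section nt

theorem dn (lo i : ℕ) (hi : i < 1000) :
    (i ≠ 999 ∧ (((lo + (i + 1) % 1000 + 1) ^ 2 : ℕ) : ℤ) - (((lo + i + 1) ^ 2 : ℕ) : ℤ) = 2 * (lo + i) + 3) ∨
    (i = 999 ∧ (((lo + (i + 1) % 1000 + 1) ^ 2 : ℕ) : ℤ) - (((lo + i + 1) ^ 2 : ℕ) : ℤ) = - (999 * (2 * lo + 1001))) := by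
  by_cases h : i = 999
  · right
    subst h
    refine ⟨rfl, ?_⟩
    norm_num
    ring
  · left
    refine ⟨h, ?_⟩
    rw [Nat.mod_eq_of_lt (by omega)]
    push_cast
    ring

theorem sq_bd {lo i : ℕ} (hlo : lo ≤ 4000) (hi : i < 1000) : (lo + i + 1) ^ 2 ≤ 25000000 := by
  have : (lo + i + 1) ^ 2 ≤ 5000 ^ 2 := Nat.pow_le_pow_left (by omega) 2
  omega

theorem small_dvd {p : ℕ} (hp : 10 ^ 10 < p) {a : ℤ} (h : (p : ℤ) ∣ a) (h1 : a < 10 ^ 10) (h2 : -10 ^ 10 < a) : a = 0 := by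
  apply Int.eq_zero_of_abs_lt_dvd h
  rw [abs_lt]
  have : (10 ^ 10 : ℤ) < p := by exact_mod_cast hp
  constructor <;> omega

/-- the arithmetic core -/
theorem nt_core {p : ℕ} (hp : 10 ^ 10 < p) {lo lo' i j : ℕ} (hlo : lo = 2000 ∨ lo = 3000) (hlo' : lo' = 0 ∨ lo' = 1000 ∨ lo' = 2000 ∨ lo' = 3000 ∨ lo' = 4000)
    (hi : i < 1000) (hj : j < 1000) {s m1 m2 m3 : ℤ}
    (h1 : (p : ℤ) ∣ m1 - ((((lo + j + 1) ^ 2 : ℕ) : ℤ) + s)) (h2 : (p : ℤ) ∣ m2 - ((((lo + (j + 1) % 1000 + 1) ^ 2 : ℕ) : ℤ) + s))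
    (h3 : (p : ℤ) ∣ m3 - ((((lo + (j + 2) % 1000 + 1) ^ 2 : ℕ) : ℤ) + s)) :
    (m1 = (((lo' + i + 1) ^ 2 : ℕ) : ℤ) → m2 = (((lo' + (i + 1) % 1000 + 1) ^ 2 : ℕ) : ℤ) → m3 = (((lo' + (i + 2) % 1000 + 1) ^ 2 : ℕ) : ℤ) →
      lo = lo' ∧ (p : ℤ) ∣ s) ∧
    (-m3 = (((lo' + i + 1) ^ 2 : ℕ) : ℤ) → -m2 = (((lo' + (i + 1) % 1000 + 1) ^ 2 : ℕ) : ℤ) → -m1 = (((lo' + (i + 2) % 1000 + 1) ^ 2 : ℕ) : ℤ) → False) := by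
  have a1 := dn lo j hj
  have a2 := dn lo ((j + 1) % 1000) (Nat.mod_lt _ (by omega))
  have b1 := dn lo' i hi
  have b2 := dn lo' ((i + 1) % 1000) (Nat.mod_lt _ (by omega))
  rw [show ((j + 1) % 1000 + 1) % 1000 = (j + 2) % 1000 by omega] at a2
  rw [show ((i + 1) % 1000 + 1) % 1000 = (i + 2) % 1000 by omega] at b2
  have c1 := sq_bd (lo := lo) (i := j) (by omega) hj
  have c2 := sq_bd (lo := lo) (i := (j + 1) % 1000) (by omega) (Nat.mod_lt _ (by omega))
  have c3 := sq_bd (lo := lo) (i := (j + 2) % 1000) (by omega) (Nat.mod_lt _ (by omega))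
  have d1 := sq_bd (lo := lo') (i := i) (by omega) hi
  have d2 := sq_bd (lo := lo') (i := (i + 1) % 1000) (by omega) (Nat.mod_lt _ (by omega))
  have d3 := sq_bd (lo := lo') (i := (i + 2) % 1000) (by omega) (Nat.mod_lt _ (by omega))
  generalize hA1 : (lo + j + 1) ^ 2 = A1 at *
  generalize (lo + (j + 1) % 1000 + 1) ^ 2 = A2 at *
  generalize (lo + (j + 2) % 1000 + 1) ^ 2 = A3 at *
  generalize hB1 : (lo' + i + 1) ^ 2 = B1 at *
  generalize hB2 : (lo' + (i + 1) % 1000 + 1) ^ 2 = B2 at *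
  generalize hB3 : (lo' + (i + 2) % 1000 + 1) ^ 2 = B3 at *
  have e1 := Int.dvd_sub h2 h1
  have e2 := Int.dvd_sub h3 h2
  constructor
  · intro f1 f2 f3
    have g1 := small_dvd hp e1 (by omega) (by omega)
    have g2 := small_dvd hp e2 (by omega) (by omega)
    have hA : lo = lo' ∧ A1 = B1 := by
      have hll : lo = lo' ∧ i = j := by omega
      refine ⟨hll.1, ?_⟩
      rw [← hA1, ← hB1, hll.1, hll.2]
    refine ⟨hA.1, ?_⟩
    have : s = -(m1 - ((A1 : ℤ) + s)) := by omega
    rw [this]; exact (Int.dvd_neg).2 h1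
  · intro f1 f2 f3
    have g1 := small_dvd hp e1 (by omega) (by omega)
    have g2 := small_dvd hp e2 (by omega) (by omega)
    omega

theorem invRev_fp {α : Type*} (f : α) (m : ℤ) : FreeGroup.invRev (fp f m) = fp f (-m) := by
  by_cases h : m = 0
  · subst h; simp [fp, FreeGroup.invRev]
  · unfold fp
    rw [invRev_rep, Int.natAbs_neg]
    congr 2
    by_cases h2 : 0 ≤ m
    · have : ¬ (0 ≤ -m) := by omega
      simp [h2]; omega
    · have : 0 ≤ -m := by omega
      simp [h2]; omega

theorem CT.uniq {A : Type} {lo : ℕ} {x x' z : GenSym A} (h : CT lo x z) (h' : CT lo x' z) (hlo : lo = 2000 ∨ lo = 3000) : x' = x := by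
  cases h <;> cases h' <;> first | rfl | omega

theorem invRev_infix {α : Type*} {u r : List (α × Bool)} (h : u <:+: r) : FreeGroup.invRev u <:+: FreeGroup.invRev r := by
  obtain ⟨a, b, rfl⟩ := h
  exact ⟨FreeGroup.invRev b, FreeGroup.invRev a, by simp [FreeGroup.invRev_append]⟩

variable {S : IndexedStructure} {p₁ p₂ : ℕ} {f g : GenSym S.A} {p : ℕ} {Y : List (GenSym S.A × Bool)}

theorem word_concl (hp : 10 ^ 10 < p) (hY : YC S p₁ p₂ f Y) {lo : ℕ} (hlo : lo = 2000 ∨ lo = 3000) (hct : CT lo g f) {s : ℤ} {μ : ℕ → ℤ}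
    (hμ : ∀ k, (p : ℤ) ∣ μ k - ((((lo + k + 1) ^ 2 : ℕ) : ℤ) + s)) {ms : List ℤ} (hnd : ms.Nodup)
    (hrot : (List.range 1000).map μ ~r ms) {A B : List ℤ} {m1 m2 m3 : ℤ} {r} (hms : ms = A ++ m1 :: m2 :: m3 :: B) (hr : IsCh r)
    (hi : Y ++ (fp f m1 ++ (Y ++ (fp f m2 ++ (Y ++ (fp f m3 ++ Y))))) <:+: r) : Y = [(g, true)] ∧ (p : ℤ) ∣ s := by
  obtain ⟨j, hj, j1, j2, j3⟩ : ∃ j < 1000, m1 = μ j ∧ m2 = μ ((j + 1) % 1000) ∧ m3 = μ ((j + 2) % 1000) := by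
    have h1 : (List.range 1000).map μ ~r m2 :: m3 :: ((B ++ A) ++ [m1]) := by
      refine hrot.trans ?_
      have := rot_app (A ++ [m1]) (m2 :: m3 :: B)
      rw [hms]
      simpa using this
    obtain ⟨L1, L2, e1, e2⟩ := rot_split h1
    exact cyc e1 e2.symm
  have h3 : m1 ≠ m2 ∧ m1 ≠ m3 ∧ m2 ≠ m3 := by
    rw [hms] at hnd
    have := (List.nodup_append.1 hnd).2.1
    simp at this
    tauto
  obtain ⟨h12, h13, h23⟩ := h3
  have k1 := hμ j
  have k2 := hμ ((j + 1) % 1000)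
  have k3 := hμ ((j + 2) % 1000)
  rw [← j1] at k1
  rw [← j2] at k2
  rw [← j3] at k3
  obtain ⟨lo', x, z, hct', hr | hr⟩ := hr
  · obtain ⟨rfl, hQ, i, hi, n1, n2, n3⟩ := caseB_chain hct' hr hY.ne hY.hd hY.lt h12 h13 h23 hi
    obtain ⟨rfl, hs⟩ := (nt_core hp hlo hct'.lo hi hj k1 k2 k3).1 n1 n2 n3
    exact ⟨by rw [hQ, hct.uniq hct' hlo], hs⟩
  · exfalso
    have hi' := invRev_infix hi
    have he : FreeGroup.invRev (Y ++ (fp f m1 ++ (Y ++ (fp f m2 ++ (Y ++ (fp f m3 ++ Y)))))) =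
        FreeGroup.invRev Y ++ (fp f (-m3) ++ (FreeGroup.invRev Y ++ (fp f (-m2) ++ (FreeGroup.invRev Y ++ (fp f (-m1) ++ FreeGroup.invRev Y))))) := by
      simp [FreeGroup.invRev_append, invRev_fp]
    rw [he] at hi'
    obtain ⟨-, hQ, i, hi, n1, n2, n3⟩ := caseB_chain hct' hr (Q := FreeGroup.invRev Y) (by
        intro h
        have := congrArg List.length h
        rw [FreeGroup.invRev_length] at this
        exact hY.ne (List.length_eq_zero_iff.1 this)) (by
        intro c l h
        refine hY.lt (FreeGroup.invRev l) (c.1, !c.2) ?_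
        rw [← FreeGroup.invRev_invRev (L₁ := Y), h]
        simp [FreeGroup.invRev]) (by
        intro l c h
        refine hY.hd (c.1, !c.2) (FreeGroup.invRev l) ?_
        rw [← FreeGroup.invRev_invRev (L₁ := Y), h]
        simp [FreeGroup.invRev]) (by omega) (by omega) (by omega) hi'
    exact (nt_core hp hlo hct'.lo hi hj k1 k2 k3).2 n1 n2 n3

end nt
end Part16


section Part17
open FreeGroup
section mainl
variable {S : IndexedStructure} {p₁ p₂ : ℕ} {f g : GenSym S.A} {p : ℕ}

theorem gen_pow (hf : FP p₁ p₂ f p) : gen S p₁ p₂ f ^ p = 1 := by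
  have h : List.replicate p (f, true) ∈ RR S p₁ p₂ := Or.inl (Or.inr ⟨f, p, hf, rfl⟩)
  have := ev_R h
  unfold ev at this
  rw [mk_rep, _root_.map_pow] at this
  exact this

theorem zpow_congr {G : Type*} [Group G] {F : G} {p : ℕ} (h : F ^ p = 1) {a b : ℤ} (hd : (p : ℤ) ∣ a - b) : F ^ a = F ^ b := by
  obtain ⟨k, hk⟩ := hd
  rw [show a = p * k + b by omega, zpow_add, zpow_mul, zpow_natCast, h, one_zpow, one_mul]

theorem exists_min (hR : SymR (RR S p₁ p₂)) (hf : FP p₁ p₂ f p) (y : GA S p₁ p₂) (hy : y ^ p ≠ 1) :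
    ∃ (i j : ℤ) (Y : List (GenSym S.A × Bool)), y = gen S p₁ p₂ f ^ i * ev S p₁ p₂ Y * gen S p₁ p₂ f ^ j ∧ YC S p₁ p₂ f Y := by
  classical
  set F := gen S p₁ p₂ f with hF
  have hFp : F ^ p = 1 := gen_pow hf
  let P : ℕ → Prop := fun n => ∃ (i j : ℤ) (w : List (GenSym S.A × Bool)), y = F ^ i * ev S p₁ p₂ w * F ^ j ∧ w.length = n
  have hex : ∃ n, P n := by
    obtain ⟨w, hw⟩ := ev_surj y
    exact ⟨_, 0, 0, w, by simp [hw], rfl⟩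
  have hmin : ∀ (i j : ℤ) (w : List (GenSym S.A × Bool)), y = F ^ i * ev S p₁ p₂ w * F ^ j → Nat.find hex ≤ w.length :=
    fun i j w h => Nat.find_min' hex ⟨i, j, w, h, rfl⟩
  obtain ⟨i, j, w, hw, hl⟩ := Nat.find_spec hex
  have he : ev S p₁ p₂ (FreeGroup.mk w).toWord = ev S p₁ p₂ w := by unfold ev; rw [FreeGroup.mk_toWord]
  have hle : (FreeGroup.mk w).toWord.length ≤ w.length := FreeGroup.norm_mk_le
  generalize hY : (FreeGroup.mk w).toWord = Y at *
  have hw' : y = F ^ i * ev S p₁ p₂ Y * F ^ j := by rw [he, hw]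
  have hsg : ∀ c : GenSym S.A × Bool, c.1 = f → ∃ e : ℤ, ev S p₁ p₂ [c] = F ^ e := by
    rintro ⟨c, b⟩ hc
    simp only at hc
    rw [hc]
    cases b
    · exact ⟨-1, by rw [hF, ← ev_fp]; rfl⟩
    · exact ⟨1, by rw [hF, ← ev_fp]; rfl⟩
  refine ⟨i, j, Y, hw', ?_, ?_, ?_, ?_, ?_⟩
  · intro h
    apply hy
    rw [hw', h, ev_nil, mul_one, ← zpow_add, ← zpow_natCast, ← zpow_mul, mul_comm, zpow_mul, zpow_natCast, hFp, one_zpow]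
  · rw [← hY]; exact isReduced_toWord
  · intro c l e hc
    obtain ⟨ε, h⟩ := hsg c hc
    have := hmin (i + ε) j l (by
      rw [hw', e, show c :: l = [c] ++ l from rfl, ev_app, h, zpow_add]; group)
    have e2 := congrArg List.length e
    rw [List.length_cons] at e2
    omega
  · intro l c e hc
    obtain ⟨ε, h⟩ := hsg c hc
    have := hmin i (ε + j) l (by
      rw [hw', e, ev_app, h, zpow_add]; group)
    have e2 := congrArg List.length e
    rw [List.length_append, List.length_singleton] at e2
    omega
  · rintro u v hr ⟨a, b, e⟩
    have h1 := ev_R hr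
    rw [ev_app] at h1
    have h2 : ev S p₁ p₂ u = ev S p₁ p₂ (FreeGroup.invRev v) := by rw [ev_inv]; exact eq_inv_of_mul_eq_one_left h1
    have := hmin i j (a ++ FreeGroup.invRev v ++ b) (by
      rw [hw', ← e]; simp only [ev_app, h2])
    have e2 := congrArg List.length e
    simp only [List.length_append, FreeGroup.invRev_length] at this e2
    omega

theorem exists_rot {ms : List ℤ} {Bd : ℤ → Prop} (hne : ms ≠ []) (hnd : ms.Nodup) (hu : ∀ m ∈ ms, ∀ m' ∈ ms, Bd m → Bd m' → m = m') :
    ∃ M z, ms ~r M ++ [z] ∧ ∀ m ∈ M, ¬ Bd m := by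
  by_cases h : ∃ z ∈ ms, Bd z
  · obtain ⟨z, hz, hb⟩ := h
    obtain ⟨A, B, e⟩ := List.append_of_mem hz
    have hr : ms ~r (B ++ A) ++ [z] := by
      rw [e]
      have := rot_app (A ++ [z]) B
      simpa using this
    refine ⟨B ++ A, z, hr, fun m hm hbm => ?_⟩
    have hmz := hu m (hr.mem_iff.2 (by simp only [List.mem_append] at *; tauto)) z hz hbm hb
    have := hr.nodup_iff.1 hnd
    rw [List.nodup_append] at this
    exact this.2.2 m hm z (by simp) hmz
  · push Not at h
    rcases List.eq_nil_or_concat ms with e | ⟨M, z, e⟩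
    · exact absurd e hne
    · rw [List.concat_eq_append] at e
      refine ⟨M, z, by rw [e], fun m hm => h m (by rw [e]; simp [hm])⟩

theorem ev_wrd (B : ℤ → List (GenSym S.A × Bool)) (L : List ℤ) : ev S p₁ p₂ (wrd B L) = (L.map fun m => ev S p₁ p₂ (B m)).prod := by
  induction L with
  | nil => rw [wrd_nil, ev_nil]; rfl
  | cons m L ih => rw [wrd_cons, ev_app, ih, List.map_cons, List.prod_cons]

theorem prod_conj {G : Type*} [Group G] (c : G) (a b : ℕ → G) (h : ∀ k, a k = c * b k * c⁻¹) (L : List ℕ) :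
    (L.map a).prod = c * (L.map b).prod * c⁻¹ := by
  induction L with
  | nil => simp
  | cons k L ih => rw [List.map_cons, List.prod_cons, ih, h, List.map_cons, List.prod_cons]; group

theorem bmod_bd {p : ℕ} (hp : 0 < p) (x : ℤ) : 2 * (x.bmod p).natAbs ≤ p := by
  have h1 := Int.le_bmod (x := x) hp
  have h2 := Int.bmod_lt (x := x) hp
  omega

theorem main_lemma (h1 : 10 ^ 10 < p₁) (h2 : 10 ^ 10 < p₂) (hf : FP p₁ p₂ f p) {lo : ℕ} (hlo : lo = 2000 ∨ lo = 3000) (hct : CT lo g f)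
    (y : GA S p₁ p₂) (hy : chainProd lo y (gen S p₁ p₂ f) = 1) (hyp : y ^ p ≠ 1) :
    ∃ i : ℤ, y = gen S p₁ p₂ f ^ i * gen S p₁ p₂ g * gen S p₁ p₂ f ^ (-i) := by
  have hp : 10 ^ 10 < p := by rcases hf with ⟨_, rfl⟩ | ⟨_, rfl⟩ <;> assumption
  have hR := symRR (S := S) h1 h2
  have hFp : gen S p₁ p₂ f ^ p = 1 := gen_pow hf
  obtain ⟨i, j, Y, e, hY⟩ := exists_min hR hf y hyp
  obtain ⟨μ, hμd⟩ : ∃ μ : ℕ → ℤ, ∀ k, μ k = (((((lo + k + 1) ^ 2 : ℕ) : ℤ) + (i + j)).bmod p) := ⟨_, fun _ => rfl⟩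
  have hμ : ∀ k, (p : ℤ) ∣ μ k - ((((lo + k + 1) ^ 2 : ℕ) : ℤ) + (i + j)) := by
    intro k; rw [hμd]; exact Int.dvd_bmod_sub_self
  have hb : ∀ k, 2 * (μ k).natAbs ≤ p := by
    intro k; rw [hμd]; exact bmod_bd (by omega) _
  have hnd : ((List.range 1000).map μ).Nodup := by
    refine List.Nodup.map_on ?_ List.nodup_range
    intro a ha b hb hab
    have ha := List.mem_range.1 ha
    have hb := List.mem_range.1 hb
    have d := Int.dvd_sub (hμ b) (hμ a)
    rw [hab] at d
    have ca := sq_bd (lo := lo) (i := a) (by omega) ha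
    have cb := sq_bd (lo := lo) (i := b) (by omega) hb
    have := small_dvd hp d (by omega) (by omega)
    have h3 : (lo + a + 1) ^ 2 = (lo + b + 1) ^ 2 := by omega
    have h4 := Nat.pow_left_injective (n := 2) (by omega) h3
    omega
  have hbd : ∀ m ∈ (List.range 1000).map μ, 2 * m.natAbs ≤ p := by
    intro m hm
    obtain ⟨k, _, hk⟩ := List.mem_map.1 hm
    rw [← hk]; exact hb k
  have hne : (List.range 1000).map μ ≠ [] := by
    intro h
    have := congrArg List.length h
    rw [List.length_map, List.length_range] at this
    simp at this
  have hev : ev S p₁ p₂ (wrd (fun m => Y ++ fp f m) ((List.range 1000).map μ)) = 1 := by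
    rw [ev_wrd, List.map_map]
    unfold chainProd at hy
    rw [prod_conj (gen S p₁ p₂ f ^ i) _ ((fun m => ev S p₁ p₂ (Y ++ fp f m)) ∘ μ)] at hy
    · have := congrArg (fun t => (gen S p₁ p₂ f ^ i)⁻¹ * t * gen S p₁ p₂ f ^ i) hy
      simp only [mul_one, inv_mul_cancel] at this
      rw [← this]
      group
    · intro k
      rw [Function.comp_apply, ev_app, ev_fp, zpow_congr hFp (hμ k), e, ← zpow_natCast]
      generalize gen S p₁ p₂ f = F
      generalize (((lo + k + 1) ^ 2 : ℕ) : ℤ) = n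
      generalize ev S p₁ p₂ Y = Z
      rw [show n + (i + j) = j + n + i by ring, zpow_add, zpow_add]
      group
  obtain ⟨M, z, hrot, hnb⟩ := exists_rot (Bd := Bad S p₁ p₂ f Y) hne hnd
    (fun m hm m' hm' hb hb' => bad_uniq hR hf hp hY (hbd m hm) (hbd m' hm') hb hb')
  generalize hms : M ++ [z] = ms at hrot
  have hev2 : ev S p₁ p₂ (wrd (fun m => Y ++ fp f m) ms) = 1 := by
    obtain ⟨L1, L2, a1, a2⟩ := rot_split hrot
    rw [a1, wrd_append, ev_app] at hev
    rw [a2, wrd_append, ev_app]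
    exact mul_eq_one_comm.1 hev
  have hred := wrd_red hY M z hnb
  rw [hms] at hred
  obtain ⟨u, v, hr, hu, h5⟩ := ev_green h1 h2 hred (by
    rw [← hms, wrd_append, wrd_cons]
    intro h
    have := congrArg List.length h
    simp only [List.length_append, List.length_nil] at this
    have := List.length_pos_iff.2 hY.ne
    omega) hev2
  have hnd2 := hrot.nodup_iff.1 hnd
  obtain ⟨A, m1, m2, m3, B, r, q1, q2, q3⟩ := word_chunk hR hf hp hY hms.symm hnb hnd2
    (fun m hm => hbd m (hrot.mem_iff.2 hm)) ⟨hr, h5⟩ hu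
  obtain ⟨hYg, hs⟩ := word_concl hp hY hlo hct hμ hnd2 hrot q1 q2 q3
  refine ⟨i, ?_⟩
  rw [e, hYg, ev_gen, zpow_congr hFp (a := -i) (b := j)]
  rw [show -i - j = -(i + j) by ring]
  exact Int.dvd_neg.2 hs

end mainl
end Part17


section Part18
open FreeGroup
section finalsec
variable {S : IndexedStructure} {p₁ p₂ : ℕ}

theorem red_fp_app {A : Type*} {f : A} {m : ℤ} {B : List (A × Bool)} (hB : FreeGroup.IsReduced B) (hh : ∀ x l, B = x :: l → x.1 ≠ f) :
    FreeGroup.IsReduced (fp f m ++ B) := by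
  unfold FreeGroup.IsReduced
  rw [List.isChain_append]
  refine ⟨fp_red f m, hB, ?_⟩
  intro x hx z hz hxz
  exfalso
  have h1 := mem_fp (List.mem_of_mem_getLast? hx)
  rcases B with _ | ⟨q, B⟩
  · simp at hz
  · simp at hz
    exact hh q B rfl (by rw [hz, ← hxz, h1])

theorem red_cons' {A : Type*} {x : A × Bool} {B : List (A × Bool)} (hB : FreeGroup.IsReduced B) (hh : ∀ z l, B = z :: l → z.1 ≠ x.1) :
    FreeGroup.IsReduced ([x] ++ B) := by
  unfold FreeGroup.IsReduced
  rw [List.isChain_append]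
  refine ⟨List.isChain_singleton _, hB, ?_⟩
  intro x' hx z hz hxz
  exfalso
  rcases B with _ | ⟨q, B⟩
  · simp at hz
  · simp at hz hx
    exact hh q B rfl (by rw [hz, ← hxz, hx])

theorem fp_head {A : Type*} {f : A} {m : ℤ} (hm : m ≠ 0) {B : List (A × Bool)} {x l} (h : fp f m ++ B = x :: l) : x.1 = f := by
  have h0 := fp_ne (f := f) hm
  obtain ⟨x', l', e⟩ := List.exists_cons_of_ne_nil h0
  rw [e, List.cons_append] at h
  have hx : x' = x := (List.cons.inj h).1
  exact mem_fp (m := m) (by rw [e, hx]; simp)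

theorem RR_g {r} (hr : r ∈ RR S p₁ p₂) {l : GenSym S.A × Bool} (hl : l ∈ r) (hb : l.1 ≠ GenSym.b) (ha : ∀ a, l.1 ≠ GenSym.elt a) :
    (∃ f p s, FP p₁ p₂ f p ∧ r = List.replicate p (f, s)) ∨ IsCh r := by
  have key : ∀ r ∈ Rpos S p₁ p₂, ∀ l ∈ r, l.1 ≠ GenSym.b → (∀ a, l.1 ≠ GenSym.elt a) → (∃ f p s, FP p₁ p₂ f p ∧ r = List.replicate p (f, s)) ∨ IsCh r := by
    rintro r (⟨y, bad, good, h, hr⟩ | ⟨f', p', hf', rfl⟩) l hl hb ha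
    · right
      have := h.lett _ (hr.mem_iff.2 hl)
      cases h with
      | @ch lo x y hct =>
        rw [List.nil_append] at hr
        exact ⟨lo, x, y, hct, Or.inl hr⟩
      | w =>
        exfalso
        rcases this with h | ⟨_, x, h, _⟩ | ⟨_, a, h⟩
        · exact hb (by rw [h])
        · cases h
        · exact ha a h
    · left
      exact ⟨f', p', true, hf', rfl⟩
  rcases hr with hr | hr
  · exact key r hr l hl hb ha
  · rcases key _ hr (l.1, !l.2) (mem_invRev.2 (by simpa using hl)) hb ha with ⟨f, p, s, h1, h⟩ | h
    · left
      refine ⟨f, p, !s, h1, ?_⟩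
      rw [← FreeGroup.invRev_invRev (L₁ := r), h, invRev_rep]
    · right
      rw [← FreeGroup.invRev_invRev (L₁ := r)]; exact h.inv

def Bnd {α : Type*} (U X : List α) (a : ℕ) : Prop := ∀ t, t <:+: X → t <:+: U → 15 * t.length ≤ a

theorem Bnd.app {α : Type*} {U X Z : List α} {a b : ℕ} (h1 : Bnd U X a) (h2 : Bnd U Z b) : Bnd U (X ++ Z) (a + b) := by
  intro t ht hU
  rcases infix_app ht with h | h | ⟨s, q, _, _, hs, hq, e⟩
  · have := h1 t h hU; omega
  · have := h2 t h hU; omega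
  · have k1 := h1 s hs.isInfix (List.IsInfix.trans ⟨[], q, by rw [e]; simp⟩ hU)
    have k2 := h2 q hq.isInfix (List.IsInfix.trans ⟨s, [], by rw [e]; simp⟩ hU)
    rw [e, List.length_append]; omega

theorem count_fp {A : Type*} [DecidableEq A] (f f' : A) (s : Bool) (m : ℤ) (hm : m ≠ 0) :
    (fp f m).count (f', s) + (fp f (-m)).count (f', s) ≤ if f = f' then m.natAbs else 0 := by
  unfold fp
  rw [List.count_replicate, List.count_replicate, Int.natAbs_neg]
  by_cases h : f = f'
  · rw [if_pos h]
    subst h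
    by_cases h0 : 0 ≤ m
    · have h1 : ¬ (0 ≤ -m) := by omega
      cases s <;> simp [h0] <;> (try split_ifs) <;> omega
    · have h1 : 0 ≤ -m := by omega
      cases s <;> simp [h0] <;> (try split_ifs) <;> omega
  · simp [h]

theorem sep (h1 : 10 ^ 10 < p₁) (h2 : 10 ^ 10 < p₂) {g : GenSym S.A} (hg : g = GenSym.c ∨ g = GenSym.d) {i j : ℤ}
    (hi : 2 * i.natAbs ≤ p₁) (hj : 2 * j.natAbs ≤ p₂) (hi0 : i ≠ 0) (hj0 : j ≠ 0)
    (he : gen S p₁ p₂ GenSym.f1 ^ i * gen S p₁ p₂ g * gen S p₁ p₂ GenSym.f1 ^ (-i) =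
      gen S p₁ p₂ GenSym.f2 ^ j * gen S p₁ p₂ g * gen S p₁ p₂ GenSym.f2 ^ (-j)) : False := by
  classical
  have hR := symRR (S := S) h1 h2
  have g1 : g ≠ GenSym.f1 := by rcases hg with h | h <;> rw [h] <;> simp
  have g2 : g ≠ GenSym.f2 := by rcases hg with h | h <;> rw [h] <;> simp
  have gb : g ≠ GenSym.b := by rcases hg with h | h <;> rw [h] <;> simp
  have ga : ∀ a, g ≠ GenSym.elt a := by rcases hg with h | h <;> rw [h] <;> simp
  obtain ⟨w, hw⟩ : ∃ w : List (GenSym S.A × Bool), w = fp GenSym.f1 i ++ ([(g, true)] ++ (fp GenSym.f1 (-i) ++ (fp GenSym.f2 j ++ ([(g, false)] ++ (fp GenSym.f2 (-j) ++ []))))) := ⟨_, rfl⟩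
  have hred : FreeGroup.IsReduced w := by
    rw [hw]
    apply red_fp_app
    · apply red_cons'
      · apply red_fp_app
        · apply red_fp_app
          · apply red_cons'
            · apply red_fp_app
              · exact List.isChain_nil
              · intro x l h; simp at h
            · intro x l h
              rw [fp_head (by omega) h]; exact g2.symm
          · intro x l h
            rw [← (List.cons.inj h).1]; exact g2
        · intro x l h
          rw [fp_head hj0 h]; simp
      · intro x l h
        rw [fp_head (by omega) h]; exact g1.symm
    · intro x l h
      rw [← (List.cons.inj h).1]; exact g1
  have hne : w ≠ [] := by rw [hw]; simp
  have hev : ev S p₁ p₂ w = 1 := by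
    have hgf : ev S p₁ p₂ [(g, false)] = (gen S p₁ p₂ g)⁻¹ := by
      rw [← ev_gen, ← ev_inv]; rfl
    rw [hw]
    simp only [ev_app, ev_fp, ev_gen, hgf, ev_nil]
    have := congrArg (fun t => t * (gen S p₁ p₂ GenSym.f2 ^ j * gen S p₁ p₂ g * gen S p₁ p₂ GenSym.f2 ^ (-j))⁻¹) he
    simp only [mul_inv_cancel] at this
    refine Eq.trans ?_ this
    group
  obtain ⟨u, v, hr, hu, h5⟩ := ev_green h1 h2 hred hne hev
  have hlen : (u ++ v).length = u.length + v.length := List.length_append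
  have hpos : 0 < (u ++ v).length := List.length_pos_iff.2 (hR.ne _ hr)
  have hu0 : u ≠ [] := by
    intro h
    rw [h] at hlen h5 hpos
    simp only [List.length_nil, List.nil_append] at *
    omega
  obtain ⟨l, t, hlt⟩ := List.exists_cons_of_ne_nil hu0
  have hlu : l ∈ u := by rw [hlt]; simp
  have hlw : l ∈ w := hu.subset hlu
  have hl1 : l.1 = GenSym.f1 ∨ l.1 = GenSym.f2 ∨ l.1 = g := by
    rw [hw] at hlw
    simp only [List.mem_append, List.mem_singleton, List.not_mem_nil, or_false] at hlw
    rcases hlw with h | h | h | h | h | h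
    · exact Or.inl (mem_fp h)
    · rw [h]; simp
    · exact Or.inl (mem_fp h)
    · exact Or.inr (Or.inl (mem_fp h))
    · rw [h]; simp
    · exact Or.inr (Or.inl (mem_fp h))
  rcases RR_g hr (List.mem_append_left v hlu) (by
      rcases hl1 with h | h | h <;> rw [h]
      · simp
      · simp
      · exact gb) (by
      rcases hl1 with h | h | h <;> rw [h]
      · simp
      · simp
      · exact ga) with ⟨f, p, s, hf, hrep⟩ | hch
  · have hlp : (u ++ v).length = p := by rw [hrep, List.length_replicate]
    have hue : u = List.replicate u.length (f, s) := by
      rw [List.eq_replicate_iff]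
      refine ⟨rfl, fun b hb => ?_⟩
      have : b ∈ u ++ v := List.mem_append_left v hb
      rw [hrep] at this
      exact List.eq_of_mem_replicate this
    have hc : u.count (f, s) = u.length := by
      rw [hue]; simp
    have hcw : u.count (f, s) ≤ w.count (f, s) := hu.sublist.count_le _
    have c1 := count_fp (A := GenSym S.A) GenSym.f1 f s i hi0
    have c2 := count_fp (A := GenSym S.A) GenSym.f2 f s j hj0
    have hgf : ∀ b, [(g, b)].count (f, s) = 0 := by
      intro b
      rw [List.count_eq_zero]
      intro h
      rw [List.mem_singleton] at h
      have : f = g := (Prod.mk.inj h).1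
      rcases hf with ⟨rfl, _⟩ | ⟨rfl, _⟩
      · exact g1 this.symm
      · exact g2 this.symm
    rw [hw] at hcw
    simp only [List.count_append, hgf, List.count_nil] at hcw
    rcases hf with ⟨rfl, rfl⟩ | ⟨rfl, rfl⟩
    · rw [if_pos rfl] at c1
      rw [if_neg (by simp)] at c2
      omega
    · rw [if_pos rfl] at c2
      rw [if_neg (by simp)] at c1
      omega
  · have hl7 := hch.len
    have bf : ∀ (f : GenSym S.A) (m : ℤ), Bnd u (fp f m) ((u ++ v).length + 15) := by
      intro f m t ht hU
      have e : t = List.replicate t.length (f, decide (0 ≤ m)) := by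
        rw [List.eq_replicate_iff]
        exact ⟨rfl, fun b hb => List.eq_of_mem_replicate (ht.subset hb)⟩
      rw [e] at hU
      exact gapb hR hr hch hU
    have bg : ∀ x : GenSym S.A × Bool, Bnd u [x] 15 := by
      intro x t ht _
      have := ht.length_le
      simp at this
      omega
    have bn : Bnd u ([] : List (GenSym S.A × Bool)) 0 := by
      intro t ht _
      have := ht.length_le
      simp at this
      simp [this]
    have hB := (bf GenSym.f1 i).app ((bg (g, true)).app ((bf GenSym.f1 (-i)).app ((bf GenSym.f2 j).app ((bg (g, false)).app ((bf GenSym.f2 (-j)).app bn)))))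
    rw [← hw] at hB
    have := hB u hu List.infix_rfl
    omega

theorem final (h1 : 10 ^ 10 < p₁) (h2 : 10 ^ 10 < p₂) {g : GenSym S.A} {lo : ℕ} (hlo : lo = 2000 ∨ lo = 3000)
    (hg : g = GenSym.c ∨ g = GenSym.d) (k1 : CT lo g GenSym.f1) (k2 : CT lo g GenSym.f2)
    (y : GA S p₁ p₂) (e1 : chainProd lo y (gen S p₁ p₂ GenSym.f1) = 1) (e2 : chainProd lo y (gen S p₁ p₂ GenSym.f2) = 1)
    (n1 : y ^ p₁ ≠ 1) (n2 : y ^ p₂ ≠ 1) : y = gen S p₁ p₂ g := by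
  have hf1 : FP p₁ p₂ (GenSym.f1 : GenSym S.A) p₁ := Or.inl ⟨rfl, rfl⟩
  have hf2 : FP p₁ p₂ (GenSym.f2 : GenSym S.A) p₂ := Or.inr ⟨rfl, rfl⟩
  obtain ⟨i, hi⟩ := main_lemma h1 h2 hf1 hlo k1 y e1 n1
  obtain ⟨j, hj⟩ := main_lemma h1 h2 hf2 hlo k2 y e2 n2
  have red : ∀ (p : ℕ) (i : ℤ) (F : GA S p₁ p₂), F ^ p = 1 → F ^ i = F ^ (i.bmod p) ∧ F ^ (-i) = F ^ (-(i.bmod p)) := by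
    intro p i F hF
    have : F ^ i = F ^ (i.bmod p) := zpow_congr hF (by
      have := Int.dvd_bmod_sub_self (x := i) (m := p)
      rw [← Int.dvd_neg] at this
      simpa using this)
    exact ⟨this, by rw [zpow_neg, this, zpow_neg]⟩
  obtain ⟨a1, a2⟩ := red p₁ i _ (gen_pow hf1)
  obtain ⟨b1, b2⟩ := red p₂ j _ (gen_pow hf2)
  rw [a1, a2] at hi
  rw [b1, b2] at hj
  have bi := bmod_bd (p := p₁) (by omega) i
  have bj := bmod_bd (p := p₂) (by omega) j
  generalize i.bmod p₁ = i' at *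
  generalize j.bmod p₂ = j' at *
  by_cases hi0 : i' = 0
  · rw [hi, hi0]; simp
  by_cases hj0 : j' = 0
  · rw [hj, hj0]; simp
  exact (sep h1 h2 hg bi bj hi0 hj0 (hi.symm.trans hj)).elim

end finalsec
end Part18

/-- Lemma `lem:uu`(3),(4): in `G(𝒜)`, if `u_c(y,f₁) = u_c(y,f₂) = e`
but `y^{p₁} ≠ e` and `y^{p₂} ≠ e`, then `y = c`; and if `u_d(z,f₁) = u_d(z,f₂) = e`
but `z^{p₁} ≠ e` and `z^{p₂} ≠ e`, then `z = d`. -/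
theorem stmt_2 (S : IndexedStructure) (p₁ p₂ : ℕ)
    (hp₁ : p₁.Prime) (hp₂ : p₂.Prime) (hne : p₁ ≠ p₂)
    (hbig₁ : 10 ^ 10 < p₁) (hbig₂ : 10 ^ 10 < p₂) :
    (∀ y : GA S p₁ p₂,
      chainProd 2000 y (gen S p₁ p₂ GenSym.f1) = 1 →
      chainProd 2000 y (gen S p₁ p₂ GenSym.f2) = 1 →
      y ^ p₁ ≠ 1 → y ^ p₂ ≠ 1 → y = gen S p₁ p₂ GenSym.c) ∧
    (∀ z : GA S p₁ p₂,
      chainProd 3000 z (gen S p₁ p₂ GenSym.f1) = 1 →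
      chainProd 3000 z (gen S p₁ p₂ GenSym.f2) = 1 →
      z ^ p₁ ≠ 1 → z ^ p₂ ≠ 1 → z = gen S p₁ p₂ GenSym.d) := by
  exact ⟨fun y a b c d => final hbig₁ hbig₂ (Or.inl rfl) (Or.inl rfl) .c1 .c2 y a b c d,
    fun y a b c d => final hbig₁ hbig₂ (Or.inr rfl) (Or.inr rfl) .d1 .d2 y a b c d⟩
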